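/- arXiv:1305.0064 — 4 statements merged into one kernel-verified Lean document; each statement's English description precedes it below -/
import Mathlib

section
/- Let G(n) denote the number of strict partial orders on Fin n (equivalently, the number of distinct games on a set of n time points, a game being determined by a strict partial ordering of the time points), and let S(n) = Σ_{i=1}^{n} Σ_{j=1}^{n-i} (n choose i) · ((n - i) choose j) · (2^i - 1)^j · (2^j - 1)^{n-i-j}. Then G(n) is asymptotically equal to S(n), i.e., the ratio G(n)/S(n) tends to 1 as n → ∞. -/
open Filter Asymptotics

/-- `G n` is the number of strict partial orders on `Fin n`, i.e. the number of
distinct games on a set of `n` time points. -/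
noncomputable def numGames (n : ℕ) : ℕ :=
  Nat.card {r : Fin n → Fin n → Prop // IsStrictOrder (Fin n) r}

/-- `S n = Σ_{i=1}^{n} Σ_{j=1}^{n-i} C(n,i) C(n-i,j) (2^i-1)^j (2^j-1)^{n-i-j}`. -/
def kleitmanRothschildSum (n : ℕ) : ℕ :=
  ∑ i ∈ Finset.Icc 1 n, ∑ j ∈ Finset.Icc 1 (n - i),
    n.choose i * (n - i).choose j * (2 ^ i - 1) ^ j * (2 ^ j - 1) ^ (n - i - j)

namespace KR
open Finset Relation
open scoped Classical

/-- edge relation of a digraph given by lower neighbourhoods -/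
def rel {V : Type} (G : V → Finset V) (x y : V) : Prop := x ∈ G y

/-- Hasse digraph: no edge is parallel to a longer directed path (in particular acyclic). -/
def Hasse {V : Type} (G : V → Finset V) : Prop :=
  ∀ x y z, x ∈ G y → TransGen (rel G) x z → ¬ TransGen (rel G) z y

section basic
variable {V : Type} {G : V → Finset V}

theorem Hasse.acyc (h : Hasse G) (x : V) : ¬ TransGen (rel G) x x := by
  intro hx
  have : ∃ y, rel G x y := by
    rcases (TransGen.head'_iff).1 hx with ⟨y, hy, _⟩
    exact ⟨y, hy⟩
  obtain ⟨y, hy⟩ := this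
  exact h x y x hy hx (TransGen.single hy)

theorem Hasse.irr (h : Hasse G) (x : V) : x ∉ G x := fun hx => h.acyc x (TransGen.single hx)

theorem tg1 {x y : V} (h : x ∈ G y) : TransGen (rel G) x y := TransGen.single h
theorem tg2 {x y z : V} (h : x ∈ G y) (h' : y ∈ G z) : TransGen (rel G) x z := (tg1 h).trans (tg1 h')

theorem Hasse.asymm (h : Hasse G) {x y : V} (hx : x ∈ G y) : y ∉ G x :=
  fun hy => h.acyc x (tg2 hx hy)

/-- no path of length two has a parallel or closing edge -/
theorem Hasse.tri1 (h : Hasse G) {x y z : V} (hx : x ∈ G y) (hy : y ∈ G z) : x ∉ G z :=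
  fun hz => h x z y hz (tg1 hx) (tg1 hy)
theorem Hasse.tri2 (h : Hasse G) {x y z : V} (hx : x ∈ G y) (hy : y ∈ G z) : z ∉ G x :=
  fun hz => h.acyc x ((tg2 hx hy).trans (tg1 hz))
theorem Hasse.quad1 (h : Hasse G) {x y z w : V} (hx : x ∈ G y) (hy : y ∈ G z) (hz : z ∈ G w) :
    x ∉ G w := fun hw => h x w y hw (tg1 hx) (tg2 hy hz)
theorem Hasse.quad2 (h : Hasse G) {x y z w : V} (hx : x ∈ G y) (hy : y ∈ G z) (hz : z ∈ G w) :
    w ∉ G x := fun hw => h.acyc x ((tg1 hx).trans ((tg2 hy hz).trans (tg1 hw)))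

end basic

/-- number of Hasse digraphs on `Fin n` -/
noncomputable def hc (n : ℕ) : ℕ := (univ.filter (fun G : Fin n → Finset (Fin n) => Hasse G)).card

theorem transGen_cover {n : ℕ} (r : Fin n → Fin n → Prop) (hr : IsStrictOrder (Fin n) r) (x y : Fin n) :
    TransGen (fun a b => r a b ∧ ∀ c, r a c → ¬ r c b) x y ↔ r x y := by
  constructor
  · intro h
    induction h with
    | single h => exact h.1
    | tail _ h ih => exact hr.trans _ _ _ ih h.1
  · have key : ∀ m : ℕ, ∀ x y, r x y → (univ.filter (fun c => r x c ∧ r c y)).card ≤ m →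
        TransGen (fun a b => r a b ∧ ∀ c, r a c → ¬ r c b) x y := by
      intro m
      induction m with
      | zero =>
        intro x y hxy hc
        refine TransGen.single ⟨hxy, fun c h1 h2 => ?_⟩
        have : c ∈ (univ.filter (fun c => r x c ∧ r c y)) := by simp [h1, h2]
        have := Finset.card_pos.2 ⟨c, this⟩
        omega
      | succ m ih =>
        intro x y hxy hc
        by_cases hcov : ∀ c, r x c → ¬ r c y
        · exact TransGen.single ⟨hxy, hcov⟩
        · push Not at hcov
          obtain ⟨c, h1, h2⟩ := hcov
          have hcm : c ∈ (univ.filter (fun c => r x c ∧ r c y)) := by simp [h1, h2]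
          refine (ih x c h1 ?_).trans (ih c y h2 ?_)
          · have : (univ.filter (fun d => r x d ∧ r d c)) ⊂ (univ.filter (fun c => r x c ∧ r c y)) := by
              refine (Finset.ssubset_iff_of_subset ?_).2 ⟨c, hcm, ?_⟩
              · intro d; simp only [mem_filter, mem_univ, true_and]
                rintro ⟨a, b⟩; exact ⟨a, hr.trans _ _ _ b h2⟩
              · simp only [mem_filter, mem_univ, true_and, not_and]
                intro _; exact hr.irrefl c
            have := Finset.card_lt_card this
            omega
          · have : (univ.filter (fun d => r c d ∧ r d y)) ⊂ (univ.filter (fun c => r x c ∧ r c y)) := by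
              refine (Finset.ssubset_iff_of_subset ?_).2 ⟨c, hcm, ?_⟩
              · intro d; simp only [mem_filter, mem_univ, true_and]
                rintro ⟨a, b⟩; exact ⟨hr.trans _ _ _ h1 a, b⟩
              · simp only [mem_filter, mem_univ, true_and, not_and]
                intro h; exact absurd h (hr.irrefl c)
            have := Finset.card_lt_card this
            omega
    intro h
    exact key _ x y h le_rfl

theorem numGames_eq_hc (n : ℕ) : numGames n = hc n := by
  have h1 : hc n = Nat.card {G : Fin n → Finset (Fin n) // Hasse G} := by
    rw [Nat.card_eq_fintype_card, Fintype.card_subtype, hc]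
  rw [h1, numGames]
  apply Nat.card_congr
  refine
    { toFun := fun r => ⟨fun y => univ.filter (fun x => r.1 x y ∧ ∀ c, r.1 x c → ¬ r.1 c y), ?_⟩
      invFun := fun G => ⟨TransGen (rel G.1), ?_⟩
      left_inv := ?_
      right_inv := ?_ }
  · have hrel : rel (fun y => univ.filter (fun x => r.1 x y ∧ ∀ c, r.1 x c → ¬ r.1 c y)) =
        (fun a b => r.1 a b ∧ ∀ c, r.1 a c → ¬ r.1 c b) := by
      funext a b; simp [rel]
    intro x y z hxy
    rw [hrel, transGen_cover _ r.2, transGen_cover _ r.2]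
    simp only [mem_filter, mem_univ, true_and] at hxy
    exact hxy.2 z
  · exact { irrefl := fun a => G.2.acyc a, trans := fun a b c h1 h2 => h1.trans h2 }
  · intro r
    ext1
    have hrel : rel (fun y => univ.filter (fun x => r.1 x y ∧ ∀ c, r.1 x c → ¬ r.1 c y)) =
        (fun a b => r.1 a b ∧ ∀ c, r.1 a c → ¬ r.1 c b) := by
      funext a b; simp [rel]
    simp only [hrel]
    funext x y
    exact propext (transGen_cover _ r.2 x y)
  · intro G
    ext1
    funext y
    ext x
    simp only [mem_filter, mem_univ, true_and]
    constructor
    · rintro ⟨h, h2⟩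
      rcases (TransGen.head'_iff).1 h with ⟨z, hz, hzy⟩
      rcases reflTransGen_iff_eq_or_transGen.1 hzy with rfl | hzy
      · exact hz
      · exact absurd hzy (h2 z (TransGen.single hz))
    · intro h
      exact ⟨TransGen.single h, fun c => G.2 x y c h⟩

/-- delete the vertex `v` (keep it as an isolated vertex) -/
noncomputable def del {V : Type} [DecidableEq V] (v : V) (G : V → Finset V) : V → Finset V :=
  fun y => if y = v then ∅ else (G y).erase v

theorem mem_del {V : Type} [DecidableEq V] {v : V} {G : V → Finset V} {x y : V} :
    x ∈ del v G y ↔ x ∈ G y ∧ x ≠ v ∧ y ≠ v := by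
  unfold del; split_ifs with h
  · simp [h]
  · simp [h, and_comm]

theorem Hasse.mono {V : Type} {G G' : V → Finset V} (h : Hasse G) (hs : ∀ x y, x ∈ G' y → x ∈ G y) :
    Hasse G' := by
  intro x y z h1 h2 h3
  exact h x y z (hs _ _ h1) (TransGen.mono hs _ _ h2) (TransGen.mono hs _ _ h3)

theorem Hasse.del {V : Type} [DecidableEq V] {G : V → Finset V} (h : Hasse G) (v : V) :
    Hasse (del v G) := h.mono (fun _ _ hx => (mem_del.1 hx).1)

/-- Hasse digraphs in which `v` is isolated are counted by `hc n`. -/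
theorem card_isolated (n : ℕ) (v : Fin (n+1)) :
    (univ.filter (fun G : Fin (n+1) → Finset (Fin (n+1)) => Hasse G ∧ del v G = G)).card ≤ hc n := by
  unfold hc
  refine Finset.card_le_card_of_injOn
    (fun G y => univ.filter (fun x => v.succAbove x ∈ G (v.succAbove y))) ?_ ?_
  · intro G hG
    simp only [coe_filter, mem_univ, true_and, Set.mem_ofPred_eq] at hG ⊢
    intro x y z h1 h2 h3
    have hl : ∀ a b, rel (fun y => univ.filter (fun x => v.succAbove x ∈ G (v.succAbove y))) a b →
        rel G (v.succAbove a) (v.succAbove b) := by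
      intro a b; simp [rel]
    exact hG.1 (v.succAbove x) (v.succAbove y) (v.succAbove z) (by simpa using h1)
      (TransGen.lift v.succAbove hl _ _ h2) (TransGen.lift v.succAbove hl _ _ h3)
  · intro G hG G' hG' he
    simp only [coe_filter, mem_univ, true_and, Set.mem_ofPred_eq] at hG hG'
    funext y
    ext x
    rw [← hG.2, ← hG'.2]
    by_cases hx : x = v
    · simp [mem_del, hx]
    by_cases hy : y = v
    · simp [mem_del, hy]
    obtain ⟨x', rfl⟩ := Fin.exists_succAbove_eq hx
    obtain ⟨y', rfl⟩ := Fin.exists_succAbove_eq hy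
    have := congrFun he y'
    have := congrArg (fun s => x' ∈ s) this
    simp only [mem_filter, mem_univ, true_and, eq_iff_iff] at this
    simp [mem_del, this]

end KR


namespace KR
open Finset Relation
open scoped Classical

section X3
variable {V : Type} [Fintype V] [DecidableEq V]

noncomputable def opts (A B : Finset V) (y : V) : Finset (Finset V) :=
  if y ∈ A then {∅} else if y ∈ B then A.powerset.erase ∅ else B.powerset.erase ∅

theorem mem_opts {A B : Finset V} {G : V → Finset V} (hd : Disjoint A B) :
    G ∈ Fintype.piFinset (opts A B) ↔ (∀ y ∈ A, G y = ∅) ∧ (∀ y ∈ B, (G y).Nonempty ∧ G y ⊆ A) ∧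
      (∀ y, y ∉ A → y ∉ B → (G y).Nonempty ∧ G y ⊆ B) := by
  rw [Fintype.mem_piFinset]
  constructor
  · intro h
    refine ⟨fun y hy => ?_, fun y hy => ?_, fun y h1 h2 => ?_⟩
    · have := h y; simpa [opts, hy] using this
    · have hA : y ∉ A := fun hA => Finset.disjoint_left.1 hd hA hy
      have := h y; simpa [opts, hy, hA, Finset.nonempty_iff_ne_empty] using this
    · have := h y; simpa [opts, h1, h2, Finset.nonempty_iff_ne_empty] using this
  · rintro ⟨h1, h2, h3⟩ y
    by_cases hA : y ∈ A
    · simp [opts, hA, h1 y hA]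
    by_cases hB : y ∈ B
    · simpa [opts, hA, hB, Finset.nonempty_iff_ne_empty] using h2 y hB
    · simpa [opts, hA, hB, Finset.nonempty_iff_ne_empty] using h3 y hA hB

theorem card_opts {A B : Finset V} (hd : Disjoint A B) :
    (Fintype.piFinset (opts A B)).card =
      (2 ^ A.card - 1) ^ B.card * (2 ^ B.card - 1) ^ (Fintype.card V - A.card - B.card) := by
  rw [Fintype.card_piFinset]
  have h1 : ∀ y, (opts A B y).card = (if y ∈ B then (2 ^ A.card - 1) else 1) *
      (if y ∈ (A ∪ B)ᶜ then (2 ^ B.card - 1) else 1) := by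
    intro y
    by_cases hA : y ∈ A
    · have hB : y ∉ B := fun hB => Finset.disjoint_left.1 hd hA hB
      simp [opts, hA, hB]
    by_cases hB : y ∈ B
    · simp [opts, hA, hB, Finset.card_erase_of_mem]
    · simp [opts, hA, hB, Finset.card_erase_of_mem]
  simp_rw [h1]
  rw [Finset.prod_mul_distrib, Finset.prod_ite_mem, Finset.prod_ite_mem]
  simp only [univ_inter, prod_const]
  rw [Finset.card_compl, Finset.card_union_of_disjoint hd, Nat.sub_sub]

noncomputable def idx (V : Type) [Fintype V] [DecidableEq V] : Finset (Σ _ : Finset V, Finset V) :=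
  (univ.filter (fun A : Finset V => A.Nonempty)).sigma
    (fun A => (Aᶜ).powerset.filter (fun B => B.Nonempty))

theorem mem_idx {p : Σ _ : Finset V, Finset V} :
    p ∈ idx V ↔ p.1.Nonempty ∧ p.2.Nonempty ∧ Disjoint p.1 p.2 := by
  simp only [idx, mem_sigma, mem_filter, mem_univ, true_and, mem_powerset, subset_compl_comm,
    Finset.subset_compl_iff_disjoint_right, and_comm]

noncomputable def X3 (V : Type) [Fintype V] [DecidableEq V] : Finset (V → Finset V) :=
  (idx V).biUnion (fun p => Fintype.piFinset (opts p.1 p.2))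

theorem mem_X3 {G : V → Finset V} : G ∈ X3 V ↔ ∃ A B : Finset V, A.Nonempty ∧ B.Nonempty ∧
    Disjoint A B ∧ (∀ y ∈ A, G y = ∅) ∧ (∀ y ∈ B, (G y).Nonempty ∧ G y ⊆ A) ∧
      (∀ y, y ∉ A → y ∉ B → (G y).Nonempty ∧ G y ⊆ B) := by
  unfold X3
  rw [Finset.mem_biUnion]
  constructor
  · rintro ⟨p, hp, hG⟩
    rw [mem_idx] at hp
    exact ⟨p.1, p.2, hp.1, hp.2.1, hp.2.2, (mem_opts hp.2.2).1 hG⟩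
  · rintro ⟨A, B, hA, hB, hd, hG⟩
    exact ⟨⟨A, B⟩, mem_idx.2 ⟨hA, hB, hd⟩, (mem_opts hd).2 hG⟩

theorem X3_recover {G : V → Finset V} {A B : Finset V} (hd : Disjoint A B)
    (hG : G ∈ Fintype.piFinset (opts A B)) :
    A = univ.filter (fun y => G y = ∅) ∧
    B = univ.filter (fun y => (G y).Nonempty ∧ ∀ x ∈ G y, G x = ∅) := by
  obtain ⟨h1, h2, h3⟩ := (mem_opts hd).1 hG
  have hA : ∀ y, G y = ∅ → y ∈ A := by
    intro y hy
    by_contra hyA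
    by_cases hyB : y ∈ B
    · have := (h2 y hyB).1; simp [hy] at this
    · have := (h3 y hyA hyB).1; simp [hy] at this
  constructor
  · ext y
    simp only [mem_filter, mem_univ, true_and]
    exact ⟨h1 y, hA y⟩
  · ext y
    simp only [mem_filter, mem_univ, true_and]
    constructor
    · intro hy
      exact ⟨(h2 y hy).1, fun x hx => h1 x ((h2 y hy).2 hx)⟩
    · rintro ⟨⟨x, hx⟩, hy2⟩
      by_contra hyB
      have hyA : y ∉ A := fun hyA => by simp [h1 y hyA] at hx
      have hxB := (h3 y hyA hyB).2 hx
      exact Finset.disjoint_left.1 hd (hA x (hy2 x hx)) hxB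

theorem X3_hasse {G : V → Finset V} (hG : G ∈ X3 V) : Hasse G := by
  obtain ⟨A, B, -, -, hd, h1, h2, h3⟩ := mem_X3.1 hG
  let ρ : V → ℕ := fun y => if y ∈ A then 0 else if y ∈ B then 1 else 2
  have hρ : ∀ x y, x ∈ G y → ρ y = ρ x + 1 := by
    intro x y hxy
    by_cases hyA : y ∈ A
    · simp [h1 y hyA] at hxy
    by_cases hyB : y ∈ B
    · have := (h2 y hyB).2 hxy
      simp [ρ, hyA, hyB, this]
    · have := (h3 y hyA hyB).2 hxy
      have hxA : x ∉ A := fun hA => Finset.disjoint_left.1 hd hA this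
      simp [ρ, hyA, hyB, this, hxA]
  have hT : ∀ x y, TransGen (rel G) x y → ρ x + 1 ≤ ρ y := by
    intro x y h
    induction h with
    | single h => exact (hρ _ _ h).ge
    | tail _ h ih => have := hρ _ _ h; omega
  intro x y z hxy hxz hzy
  have a := hρ _ _ hxy
  have b := hT _ _ hxz
  have c := hT _ _ hzy
  omega

theorem sum_pow_card (s : Finset V) (F : ℕ → ℕ) : ∑ B ∈ s.powerset, F B.card =
    ∑ m ∈ range (s.card + 1), s.card.choose m * F m := by
  simpa using Finset.sum_powerset_apply_card (α := ℕ) F (x := s)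

theorem card_X3 : (X3 V).card = kleitmanRothschildSum (Fintype.card V) := by
  unfold X3
  rw [Finset.card_biUnion]
  · unfold idx
    rw [Finset.sum_sigma]
    set n := Fintype.card V with hn
    have inner : ∀ A : Finset V, ∑ B ∈ (Aᶜ).powerset.filter (fun B => B.Nonempty),
        (Fintype.piFinset (opts A B)).card = ∑ j ∈ Icc 1 (n - A.card), (n - A.card).choose j *
          ((2 ^ A.card - 1) ^ j * (2 ^ j - 1) ^ (n - A.card - j)) := by
      intro A
      have e1 : ∑ B ∈ (Aᶜ).powerset.filter (fun B => B.Nonempty),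
          (Fintype.piFinset (opts A B)).card = ∑ B ∈ (Aᶜ).powerset, (fun j => if j = 0 then 0 else
            (2 ^ A.card - 1) ^ j * (2 ^ j - 1) ^ (n - A.card - j)) B.card := by
        rw [Finset.sum_filter]
        refine Finset.sum_congr rfl fun B hB => ?_
        rw [mem_powerset] at hB
        have hd : Disjoint A B := by
          rw [Finset.disjoint_right]; intro x hx; exact Finset.mem_compl.1 (hB hx)
        by_cases h : B = ∅
        · simp [h]
        · have h' : B.Nonempty := Finset.nonempty_iff_ne_empty.2 h
          rw [if_pos h', card_opts hd]
          simp [h, ← hn]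
      rw [e1]
      refine (sum_pow_card (Aᶜ) (fun j => if j = 0 then 0 else
            (2 ^ A.card - 1) ^ j * (2 ^ j - 1) ^ (n - A.card - j))).trans ?_
      rw [Finset.card_compl, ← hn]
      symm
      apply Finset.sum_subset_zero_on_sdiff
      · intro j; simp only [mem_Icc, mem_range]; omega
      · intro j; simp only [mem_Icc, mem_range, Finset.mem_sdiff]; intro hj
        have : j = 0 := by omega
        simp [this]
      · intro j; simp only [mem_Icc]; intro hj
        have : j ≠ 0 := by omega
        simp [this]
    rw [Finset.sum_congr rfl (fun A _ => inner A), Finset.sum_filter]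
    unfold kleitmanRothschildSum
    have e2 : ∑ A : Finset V, (if A.Nonempty then ∑ j ∈ Icc 1 (n - A.card), (n - A.card).choose j *
          ((2 ^ A.card - 1) ^ j * (2 ^ j - 1) ^ (n - A.card - j)) else 0) =
        ∑ A ∈ (univ : Finset V).powerset, (fun i => if i = 0 then 0 else
          ∑ j ∈ Icc 1 (n - i), (n - i).choose j *
          ((2 ^ i - 1) ^ j * (2 ^ j - 1) ^ (n - i - j))) A.card := by
      rw [Finset.powerset_univ]
      refine Finset.sum_congr rfl fun A _ => ?_
      by_cases h : A = ∅
      · simp [h]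
      · simp [h, Finset.nonempty_iff_ne_empty.2 h]
    rw [e2]
    refine (sum_pow_card (univ : Finset V) (fun i => if i = 0 then 0 else
          ∑ j ∈ Icc 1 (n - i), (n - i).choose j *
          ((2 ^ i - 1) ^ j * (2 ^ j - 1) ^ (n - i - j)))).trans ?_
    rw [Finset.card_univ, ← hn]
    symm
    apply Finset.sum_subset_zero_on_sdiff
    · intro j; simp only [mem_Icc, mem_range]; omega
    · intro j; simp only [mem_Icc, mem_range, Finset.mem_sdiff]; intro hj
      have : j = 0 := by omega
      simp [this]
    · intro i; simp only [mem_Icc]; intro hj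
      have : i ≠ 0 := by omega
      simp only [this, if_false, Finset.mul_sum]
      refine Finset.sum_congr rfl fun j _ => ?_
      ring
  · intro p hp q hq hpq
    rw [Function.onFun, Finset.disjoint_left]
    intro G hG hG'
    apply hpq
    have hp' := (mem_idx.1 hp).2.2
    have hq' := (mem_idx.1 hq).2.2
    obtain ⟨a, b⟩ := X3_recover hp' hG
    obtain ⟨a', b'⟩ := X3_recover hq' hG'
    obtain ⟨p1, p2⟩ := p
    obtain ⟨q1, q2⟩ := q
    simp only at a b a' b'
    rw [a, b, a', b']
end X3

/-! growth of the sum -/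
def TT (n i j : ℕ) : ℕ :=
  n.choose i * (n - i).choose j * (2 ^ i - 1) ^ j * (2 ^ j - 1) ^ (n - i - j)

theorem TT_grow {n i j : ℕ} (hi : 1 ≤ i) (hj : 1 ≤ j) (hij : i + j ≤ n) :
    2 ^ (n / 2) * TT n i j ≤ 2 * (TT (n+1) i j + TT (n+1) i (j+1)) := by
  have hp : ∀ a : ℕ, 1 ≤ a → 2 ^ a ≤ 2 * (2 ^ a - 1) := by
    intro a ha
    have : 2 ^ 1 ≤ 2 ^ a := Nat.pow_le_pow_right (by norm_num) ha
    omega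
  by_cases h : n / 2 ≤ j
  · have e : n + 1 - i - j = (n - i - j) + 1 := by omega
    have h1 : 2 ^ (n/2) ≤ 2 * (2 ^ j - 1) :=
      (Nat.pow_le_pow_right (by norm_num) h).trans (hp j hj)
    have h2 : n.choose i * (n - i).choose j ≤ (n+1).choose i * (n + 1 - i).choose j :=
      Nat.mul_le_mul (Nat.choose_le_choose _ (by omega)) (Nat.choose_le_choose _ (by omega))
    calc 2 ^ (n / 2) * TT n i j ≤ (2 * (2 ^ j - 1)) * TT n i j := Nat.mul_le_mul_right _ h1
      _ = 2 * ((n.choose i * (n - i).choose j) * (2 ^ i - 1) ^ j * (2 ^ j - 1) ^ (n - i - j + 1)) := by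
          unfold TT; rw [pow_succ]; ring
      _ ≤ 2 * TT (n+1) i j := by
          unfold TT; rw [e]; gcongr
      _ ≤ _ := by omega
  · have e : n + 1 - i - (j+1) = n - i - j := by omega
    have h1 : 2 ^ (n/2) ≤ 2 * ((2 ^ i - 1) * 2 ^ (n - i - j)) := by
      calc 2 ^ (n/2) ≤ 2 ^ (i + (n - i - j)) := Nat.pow_le_pow_right (by norm_num) (by omega)
        _ = 2 ^ i * 2 ^ (n - i - j) := pow_add _ _ _
        _ ≤ (2 * (2 ^ i - 1)) * 2 ^ (n - i - j) := Nat.mul_le_mul_right _ (hp i hi)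
        _ = _ := by ring
    have h2 : n.choose i * (n - i).choose j ≤ (n+1).choose i * (n + 1 - i).choose (j+1) := by
      refine Nat.mul_le_mul (Nat.choose_le_choose _ (by omega)) ?_
      have : n + 1 - i = (n - i) + 1 := by omega
      rw [this, Nat.choose_succ_succ]; omega
    have h3 : 2 * (2 ^ j - 1) ≤ 2 ^ (j+1) - 1 := by rw [pow_succ]; omega
    calc 2 ^ (n / 2) * TT n i j ≤ (2 * ((2 ^ i - 1) * 2 ^ (n - i - j))) * TT n i j :=
          Nat.mul_le_mul_right _ h1
      _ = 2 * ((n.choose i * (n - i).choose j) * (2 ^ i - 1) ^ (j+1) *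
            (2 * (2 ^ j - 1)) ^ (n - i - j)) := by
          unfold TT; rw [pow_succ, mul_pow]; ring
      _ ≤ 2 * TT (n+1) i (j+1) := by
          unfold TT; rw [e]; gcongr
      _ ≤ _ := by omega

theorem S_grow (n : ℕ) : 2 ^ (n / 2) * kleitmanRothschildSum n ≤ 4 * kleitmanRothschildSum (n+1) := by
  have h1 : ∑ i ∈ Icc 1 n, ∑ j ∈ Icc 1 (n - i), TT (n+1) i j ≤ kleitmanRothschildSum (n+1) := by
    unfold kleitmanRothschildSum
    change _ ≤ ∑ i ∈ Icc 1 (n+1), ∑ j ∈ Icc 1 (n + 1 - i), TT (n+1) i j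
    refine (Finset.sum_le_sum fun i _ => ?_).trans
      (Finset.sum_le_sum_of_subset (Finset.Icc_subset_Icc_right (Nat.le_succ n)))
    exact Finset.sum_le_sum_of_subset (Finset.Icc_subset_Icc_right (by omega))
  have h2 : ∑ i ∈ Icc 1 n, ∑ j ∈ Icc 1 (n - i), TT (n+1) i (j+1) ≤ kleitmanRothschildSum (n+1) := by
    unfold kleitmanRothschildSum
    change _ ≤ ∑ i ∈ Icc 1 (n+1), ∑ j ∈ Icc 1 (n + 1 - i), TT (n+1) i j
    refine (Finset.sum_le_sum fun i hi => ?_).trans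
      (Finset.sum_le_sum_of_subset (Finset.Icc_subset_Icc_right (Nat.le_succ n)))
    rw [mem_Icc] at hi
    rw [← Finset.sum_image (f := fun j => TT (n+1) i j) (g := fun j => j + 1)
      (fun a _ b _ h => by simpa using h)]
    refine Finset.sum_le_sum_of_subset ?_
    intro j
    simp only [mem_image, mem_Icc]
    rintro ⟨a, ha, rfl⟩
    omega
  have h3 : 2 ^ (n / 2) * kleitmanRothschildSum n ≤
      ∑ i ∈ Icc 1 n, ∑ j ∈ Icc 1 (n - i), 2 * (TT (n+1) i j + TT (n+1) i (j+1)) := by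
    unfold kleitmanRothschildSum
    rw [Finset.mul_sum]
    refine Finset.sum_le_sum fun i hi => ?_
    rw [Finset.mul_sum]
    refine Finset.sum_le_sum fun j hj => ?_
    rw [mem_Icc] at hi hj
    exact TT_grow hi.1 hj.1 (by omega)
  simp only [← Finset.mul_sum, Finset.sum_add_distrib] at h3
  omega

theorem pow_sub_one_ge {i j : ℕ} (h : 2 * j ≤ 2 ^ i) : 2 ^ (i * j) ≤ 2 * (2 ^ i - 1) ^ j := by
  have hpos : (0:ℝ) < 2 ^ i := by positivity
  have h1 : (1:ℝ) / 2 ≤ (1 - 1 / 2 ^ i) ^ j := by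
    have hb := one_add_mul_le_pow (a := -(1 / (2:ℝ) ^ i)) (by
      have : 1 / (2:ℝ) ^ i ≤ 1 := by
        rw [div_le_one hpos]; exact one_le_pow₀ (by norm_num)
      linarith) j
    have h2 : (j:ℝ) * (1 / 2 ^ i) ≤ 1 / 2 := by
      rw [mul_one_div, div_le_iff₀ hpos]
      have : (2 * j : ℝ) ≤ 2 ^ i := by exact_mod_cast h
      linarith
    calc (1:ℝ)/2 ≤ 1 + j * -(1 / 2 ^ i) := by linarith
      _ ≤ _ := hb
      _ = _ := by ring
  have h3 : (2:ℝ) ^ (i * j) ≤ 2 * (2 ^ i - 1) ^ j := by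
    have : ((2:ℝ) ^ i - 1) ^ j = 2 ^ (i * j) * (1 - 1 / 2 ^ i) ^ j := by
      rw [pow_mul, ← mul_pow]; congr 1; field_simp
    rw [this]
    have hp2 : (0:ℝ) < 2 ^ (i * j) := by positivity
    nlinarith
  have h4 : ((2 ^ i - 1 : ℕ) : ℝ) = 2 ^ i - 1 := by
    rw [Nat.cast_sub Nat.one_le_two_pow]; simp
  have h5 : ((2 ^ (i * j) : ℕ) : ℝ) ≤ ((2 * (2 ^ i - 1) ^ j : ℕ) : ℝ) := by
    push_cast [h4]; exact h3
  exact_mod_cast h5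

theorem two_pow_le_choose (m : ℕ) : 2 ^ m ≤ (m + 1) * m.choose (m / 2) := by
  rw [← Nat.sum_range_choose]
  calc _ ≤ ∑ i ∈ range (m+1), m.choose (m/2) :=
        Finset.sum_le_sum fun i _ => Nat.choose_le_middle i m
    _ = _ := by simp

theorem four_mul_le_pow : ∀ i : ℕ, 4 ≤ i → 4 * i ≤ 2 ^ i := by
  intro i hi
  induction i, hi using Nat.le_induction with
  | base => norm_num
  | succ i hi ih => rw [pow_succ]; omega

theorem S_lower (n : ℕ) (hn : 100 ≤ n) :
    2 ^ (n + (n - n / 2) + (n / 2) * (n - n / 2)) ≤ 4 * (n + 1) ^ 2 * kleitmanRothschildSum n := by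
  set j := n / 2 with hj
  set m := n - j with hm
  set i := m / 2 with hi
  have hT : TT n i j ≤ kleitmanRothschildSum n := by
    unfold kleitmanRothschildSum
    change _ ≤ ∑ i ∈ Icc 1 n, ∑ j ∈ Icc 1 (n - i), TT n i j
    refine le_trans ?_ (Finset.single_le_sum (f := fun i => ∑ j ∈ Icc 1 (n - i), TT n i j)
      (fun _ _ => Nat.zero_le _) (mem_Icc.2 ⟨by omega, by omega⟩ : i ∈ Icc 1 n))
    exact Finset.single_le_sum (f := fun j => TT n i j)
      (fun _ _ => Nat.zero_le _) (mem_Icc.2 ⟨by omega, by omega⟩ : j ∈ Icc 1 (n - i))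
  have hch : n.choose i * (n - i).choose j = n.choose j * m.choose i := by
    have h1 := Nat.choose_mul (n := n) (k := i + j) (s := i) (by omega) 
    have h2 := Nat.choose_mul (n := n) (k := i + j) (s := j) (by omega) 
    have e1 : i + j - i = j := by omega
    have e2 : i + j - j = i := by omega
    rw [e1] at h1
    rw [e2] at h2
    rw [← h1, hm, ← h2, Nat.choose_symm_add]
  have b1 := two_pow_le_choose n
  have b2 := two_pow_le_choose m
  rw [← hj] at b1
  rw [← hi] at b2
  have hi4 : 4 * i ≤ 2 ^ i := four_mul_le_pow i (by omega)
  have b3 : 2 ^ (i * j) ≤ 2 * (2 ^ i - 1) ^ j := pow_sub_one_ge (by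
    have : 2 ^ i = 2 ^ (i - 4) * 16 := by rw [show (16:ℕ) = 2 ^ 4 by norm_num, ← pow_add]; congr 1; omega
    have h5 : 4 * (i - 4) ≤ 2 ^ (i - 4) := four_mul_le_pow _ (by omega)
    omega)
  have b4 : 2 ^ (j * (m - i)) ≤ 2 * (2 ^ j - 1) ^ (m - i) := pow_sub_one_ge (by
    have h5 : 4 * j ≤ 2 ^ j := four_mul_le_pow _ (by omega)
    omega)
  have e : n - i - j = m - i := by omega
  calc 2 ^ (n + m + j * m) = 2 ^ n * 2 ^ m * (2 ^ (i * j) * 2 ^ (j * (m - i))) := by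
        rw [← pow_add, ← pow_add, ← pow_add]; congr 1
        have : i * j + j * (m - i) = j * m := by
          rw [mul_comm i j, ← mul_add]; congr 1; omega
        rw [this]
    _ ≤ ((n + 1) * n.choose j) * ((m+1) * m.choose i) * ((2 * (2 ^ i - 1) ^ j) *
          (2 * (2 ^ j - 1) ^ (m - i))) := by gcongr
    _ = 4 * ((n+1) * (m+1)) * TT n i j := by
        unfold TT; rw [hch, e]; ring
    _ ≤ 4 * (n+1)^2 * kleitmanRothschildSum n := by
        have : (n+1) * (m+1) ≤ (n+1)^2 := by rw [sq]; apply Nat.mul_le_mul_left; omega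
        gcongr
end KR


namespace KR
open Finset Relation
open scoped Classical

/-! ### entropy bounds -/
theorem ent {α : Type} (T : Finset α) (k s : ℕ) :
    ((T.powerset.filter (fun X => X.card ≤ k)).card : ℝ) ≤
      (2:ℝ) ^ ((s:ℝ) * k + 2 * (T.card : ℝ) / 2 ^ s) := by
  set y : ℝ := 1 / 2 ^ s with hy
  have hy0 : 0 < y := by positivity
  have hy1 : y ≤ 1 := by
    rw [hy, div_le_one (by positivity)]; exact one_le_pow₀ (by norm_num)
  have h1 : ((T.powerset.filter (fun X => X.card ≤ k)).card : ℝ) * y ^ k ≤ (y + 1) ^ T.card := by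
    rw [← Finset.sum_pow_mul_eq_add_pow, ← nsmul_eq_mul, ← Finset.sum_const]
    refine (Finset.sum_le_sum (g := fun X => y ^ X.card * 1 ^ (T.card - X.card)) ?_).trans
      (Finset.sum_le_sum_of_subset_of_nonneg (Finset.filter_subset _ _) ?_)
    · intro X hX
      rw [mem_filter] at hX
      simp only [one_pow, mul_one]
      exact pow_le_pow_of_le_one hy0.le hy1 hX.2
    · intros; positivity
  have h2 : (y + 1) ^ T.card ≤ (2:ℝ) ^ (2 * (T.card : ℝ) / 2 ^ s) := by
    have e1 : y + 1 ≤ Real.exp y := Real.add_one_le_exp y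
    have e2 : Real.exp 1 ≤ 2 ^ (2:ℝ) := by
      have := Real.exp_one_lt_d9
      norm_num; linarith
    have e3 : Real.exp y ≤ (2:ℝ) ^ (2 * y) := by
      calc Real.exp y = Real.exp 1 ^ y := by rw [← Real.exp_mul, one_mul]
        _ ≤ ((2:ℝ) ^ (2:ℝ)) ^ y := Real.rpow_le_rpow (Real.exp_pos _).le e2 hy0.le
        _ = (2:ℝ) ^ (2 * y) := (Real.rpow_mul (by norm_num) _ _).symm
    calc (y + 1) ^ T.card ≤ ((2:ℝ) ^ (2 * y)) ^ T.card :=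
          pow_le_pow_left₀ (by positivity) (e1.trans e3) _
      _ = (2:ℝ) ^ (2 * y * T.card) := by rw [← Real.rpow_natCast, ← Real.rpow_mul (by norm_num)]
      _ = _ := by rw [hy]; congr 1; ring
  have h3 : y ^ k = (2:ℝ) ^ (-((s:ℝ) * k)) := by
    rw [hy, one_div, inv_pow, ← pow_mul, Real.rpow_neg (by norm_num)]
    congr 1
    rw [← Nat.cast_mul, Real.rpow_natCast]
  have h4 := h1.trans h2
  rw [h3, Real.rpow_neg (by norm_num), ← div_eq_mul_inv, div_le_iff₀ (by positivity)] at h4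
  rw [Real.rpow_add (by norm_num)]
  linarith

theorem near_count {α : Type} [Fintype α] [DecidableEq α] (P : Finset α) (k : ℕ) :
    (univ.filter (fun X : Finset α => (X \ P).card ≤ k)).card ≤
      2 ^ P.card * ((univ : Finset α).powerset.filter (fun X => X.card ≤ k)).card := by
  rw [← Finset.card_powerset, ← Finset.card_product]
  refine Finset.card_le_card_of_injOn (fun X => (X ∩ P, X \ P)) ?_ ?_
  · intro X hX
    simp only [coe_filter, mem_univ, true_and, Set.mem_ofPred_eq] at hX
    simp only [coe_product, Set.mem_prod, mem_coe, mem_powerset, mem_filter]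
    exact ⟨Finset.inter_subset_right, Finset.subset_univ _, hX⟩
  · intro X _ Y _ h
    simp only [Prod.mk.injEq] at h
    rw [← Finset.sdiff_union_inter X P, ← Finset.sdiff_union_inter Y P, h.1, h.2]

/-! ### neighbourhoods and codes -/
section defs
variable {V : Type} [Fintype V] [DecidableEq V]

/-- signed neighbourhood: `(y,true)` upper neighbour, `(y,false)` lower neighbour -/
noncomputable def sN (G : V → Finset V) (v : V) : Finset (V × Bool) :=
  univ.filter (fun p => if p.2 = true then v ∈ G p.1 else p.1 ∈ G v)
noncomputable def sNQ (G : V → Finset V) (Q : Finset V) : Finset (V × Bool) := Q.biUnion (sN G)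
noncomputable def Up (G : V → Finset V) (v : V) : Finset V := univ.filter (fun y => v ∈ G y)
noncomputable def Nb (G : V → Finset V) (v : V) : Finset V := univ.filter (fun y => v ∈ G y ∨ y ∈ G v)
noncomputable def NQ (G : V → Finset V) (Q : Finset V) : Finset V := Q.biUnion (Nb G)
/-- decodable sets -/
noncomputable def Wd (G : V → Finset V) (Q : Finset V) (t : ℕ) : Finset V :=
  if t = 0 then NQ G Q else if t = 1 then (NQ G Q)ᶜ else if t = 2 then Q.biUnion (Up G)
  else Q.biUnion G
noncomputable def PosB (G : V → Finset V) (v : V) (k : ℕ) (Q1 Q2 W : Finset V) : Finset (V × Bool) :=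
  univ.filter (fun p => p.1 ≠ v ∧ p.1 ∉ NQ G (Q1 ∪ Q2) ∧ p.1 ∉ W ∧
    (sN G p.1 \ sNQ G (if p.2 = true then Q1 else Q2)).card ≤ k)
noncomputable def dec (G : V → Finset V) (v : V) (k : ℕ)
    (c : Finset V × Finset V × Finset V × Fin 5) : Finset (V × Bool) :=
  if c.2.2.2 = 4 then sNQ G c.1 else PosB G v k c.1 c.2.1 (Wd G c.2.2.1 c.2.2.2)
noncomputable def small (V : Type) [Fintype V] (K : ℕ) : Finset (Finset V) :=
  (univ : Finset V).powerset.filter (fun X => X.card ≤ K)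
noncomputable def codes (V : Type) [Fintype V] (K : ℕ) :
    Finset (Finset V × Finset V × Finset V × Fin 5) :=
  small V K ×ˢ small V K ×ˢ small V K ×ˢ univ

def Good (G : V → Finset V) (k K L M : ℕ) : Prop :=
  ∀ v, ∀ c ∈ codes V K, 2 * (dec (del v G) v k c).card + 2 * L ≤ Fintype.card V →
    M < (sN G v \ dec (del v G) v k c).card

theorem mem_sN_true {G : V → Finset V} {v y : V} : (y, true) ∈ sN G v ↔ v ∈ G y := by simp [sN]
theorem mem_sN_false {G : V → Finset V} {v y : V} : (y, false) ∈ sN G v ↔ y ∈ G v := by simp [sN]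
theorem mem_Up {G : V → Finset V} {v y : V} : y ∈ Up G v ↔ v ∈ G y := by simp [Up]
theorem mem_Nb {G : V → Finset V} {v y : V} : y ∈ Nb G v ↔ v ∈ G y ∨ y ∈ G v := by simp [Nb]
end defs

theorem removal (n : ℕ) (v : Fin (n+1))
    (Pos : (Fin (n+1) → Finset (Fin (n+1))) → Finset (Fin (n+1) × Bool)) (m M : ℕ) :
    (univ.filter (fun G : Fin (n+1) → Finset (Fin (n+1)) => Hasse G ∧ (Pos (del v G)).card ≤ m ∧
      (sN G v \ Pos (del v G)).card ≤ M)).card ≤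
    (2 ^ m * ((univ : Finset (Fin (n+1) × Bool)).powerset.filter (fun X => X.card ≤ M)).card) * hc n := by
  refine le_trans ?_ (Nat.mul_le_mul_left _ (card_isolated n v))
  refine Finset.card_le_mul_card_image_of_maps_to (f := del v) ?_ _ ?_
  · intro G hG
    simp only [mem_filter, mem_univ, true_and] at hG ⊢
    refine ⟨hG.1.del v, ?_⟩
    funext y; ext x
    simp only [mem_del]; tauto
  · intro G' _
    by_cases hP : (Pos G').card ≤ m
    · refine le_trans ?_ (Nat.mul_le_mul_right _ (Nat.pow_le_pow_right (by norm_num) hP))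
      refine le_trans ?_ (near_count (Pos G') M)
      refine Finset.card_le_card_of_injOn (fun G => sN G v) ?_ ?_
      · intro G hG
        simp only [coe_filter, mem_filter, mem_univ, true_and, Set.mem_ofPred_eq] at hG ⊢
        rw [← hG.2]; exact hG.1.2.2
      · intro G hG H hH h
        simp only [coe_filter, mem_filter, mem_univ, true_and, Set.mem_ofPred_eq] at hG hH
        have hd : del v G = del v H := by rw [hG.2, hH.2]
        simp only at h
        funext y; ext x
        by_cases hy : y = v
        · rw [hy, ← mem_sN_false, ← mem_sN_false, h]
        by_cases hx : x = v
        · rw [hx, ← mem_sN_true, ← mem_sN_true, h]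
        have h1 : x ∈ del v G y ↔ x ∈ del v H y := by rw [hd]
        simpa [mem_del, hx, hy] using h1
    · rw [Finset.card_eq_zero.2]
      · exact Nat.zero_le _
      · rw [Finset.filter_eq_empty_iff]
        intro G hG h
        simp only [mem_filter, mem_univ, true_and] at hG
        rw [h] at hG; exact hP hG.2.1

theorem bad_count (n k K L M : ℕ) :
    (univ.filter (fun G : Fin (n+1) → Finset (Fin (n+1)) => Hasse G ∧ ¬ Good G k K L M)).card ≤
    (n + 1) * (codes (Fin (n+1)) K).card * ((2 ^ ((n + 1 - 2 * L) / 2) *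
      ((univ : Finset (Fin (n+1) × Bool)).powerset.filter (fun X => X.card ≤ M)).card) * hc n) := by
  have hsub : (univ.filter (fun G : Fin (n+1) → Finset (Fin (n+1)) => Hasse G ∧ ¬ Good G k K L M)) ⊆
      ((univ : Finset (Fin (n+1))) ×ˢ codes (Fin (n+1)) K).biUnion (fun p =>
        univ.filter (fun G : Fin (n+1) → Finset (Fin (n+1)) => Hasse G ∧
          (dec (del p.1 G) p.1 k p.2).card ≤ (n + 1 - 2 * L) / 2 ∧
          (sN G p.1 \ dec (del p.1 G) p.1 k p.2).card ≤ M)) := by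
    intro G hG
    rw [mem_filter] at hG
    obtain ⟨_, h1, h2⟩ := hG
    unfold Good at h2
    push Not at h2
    obtain ⟨v, c, hc, h3, h4⟩ := h2
    rw [mem_biUnion]
    refine ⟨(v, c), by simp [hc], ?_⟩
    simp only [mem_filter, mem_univ, true_and]
    rw [Fintype.card_fin] at h3
    exact ⟨h1, by omega, h4⟩
  refine (Finset.card_le_card hsub).trans ?_
  refine (Finset.card_biUnion_le_card_mul _ _ _ (fun p _ =>
    removal n p.1 (fun G' => dec G' p.1 k p.2) ((n + 1 - 2 * L) / 2) M)).trans ?_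
  rw [Finset.card_product, Finset.card_univ, Fintype.card_fin]

theorem card_small (N K s : ℕ) :
    ((small (Fin N) K).card : ℝ) ≤ (2:ℝ) ^ ((s:ℝ) * K + 2 * (N : ℝ) / 2 ^ s) := by
  have := ent (univ : Finset (Fin N)) K s
  rwa [Finset.card_univ, Fintype.card_fin] at this

theorem card_codes (N K s : ℕ) :
    ((codes (Fin N) K).card : ℝ) ≤ 5 * (2:ℝ) ^ (3 * ((s:ℝ) * K + 2 * (N : ℝ) / 2 ^ s)) := by
  have h := card_small N K s
  set E := (2:ℝ) ^ ((s:ℝ) * K + 2 * (N : ℝ) / 2 ^ s) with hE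
  have h2 : (2:ℝ) ^ (3 * ((s:ℝ) * K + 2 * (N : ℝ) / 2 ^ s)) = E ^ 3 := by
    rw [hE, ← Real.rpow_natCast (_ ^ _) 3, ← Real.rpow_mul (by norm_num)]; congr 1; push_cast; ring
  rw [h2]
  unfold codes
  rw [Finset.card_product, Finset.card_product, Finset.card_product, Finset.card_univ, Fintype.card_fin]
  push_cast
  have h0 : (0:ℝ) ≤ ((small (Fin N) K).card : ℝ) := Nat.cast_nonneg _
  calc _ = 5 * ((small (Fin N) K).card : ℝ) ^ 3 := by ring
    _ ≤ 5 * E ^ 3 := by gcongr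
end KR


set_option linter.all false
namespace KR
open Finset Relation
open scoped Classical

theorem greedy {α β : Type} [DecidableEq α] [DecidableEq β] (T : Finset α) (f : α → Finset β) (k : ℕ) :
    ∃ Q ⊆ T, Q.card * (k+1) ≤ (Q.biUnion f).card ∧ ∀ u ∈ T, (f u \ Q.biUnion f).card ≤ k := by
  obtain ⟨Q, hQ, hmax⟩ := Finset.exists_max_image
    (T.powerset.filter (fun Q => Q.card * (k+1) ≤ (Q.biUnion f).card)) Finset.card
    ⟨∅, by simp⟩
  rw [mem_filter, mem_powerset] at hQ
  refine ⟨Q, hQ.1, hQ.2, ?_⟩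
  intro u hu
  by_contra hk
  push Not at hk
  have hnot : u ∉ Q := by
    intro h
    have : f u \ Q.biUnion f = ∅ := by
      rw [Finset.sdiff_eq_empty_iff_subset]; exact Finset.subset_biUnion_of_mem f h
    rw [this] at hk; simp at hk
  have hm := hmax (insert u Q) (by
    rw [mem_filter, mem_powerset]
    refine ⟨Finset.insert_subset hu hQ.1, ?_⟩
    rw [Finset.card_insert_of_notMem hnot, Finset.biUnion_insert, ← Finset.sdiff_union_self_eq_union,
      Finset.card_union_of_disjoint Finset.sdiff_disjoint]
    nlinarith [hQ.2])
  rw [Finset.card_insert_of_notMem hnot] at hm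
  omega

section D
variable {V : Type} [Fintype V] [DecidableEq V] {G : V → Finset V}

theorem Nb_symm {x y : V} : y ∈ Nb G x ↔ x ∈ Nb G y := by rw [mem_Nb, mem_Nb]; tauto

theorem Hasse.ne (h : Hasse G) {x y : V} (hxy : y ∈ Nb G x) : x ≠ y := by
  rintro rfl; rw [mem_Nb] at hxy; exact h.irr x (by tauto)

theorem Hasse.tri (h : Hasse G) {x y z : V} (hxy : y ∈ Nb G x) (hyz : z ∈ Nb G y) : z ∉ Nb G x := by
  intro hz
  rw [mem_Nb] at *
  rcases hxy with a | a <;> rcases hyz with b | b <;> rcases hz with c | c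
  · exact h.tri1 a b c
  · exact h.tri2 a b c
  · exact h.tri1 c b a
  · exact h.tri1 c a b
  · exact h.tri1 a c b
  · exact h.tri1 b c a
  · exact h.tri2 b a c
  · exact h.tri1 b a c

theorem fst_mem_Nb {v : V} {p : V × Bool} (hp : p ∈ sN G v) : p.1 ∈ Nb G v := by
  obtain ⟨y, b⟩ := p
  rw [mem_Nb]
  cases b
  · exact Or.inr (mem_sN_false.1 hp)
  · exact Or.inl (mem_sN_true.1 hp)

theorem sN_sign (h : Hasse G) {v y : V} {b c : Bool} (hb : (y, b) ∈ sN G v) (hc : (y, c) ∈ sN G v) : b = c := by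
  cases b <;> cases c
  · rfl
  · exact (h.asymm (mem_sN_false.1 hb) (mem_sN_true.1 hc)).elim
  · exact (h.asymm (mem_sN_true.1 hb) (mem_sN_false.1 hc)).elim
  · rfl

theorem mem_Nb_exists {v y : V} (hy : y ∈ Nb G v) : ∃ b, (y, b) ∈ sN G v := by
  rw [mem_Nb] at hy
  rcases hy with h | h
  · exact ⟨true, mem_sN_true.2 h⟩
  · exact ⟨false, mem_sN_false.2 h⟩

theorem mem_sN_del {v q z : V} {b : Bool} (hq : q ≠ v) :
    (z, b) ∈ sN (del v G) q ↔ (z, b) ∈ sN G q ∧ z ≠ v := by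
  cases b
  · rw [mem_sN_false, mem_sN_false, mem_del]; tauto
  · rw [mem_sN_true, mem_sN_true, mem_del]; tauto

theorem mem_Nb_del {v q z : V} (hq : q ≠ v) : z ∈ Nb (del v G) q ↔ z ∈ Nb G q ∧ z ≠ v := by
  rw [mem_Nb, mem_Nb, mem_del, mem_del]; tauto

theorem mem_sNQ_del {v z : V} {b : Bool} {Q : Finset V} (hQ : v ∉ Q) :
    (z, b) ∈ sNQ (del v G) Q ↔ (z, b) ∈ sNQ G Q ∧ z ≠ v := by
  unfold sNQ
  simp only [mem_biUnion]
  constructor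
  · rintro ⟨q, hq, h⟩
    have := (mem_sN_del (ne_of_mem_of_not_mem hq hQ)).1 h
    exact ⟨⟨q, hq, this.1⟩, this.2⟩
  · rintro ⟨⟨q, hq, h⟩, hz⟩
    exact ⟨q, hq, (mem_sN_del (ne_of_mem_of_not_mem hq hQ)).2 ⟨h, hz⟩⟩

theorem mem_NQ_del {v z : V} {Q : Finset V} (hQ : v ∉ Q) :
    z ∈ NQ (del v G) Q ↔ z ∈ NQ G Q ∧ z ≠ v := by
  unfold NQ
  simp only [mem_biUnion]
  constructor
  · rintro ⟨q, hq, h⟩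
    have := (mem_Nb_del (ne_of_mem_of_not_mem hq hQ)).1 h
    exact ⟨⟨q, hq, this.1⟩, this.2⟩
  · rintro ⟨⟨q, hq, h⟩, hz⟩
    exact ⟨q, hq, (mem_Nb_del (ne_of_mem_of_not_mem hq hQ)).2 ⟨h, hz⟩⟩

theorem mem_Wd_del {v z : V} {Q : Finset V} {t : ℕ} (hQ : v ∉ Q) (hz : z ≠ v) :
    z ∈ Wd (del v G) Q t ↔ z ∈ Wd G Q t := by
  unfold Wd
  split_ifs
  · rw [mem_NQ_del hQ]; tauto
  · rw [mem_compl, mem_compl, mem_NQ_del hQ]; tauto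
  · simp only [mem_biUnion, mem_Up, mem_del]
    constructor
    · rintro ⟨q, hq, h⟩; exact ⟨q, hq, h.1⟩
    · rintro ⟨q, hq, h⟩; exact ⟨q, hq, h, fun e => hQ (e ▸ hq), hz⟩
  · simp only [mem_biUnion, mem_del]
    constructor
    · rintro ⟨q, hq, h⟩; exact ⟨q, hq, h.1⟩
    · rintro ⟨q, hq, h⟩; exact ⟨q, hq, h, hz, fun e => hQ (e ▸ hq)⟩

theorem mem_codes {K : ℕ} {Q1 Q2 Q3 : Finset V} {t : Fin 5} :
    (Q1, Q2, Q3, t) ∈ codes V K ↔ Q1.card ≤ K ∧ Q2.card ≤ K ∧ Q3.card ≤ K := by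
  simp [codes, small]

theorem good4 (hG : Hasse G) {k K L M : ℕ} (hg : Good G k K L M) {v : V} {Q : Finset V} (hv : v ∉ Q)
    (hQ : Q.card ≤ K) (hs : 2 * (sNQ G Q).card + 2 * L ≤ Fintype.card V) :
    M < (sN G v \ sNQ G Q).card := by
  have h := hg v (Q, ∅, ∅, 4) (mem_codes.2 ⟨hQ, by simp, by simp⟩)
  have e : dec (del v G) v k (Q, ∅, ∅, 4) = sNQ (del v G) Q := by simp [dec]
  rw [e] at h
  have h1 : (sNQ (del v G) Q).card ≤ (sNQ G Q).card := by
    apply Finset.card_le_card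
    rintro ⟨z, b⟩ hz
    exact ((mem_sNQ_del hv).1 hz).1
  have h2 := h (by omega)
  refine lt_of_lt_of_le h2 (Finset.card_le_card ?_)
  rintro ⟨z, b⟩ hz
  rw [Finset.mem_sdiff, mem_sNQ_del hv] at hz
  rw [Finset.mem_sdiff]
  refine ⟨hz.1, fun h => hz.2 ⟨h, ?_⟩⟩
  exact (hG.ne (fst_mem_Nb hz.1)).symm

theorem good_deg (hG : Hasse G) {k K L M : ℕ} (hg : Good G k K L M) (hL : 2 * L ≤ Fintype.card V) (v : V) :
    M < (sN G v).card := by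
  have := good4 hG hg (v := v) (Q := ∅) (by simp) (by simp) (by simp [sNQ]; exact hL)
  simpa [sNQ] using this

theorem card_sN (hG : Hasse G) (v : V) : (sN G v).card = (Up G v).card + (G v).card := by
  have : sN G v = (Up G v).image (fun y => (y, true)) ∪ (G v).image (fun y => (y, false)) := by
    ext ⟨y, b⟩
    cases b
    · simp [mem_sN_false]
    · simp [mem_sN_true, mem_Up]
  rw [this, Finset.card_union_of_disjoint, Finset.card_image_of_injective, Finset.card_image_of_injective]
  · intro a b h; simpa using h
  · intro a b h; simpa using h
  · rw [Finset.disjoint_left]; intro x hx hy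
    simp only [mem_image] at hx hy
    obtain ⟨a, _, rfl⟩ := hx
    obtain ⟨b, _, h⟩ := hy
    simp at h

/-- fst is injective on `sNQ` of a set on one side of `v` -/
theorem card_sNQ_eq (hG : Hasse G) {v : V} {Q : Finset V} (hQ : Q ⊆ Up G v ∨ Q ⊆ G v) :
    (sNQ G Q).card ≤ (NQ G Q).card := by
  refine Finset.card_le_card_of_injOn Prod.fst ?_ ?_
  · intro p hp
    simp only [sNQ, mem_coe, mem_biUnion, NQ] at hp ⊢
    obtain ⟨q, hq, h⟩ := hp
    exact ⟨q, hq, fst_mem_Nb h⟩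
  · have key : ∀ z, (z, true) ∈ sNQ G Q → (z, false) ∈ sNQ G Q → False := by
      intro z h1 h2
      simp only [sNQ, mem_biUnion, mem_sN_true, mem_sN_false] at h1 h2
      obtain ⟨q, hq, h1⟩ := h1
      obtain ⟨r, hr, h2⟩ := h2
      rcases hQ with h | h
      · exact hG.quad1 (mem_Up.1 (h hq)) h1 h2 (mem_Up.1 (h hr))
      · exact hG.quad1 h1 h2 (h hr) (h hq)
    rintro ⟨z, b⟩ hz ⟨z', b'⟩ hz' e
    simp only at e
    subst e
    rw [mem_coe] at hz hz'
    cases b <;> cases b' <;> first | rfl | exact (key _ hz' hz).elim | exact (key _ hz hz').elim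

/-- properties of hosts -/
def HP (G : V → Finset V) (k K L1 : ℕ) (v : V) (Q : Finset V) : Prop :=
  Q ⊆ Nb G v ∧ Q.card ≤ K ∧ Fintype.card V ≤ 2 * (NQ G Q).card + 2 * L1 ∧
  ∀ (t : ℕ) (Q3 : Finset V) (L M : ℕ), Good G k K L M → t < 4 → v ∉ Q3 → Q3.card ≤ K →
    (Nb G v ∩ Wd G Q3 t).card + 1 ≤ M → Fintype.card V < 2 * ((NQ G Q ∪ Wd G Q3 t)ᶜ).card + 2 * L

set_option maxHeartbeats 2000000 in
theorem host_exists (hG : Hasse G) {k K0 K L1 M1 : ℕ} (hK : 2 * K0 ≤ K) (hk : 2 * Fintype.card V < (K0 + 1) * (k+1))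
    (hg : Good G k K L1 M1) (hL : 2 * L1 ≤ Fintype.card V) (hkM : k ≤ M1) (hKM : 2 * K0 + 2 ≤ M1) (hM2 : 2 * k + 1 ≤ M1)
    (v w : V) : ∃ Q, HP G k K L1 v Q ∧ w ∉ Q := by
  have card_le : ∀ Q : Finset V, Q.card * (k+1) ≤ (sNQ G Q).card → Q.card ≤ K0 := by
    intro Q h
    have h1 : (sNQ G Q).card ≤ 2 * Fintype.card V := by
      refine (Finset.card_le_univ _).trans ?_
      rw [Fintype.card_prod, Fintype.card_bool, mul_comm]
    have h2 : Q.card * (k+1) < (K0 + 1) * (k+1) := by omega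
    have := lt_of_mul_lt_mul_right h2 (Nat.zero_le _)
    omega
  obtain ⟨Q1, hQ1, hc1, hs1⟩ := greedy ((Up G v).erase w) (sN G) k
  obtain ⟨Q2, hQ2, hc2, hs2⟩ := greedy ((G v).erase w) (sN G) k
  change Q1.card * (k+1) ≤ (sNQ G Q1).card at hc1
  change Q2.card * (k+1) ≤ (sNQ G Q2).card at hc2
  change ∀ u ∈ (Up G v).erase w, (sN G u \ sNQ G Q1).card ≤ k at hs1
  change ∀ u ∈ (G v).erase w, (sN G u \ sNQ G Q2).card ≤ k at hs2
  have k1 := card_le _ hc1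
  have k2 := card_le _ hc2
  have hU1 : Q1 ⊆ Up G v := hQ1.trans (Finset.erase_subset _ _)
  have hU2 : Q2 ⊆ G v := hQ2.trans (Finset.erase_subset _ _)
  have big : ∀ T Q : Finset V, Q ⊆ T.erase w → (Q ⊆ Up G v ∨ Q ⊆ G v) → Q.card ≤ K0 → K0 + 2 ≤ T.card →
      (∀ u ∈ T.erase w, (sN G u \ sNQ G Q).card ≤ k) → Fintype.card V < 2 * (NQ G Q).card + 2 * L1 := by
    intro T Q h1 h2 h3 h4 h5
    have : ∃ y ∈ T.erase w, y ∉ Q := by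
      apply Finset.exists_mem_notMem_of_card_lt_card
      have := Finset.pred_card_le_card_erase (s := T) (a := w)
      omega
    obtain ⟨y, hy, hyQ⟩ := this
    have h6 := h5 y hy
    have h7 := card_sNQ_eq hG h2
    by_contra hcon
    have := good4 hG hg hyQ (by omega) (by omega)
    omega
  have hvQ1 : v ∉ Q1 := fun h => hG.irr v (mem_Up.1 (hU1 h))
  have hvQ2 : v ∉ Q2 := fun h => hG.irr v (hU2 h)
  have hsub : Q1 ∪ Q2 ⊆ Nb G v := by
    intro q hq
    rw [mem_union] at hq
    rw [mem_Nb]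
    rcases hq with h | h
    · exact Or.inl (mem_Up.1 (hU1 h))
    · exact Or.inr (hU2 h)
  refine ⟨Q1 ∪ Q2, ⟨hsub, ?_, ?_, ?_⟩, ?_⟩
  · have := Finset.card_union_le Q1 Q2; omega
  · have hd := good_deg hG hg hL v
    rw [card_sN hG] at hd
    have m1 : (NQ G Q1).card ≤ (NQ G (Q1 ∪ Q2)).card :=
      Finset.card_le_card (Finset.biUnion_subset_biUnion_of_subset_left _ Finset.subset_union_left)
    have m2 : (NQ G Q2).card ≤ (NQ G (Q1 ∪ Q2)).card :=
      Finset.card_le_card (Finset.biUnion_subset_biUnion_of_subset_left _ Finset.subset_union_right)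
    rcases le_or_gt (K0 + 2) (Up G v).card with h | h
    · have := big _ _ hQ1 (Or.inl hU1) k1 h hs1; omega
    · have := big _ _ hQ2 (Or.inr hU2) k2 (by omega) hs2; omega
  · intro t Q3 L M hgl ht hv3 hc3 hm
    by_contra hcon
    set t' : Fin 5 := ⟨t, by omega⟩ with ht'
    have hne : t' ≠ 4 := by
      intro h
      have := congrArg Fin.val h
      simp [ht'] at this; omega
    have hvQ : v ∉ Q1 ∪ Q2 := by rw [mem_union]; tauto
    have h := hgl v (Q1, Q2, Q3, t') (mem_codes.2 ⟨by omega, by omega, hc3⟩)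
    have e : dec (del v G) v k (Q1, Q2, Q3, t') = PosB (del v G) v k Q1 Q2 (Wd (del v G) Q3 t) := by
      unfold dec; exact if_neg hne
    rw [e] at h
    set P := PosB (del v G) v k Q1 Q2 (Wd (del v G) Q3 t) with hP
    have memP : ∀ y b, (y, b) ∈ P ↔ y ≠ v ∧ y ∉ NQ G (Q1 ∪ Q2) ∧ y ∉ Wd G Q3 t ∧
        (sN (del v G) y \ sNQ (del v G) (if b = true then Q1 else Q2)).card ≤ k := by
      intro y b
      rw [hP]
      simp only [PosB, mem_filter, mem_univ, true_and]
      constructor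
      · rintro ⟨a1, a2, a3, a4⟩
        rw [mem_NQ_del hvQ] at a2
        rw [mem_Wd_del hv3 a1] at a3
        exact ⟨a1, fun h => a2 ⟨h, a1⟩, a3, a4⟩
      · rintro ⟨a1, a2, a3, a4⟩
        rw [mem_NQ_del hvQ, mem_Wd_del hv3 a1]
        exact ⟨a1, fun h => a2 h.1, a3, a4⟩
    have hPc : P.card ≤ ((NQ G (Q1 ∪ Q2) ∪ Wd G Q3 t)ᶜ).card := by
      refine Finset.card_le_card_of_injOn Prod.fst ?_ ?_
      · rintro ⟨y, b⟩ hy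
        rw [mem_coe, memP] at hy
        rw [mem_coe, mem_compl, mem_union]
        tauto
      · have key : ∀ y, (y, true) ∈ P → (y, false) ∈ P → False := by
          intro y h1 h2
          rw [memP] at h1 h2
          have hyv := h1.1
          have h1 := h1.2.2.2
          have h2 := h2.2.2.2
          simp only [if_true, Bool.false_eq_true, if_false] at h1 h2
          have hdis : sNQ (del v G) Q1 ∩ sNQ (del v G) Q2 = ∅ := by
            rw [Finset.eq_empty_iff_forall_notMem]
            rintro ⟨z, b⟩ hz
            rw [mem_inter, mem_sNQ_del hvQ1, mem_sNQ_del hvQ2] at hz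
            obtain ⟨⟨hz1, _⟩, ⟨hz2, _⟩⟩ := hz
            simp only [sNQ, mem_biUnion] at hz1 hz2
            obtain ⟨q, hq, hz1⟩ := hz1
            obtain ⟨r, hr, hz2⟩ := hz2
            have e1 := mem_Up.1 (hU1 hq)
            have e2 := hU2 hr
            cases b
            · rw [mem_sN_false] at hz1 hz2
              exact hG.quad1 hz2 e2 e1 hz1
            · rw [mem_sN_true] at hz1 hz2
              exact hG.quad1 e2 e1 hz1 hz2
          have hle : (sN (del v G) y).card ≤ 2 * k := by
            have : sN (del v G) y ⊆ (sN (del v G) y \ sNQ (del v G) Q1) ∪ (sN (del v G) y \ sNQ (del v G) Q2) := by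
              intro p hp
              rw [mem_union, Finset.mem_sdiff, Finset.mem_sdiff]
              by_contra hh
              have : p ∈ sNQ (del v G) Q1 ∩ sNQ (del v G) Q2 := by rw [mem_inter]; tauto
              rw [hdis] at this
              simp at this
            have h3 := (Finset.card_le_card this).trans (Finset.card_union_le _ _)
            omega
          have hge : (sN G y).card ≤ (sN (del v G) y).card + 1 := by
            by_cases hb : ∃ b, (v, b) ∈ sN G y
            · obtain ⟨b, hb⟩ := hb
              have : sN G y ⊆ insert (v, b) (sN (del v G) y) := by
                rintro ⟨z, c⟩ hz
                rw [mem_insert, mem_sN_del hyv]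
                by_cases hzv : z = v
                · subst hzv
                  left
                  rw [sN_sign hG hb hz]
                · exact Or.inr ⟨hz, hzv⟩
              exact (Finset.card_le_card this).trans (Finset.card_insert_le _ _)
            · push Not at hb
              refine (Finset.card_le_card ?_).trans (Nat.le_succ _)
              rintro ⟨z, c⟩ hz
              rw [mem_sN_del hyv]
              exact ⟨hz, fun e => hb c (e ▸ hz)⟩
          have := good_deg hG hg hL y
          omega
        rintro ⟨z, b⟩ hz ⟨z', b'⟩ hz' e
        simp only at e
        subst e
        rw [mem_coe] at hz hz'
        cases b <;> cases b' <;> first | rfl | exact (key _ hz' hz).elim | exact (key _ hz hz').elim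
    have h2 := h (by omega)
    have hsd : (sN G v \ P).card ≤ (insert w (Nb G v ∩ Wd G Q3 t)).card := by
      refine Finset.card_le_card_of_injOn Prod.fst ?_ ?_
      · rintro ⟨y, b⟩ hy
        rw [mem_coe, Finset.mem_sdiff, memP] at hy
        obtain ⟨hy, hn⟩ := hy
        have hyN := fst_mem_Nb hy
        simp only at hyN
        rw [mem_coe, mem_insert, mem_inter]
        by_contra hcc
        push Not at hcc
        apply hn
        refine ⟨(hG.ne hyN).symm, ?_, hcc.2 hyN, ?_⟩
        · intro hy2
          simp only [NQ, mem_biUnion] at hy2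
          obtain ⟨q, hq, hy2⟩ := hy2
          exact hG.tri (hsub hq) hy2 hyN
        · have sat : ∀ Q : Finset V, v ∉ Q → (sN G y \ sNQ G Q).card ≤ k → (sN (del v G) y \ sNQ (del v G) Q).card ≤ k := by
            intro Q hQ hh
            refine (Finset.card_le_card ?_).trans hh
            rintro ⟨z, c⟩ hz
            rw [Finset.mem_sdiff, mem_sNQ_del hQ, mem_sN_del (hG.ne hyN).symm] at hz
            rw [Finset.mem_sdiff]; tauto
          cases b
          · rw [mem_sN_false] at hy
            simpa using sat Q2 hvQ2 (hs2 y (mem_erase.2 ⟨hcc.1, hy⟩))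
          · rw [mem_sN_true] at hy
            simpa using sat Q1 hvQ1 (hs1 y (mem_erase.2 ⟨hcc.1, mem_Up.2 hy⟩))
      · rintro ⟨z, b⟩ hz ⟨z', b'⟩ hz' e
        simp only at e
        subst e
        rw [mem_coe, Finset.mem_sdiff] at hz hz'
        have hz := hz.1
        have hz' := hz'.1
        rw [sN_sign hG hz hz']
    have := Finset.card_insert_le w (Nb G v ∩ Wd G Q3 t)
    omega
  · rw [mem_union]
    rintro (h | h)
    · exact (mem_erase.1 (hQ1 h)).1 rfl
    · exact (mem_erase.1 (hQ2 h)).1 rfl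
end D
end KR


set_option linter.all false
namespace KR
open Finset Relation
open scoped Classical

section E
variable {V : Type} [Fintype V] [DecidableEq V] {G : V → Finset V}

theorem card_cov {A B C : Finset V} (h : ∀ x ∈ A, x ∈ B ∨ x ∈ C) : A.card ≤ B.card + C.card :=
  (Finset.card_le_card (fun x hx => mem_union.2 (h x hx))).trans (Finset.card_union_le _ _)

theorem HP.inter {k K L1 : ℕ} {v : V} {Q : Finset V} (h : HP G k K L1 v Q) {t : ℕ} {Q3 : Finset V} {L M : ℕ}
    (hg : Good G k K L M) (ht : t < 4) (hv : v ∉ Q3) (hc : Q3.card ≤ K)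
    (hm : (Nb G v ∩ Wd G Q3 t).card + 1 ≤ M) : ((NQ G Q)ᶜ ∩ Wd G Q3 t).card < L1 + L := by
  have h1 := h.2.2.2 t Q3 L M hg ht hv hc hm
  have h2 := h.2.2.1
  have h3 := Finset.card_inter_add_card_sdiff (NQ G Q)ᶜ (Wd G Q3 t)
  have h4 : (NQ G Q)ᶜ \ Wd G Q3 t = (NQ G Q ∪ Wd G Q3 t)ᶜ := by ext x; simp
  have h5 := Finset.card_add_card_compl (NQ G Q)
  rw [h4] at h3
  omega

theorem HP.disj (hG : Hasse G) {k K L1 : ℕ} {v : V} {Q : Finset V} (h : HP G k K L1 v Q) :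
    ∀ y ∈ Nb G v, y ∈ (NQ G Q)ᶜ := by
  intro y hy
  rw [mem_compl]
  intro hy2
  simp only [NQ, mem_biUnion] at hy2
  obtain ⟨q, hq, hy2⟩ := hy2
  exact hG.tri (h.1 hq) hy2 hy

theorem Wd0 (Q : Finset V) : Wd G Q 0 = NQ G Q := by simp [Wd]
theorem Wd1 (Q : Finset V) : Wd G Q 1 = (NQ G Q)ᶜ := by simp [Wd]
theorem Wd2 (x : V) : Wd G {x} 2 = Up G x := by simp [Wd]
theorem Wd3 (x : V) : Wd G {x} 3 = G x := by simp [Wd]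

set_option maxHeartbeats 1000000 in
theorem coloring (hG : Hasse G) {k K L1 M1 L2 M2 L3 M3 : ℕ}
    (hosts : ∀ v w, ∃ Q, HP G k K L1 v Q ∧ w ∉ Q)
    (g1 : Good G k K L1 M1) (g2 : Good G k K L2 M2) (g3 : Good G k K L3 M3)
    (h12 : L1 ≤ L2) (hM1 : 1 ≤ M1) (hM2 : 2 * L1 ≤ M2) (hM3 : 32 * L2 ≤ M3) (hL1 : 1 ≤ L1) (hL13 : L2 ≤ L3)
    (hK : 1 ≤ K) (hn : 100 * L2 < Fintype.card V) :
    ∃ c : V → Bool, (∀ x y, y ∈ Nb G x → c x ≠ c y) ∧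
      (∀ x y, c x = c y → 32 * L2 ≤ (Up G y).card → (Nb G x ∩ Up G y).Nonempty) ∧
      (∀ x y, c x = c y → 32 * L2 ≤ (G y).card → (Nb G x ∩ G y).Nonempty) ∧
      (∀ x y, c x = c y → 30 * L2 + 2 * L3 ≤ (Up G y).card → 32 * L2 ≤ (Nb G x ∩ Up G y).card) ∧
      (∀ x y, c x = c y → 30 * L2 + 2 * L3 ≤ (G y).card → 32 * L2 ≤ (Nb G x ∩ G y).card) := by
  have hv0 : Nonempty V := by
    rw [← Fintype.card_pos_iff]; omega
  obtain ⟨v0⟩ := hv0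
  have hch : ∀ v, ∃ Q, HP G k K L1 v Q := fun v => (hosts v v).imp fun _ h => h.1
  choose Q hQ using hch
  set S : V → Finset V := fun v => (NQ G (Q v))ᶜ with hS
  have notself : ∀ v (Q : Finset V), HP G k K L1 v Q → v ∉ Q := fun v Q h hv => hG.ne (h.1 hv) rfl
  -- D4
  have D4 : ∀ v Q' x, HP G k K L1 v Q' → x ∈ Nb G v → ((NQ G Q')ᶜ ∩ Nb G x).card < 2 * L1 := by
    intro v Q' x h hx
    have e : Wd G {x} 0 = Nb G x := by rw [Wd0]; simp [NQ]
    have e0 : Nb G v ∩ Nb G x = ∅ := by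
      rw [Finset.eq_empty_iff_forall_notMem]
      intro y hy
      rw [mem_inter] at hy
      exact hG.tri hx hy.2 hy.1
    have := h.inter (t := 0) (Q3 := {x}) g1 (by norm_num) (by rw [mem_singleton]; exact hG.ne hx) (by simpa using hK)
      (by rw [e, e0]; simpa using hM1)
    rw [e] at this; omega
  have D5 : ∀ v Q' x Q'', HP G k K L1 v Q' → HP G k K L1 x Q'' → x ∈ Nb G v → x ∉ Q' →
      ((NQ G Q'')ᶜ ∩ (NQ G Q')ᶜ).card < 2 * L2 := by
    intro v Q' x Q'' h h' hx hxQ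
    have := h'.inter (t := 1) (Q3 := Q') g2 (by norm_num) hxQ h.2.1 (by
      rw [Wd1, Finset.inter_comm]
      have := D4 v Q' x h hx
      omega)
    rw [Wd1] at this; omega
  have D6 : ∀ v Q' Q'', HP G k K L1 v Q' → HP G k K L1 v Q'' → ((NQ G Q')ᶜ ∩ NQ G Q'').card < 2 * L1 := by
    intro v Q' Q'' h h'
    have := h.inter (t := 0) (Q3 := Q'') g1 (by norm_num) (notself _ _ h') h'.2.1 (by
      have e0 : Nb G v ∩ NQ G Q'' = ∅ := by
        rw [Finset.eq_empty_iff_forall_notMem]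
        intro y hy
        rw [mem_inter] at hy
        exact (mem_compl.1 (h'.disj hG y hy.1)) hy.2
      rw [Wd0, e0]; simpa using hM1)
    rw [Wd0] at this; omega
  have D7 : ∀ v x, x ∈ Nb G v → (S x ∩ S v).card < 4 * L2 := by
    intro v x hx
    obtain ⟨Q', hQ', hxQ'⟩ := hosts v x
    have a1 := D5 v Q' x (Q x) hQ' (hQ x) hx hxQ'
    have a2 := D6 v (Q v) Q' (hQ v) hQ'
    have a3 : (S x ∩ S v).card ≤ ((NQ G (Q x))ᶜ ∩ (NQ G Q')ᶜ).card + ((NQ G (Q v))ᶜ ∩ NQ G Q').card := by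
      apply card_cov
      intro z hz
      simp only [hS, mem_inter, mem_compl] at hz ⊢
      tauto
    omega
  have szR : ∀ v, (NQ G (Q v)).card + (S v).card = Fintype.card V := fun v => Finset.card_add_card_compl _
  have sz1 : ∀ v, 2 * (S v).card ≤ Fintype.card V + 2 * L1 := by
    intro v
    have := (hQ v).2.2.1
    have := szR v
    omega
  have sz2 : ∀ v, Fintype.card V ≤ 2 * (S v).card + 2 * L1 := by
    intro v
    have := (hQ v).2.2.2 0 ∅ L1 M1 g1 (by norm_num) (by simp) (by simp) (by simpa [Wd, NQ] using hM1)
    have e : NQ G (Q v) ∪ Wd G ∅ 0 = NQ G (Q v) := by simp [Wd, NQ]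
    rw [e] at this
    exact this.le
  have D8 : ∀ x, (S x \ S v0).card ≤ 10 * L2 ∨ (S x ∩ S v0).card ≤ 14 * L2 := by
    intro x
    by_cases hx0 : x ∈ Q v0
    · right
      have := D7 v0 x ((hQ v0).1 hx0)
      omega
    by_cases hex : ∃ y ∈ Nb G x, y ∈ NQ G (Q v0)
    · right
      obtain ⟨y, hy, hy2⟩ := hex
      simp only [NQ, mem_biUnion] at hy2
      obtain ⟨q, hq, hy2⟩ := hy2
      have b1 := D7 y x (Nb_symm.1 hy)
      have b2 := D7 q y hy2
      have b3 := D7 v0 q ((hQ v0).1 hq)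
      have b4 : (S x ∩ S v0).card ≤ (S x ∩ S y).card + ((S y)ᶜ ∩ S v0).card := by
        apply card_cov; intro z hz; simp only [mem_inter, mem_compl] at hz ⊢; tauto
      have b5 : ((S y)ᶜ ∩ S v0).card ≤ (S y ∪ S q)ᶜ.card + (S q ∩ S v0).card := by
        apply card_cov; intro z hz; simp only [mem_inter, mem_compl, mem_union] at hz ⊢; tauto
      have b6 := Finset.card_add_card_compl (S y ∪ S q)
      have b7 := Finset.card_union_add_card_inter (S y) (S q)
      have b8 := sz2 y
      have b9 := sz2 q
      omega
    · left
      push Not at hex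
      have := (hQ x).inter (t := 0) (Q3 := Q v0) g1 (by norm_num) hx0 (hQ v0).2.1 (by
        have e0 : Nb G x ∩ NQ G (Q v0) = ∅ := by
          rw [Finset.eq_empty_iff_forall_notMem]
          intro y hy
          rw [mem_inter] at hy
          exact hex y hy.1 hy.2
        rw [Wd0, e0]; simpa using hM1)
      rw [Wd0] at this
      have e : S x \ S v0 = (NQ G (Q x))ᶜ ∩ NQ G (Q v0) := by ext z; simp [hS]
      rw [e]; omega
  have s0a := sz1 v0
  have s0b := sz2 v0
  have D10 : ∀ x y, (((S x \ S v0).card ≤ 10 * L2) ↔ ((S y \ S v0).card ≤ 10 * L2)) → (S y \ S x).card ≤ 30 * L2 := by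
    intro x y hxy
    have sx := sz2 x
    have e1 := Finset.card_inter_add_card_sdiff (S x) (S v0)
    have e2 := Finset.card_inter_add_card_sdiff (S v0) (S x)
    rw [Finset.inter_comm] at e2
    by_cases hx : (S x \ S v0).card ≤ 10 * L2
    · have hy := hxy.1 hx
      have a1 : (S y \ S x).card ≤ (S y \ S v0).card + (S v0 \ S x).card := by
        apply card_cov; intro z hz; simp only [Finset.mem_sdiff] at hz ⊢; tauto
      omega
    · have hy : ¬ (S y \ S v0).card ≤ 10 * L2 := fun h => hx (hxy.2 h)
      have hx' := (D8 x).resolve_left hx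
      have hy' := (D8 y).resolve_left hy
      have a1 : (S y \ S x).card ≤ (S y ∩ S v0).card + (S x ∪ S v0)ᶜ.card := by
        apply card_cov; intro z hz; simp only [Finset.mem_sdiff, mem_inter, mem_compl, mem_union] at hz ⊢; tauto
      have a2 := Finset.card_add_card_compl (S x ∪ S v0)
      have a3 := Finset.card_union_add_card_inter (S x) (S v0)
      omega
  have D10' : ∀ x y, decide ((S x \ S v0).card ≤ 10 * L2) = decide ((S y \ S v0).card ≤ 10 * L2) →
      (S y \ S x).card ≤ 30 * L2 := fun x y h => D10 x y (decide_eq_decide.1 h)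
  have key : ∀ x y t (W : Finset V), Wd G {y} t = W → W ⊆ Nb G y → t < 4 → x ≠ y → (S y \ S x).card ≤ 30 * L2 →
      ∀ L M, Good G k K L M → (Nb G x ∩ W).card + 1 ≤ M → W.card < 30 * L2 + (L1 + L) := by
    intro x y t W hW hWN ht hxy hd L M hg hm
    have := (hQ x).inter (t := t) (Q3 := {y}) hg ht (by simpa using hxy) (by simpa using hK) (by rw [hW]; exact hm)
    rw [hW] at this
    have : W.card ≤ (S y \ S x).card + ((NQ G (Q x))ᶜ ∩ W).card := by
      apply card_cov
      intro z hz
      have hzy : z ∈ S y := (hQ y).disj hG z (hWN hz)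
      rw [Finset.mem_sdiff, mem_inter]
      by_cases hzx : z ∈ S x
      · exact Or.inr ⟨hzx, hz⟩
      · exact Or.inl ⟨hzy, hzx⟩
    omega
  have sU : ∀ y, Up G y ⊆ Nb G y := fun y z hz => mem_Nb.2 (Or.inl (mem_Up.1 hz))
  have sG : ∀ y, G y ⊆ Nb G y := fun y z hz => mem_Nb.2 (Or.inr hz)
  have key1 : ∀ x y t (W : Finset V), Wd G {y} t = W → W ⊆ Nb G y → t < 4 → (S y \ S x).card ≤ 30 * L2 →
      32 * L2 ≤ W.card → (Nb G x ∩ W).Nonempty := by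
    intro x y t W hW hWN ht hd hc
    by_cases hxy : x = y
    · subst hxy
      rw [Finset.inter_eq_right.2 hWN, ← Finset.card_pos]; omega
    by_contra hne
    rw [Finset.not_nonempty_iff_eq_empty] at hne
    have := key x y t W hW hWN ht hxy hd L1 M1 g1 (by rw [hne]; simpa using hM1)
    omega
  have key2 : ∀ x y t (W : Finset V), Wd G {y} t = W → W ⊆ Nb G y → t < 4 → (S y \ S x).card ≤ 30 * L2 →
      30 * L2 + 2 * L3 ≤ W.card → 32 * L2 ≤ W.card → 32 * L2 ≤ (Nb G x ∩ W).card := by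
    intro x y t W hW hWN ht hd hc hc'
    by_cases hxy : x = y
    · subst hxy
      rw [Finset.inter_eq_right.2 hWN]; exact hc'
    by_contra hne
    have := key x y t W hW hWN ht hxy hd L3 M3 g3 (by omega)
    omega
  refine ⟨fun x => decide ((S x \ S v0).card ≤ 10 * L2), ?_, ?_, ?_, ?_, ?_⟩
  · intro x y hxy heq
    have h1 := D10' x y heq
    have h2 := D7 x y hxy
    have h3 := Finset.card_inter_add_card_sdiff (S y) (S x)
    have h4 := sz2 y
    omega
  · intro x y h hc
    exact key1 x y 2 _ (Wd2 y) (sU y) (by norm_num) (D10' x y h) hc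
  · intro x y h hc
    exact key1 x y 3 _ (Wd3 y) (sG y) (by norm_num) (D10' x y h) hc
  · intro x y h hc
    exact key2 x y 2 _ (Wd2 y) (sU y) (by norm_num) (D10' x y h) hc (by omega)
  · intro x y h hc
    exact key2 x y 3 _ (Wd3 y) (sG y) (by norm_num) (D10' x y h) hc (by omega)
end E
end KR


set_option linter.all false
namespace KR
open Finset Relation
open scoped Classical

section F
variable {V : Type} [Fintype V] [DecidableEq V] {G : V → Finset V}

structure WW (t : ℕ) (c s : V → Bool) (G : V → Finset V) : Prop where
  prop : ∀ x y, x ∈ G y → c x ≠ c y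
  w2 : ∀ x y, x ∈ G y → s x = false → s y = false
  w3a : ∀ x y, x ∈ G y → s x = true → s y = true → G x = ∅
  w3b : ∀ x y, x ∈ G y → s x = false → s y = false → Up G y = ∅
  w4a : ∀ v, s v = true → (G v).card ≤ t
  w4b : ∀ v, s v = false → (Up G v).card ≤ t

theorem structure_final (hG : Hasse G) {c : V → Bool} {t t' : ℕ} (hne : Nonempty V)
    (hc : ∀ x y, y ∈ Nb G x → c x ≠ c y)
    (i1U : ∀ x y, c x = c y → t' ≤ (Up G y).card → (Nb G x ∩ Up G y).Nonempty)
    (i1G : ∀ x y, c x = c y → t' ≤ (G y).card → (Nb G x ∩ G y).Nonempty)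
    (i2U : ∀ x y, c x = c y → t ≤ (Up G y).card → t' ≤ (Nb G x ∩ Up G y).card)
    (i2G : ∀ x y, c x = c y → t ≤ (G y).card → t' ≤ (Nb G x ∩ G y).card)
    (ht' : 1 ≤ t') (htt : t' ≤ t) (hdeg : ∀ v, 2 * t ≤ (Up G v).card + (G v).card) :
    G ∈ X3 V ∨ ∃ c s, WW t c s G := by
  have hcU : ∀ {x y}, x ∈ G y → c x ≠ c y := fun {x y} h => hc x y (mem_Nb.2 (Or.inl h))
  have bool3 : ∀ {a b d : Bool}, a ≠ b → b ≠ d → a = d := by decide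
  have claim1 : ∀ a x, a ∈ G x → t' ≤ (Up G x).card → G a = ∅ := by
    intro a x hax hx
    rw [Finset.eq_empty_iff_forall_notMem]
    intro z hz
    obtain ⟨w, hw⟩ := i1U z x (bool3 (hcU hz) (hcU hax)) hx
    rw [mem_inter, mem_Nb, mem_Up] at hw
    rcases hw.1 with h | h
    · exact hG.quad1 hz hax hw.2 h
    · exact hG.quad2 hz hax hw.2 h
  have claim2 : ∀ x w, x ∈ G w → t' ≤ (G x).card → Up G w = ∅ := by
    intro x w hxw hx
    rw [Finset.eq_empty_iff_forall_notMem]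
    intro z hz
    rw [mem_Up] at hz
    obtain ⟨a, ha⟩ := i1G z x (bool3 (hcU hxw) (hcU hz)).symm hx
    rw [mem_inter, mem_Nb] at ha
    rcases ha.1 with h | h
    · exact hG.quad2 ha.2 hxw hz h
    · exact hG.quad1 ha.2 hxw hz h
  by_cases hm : ∃ m, t ≤ (Up G m).card ∧ t ≤ (G m).card
  · left
    obtain ⟨m, hmU, hmG⟩ := hm
    have rule : ∀ a x w b, a ∈ G x → x ∈ G w → a ∈ Nb G b → w ∈ Nb G b → a ∈ G b ∧ b ∈ G w := by
      intro a x w b h1 h2 h3 h4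
      rw [mem_Nb] at h3 h4
      rcases h3 with h3 | h3
      · rcases h4 with h4 | h4
        · exact (hG.quad1 h3 h1 h2 h4).elim
        · exact (hG.quad2 h3 h1 h2 h4).elim
      · rcases h4 with h4 | h4
        · exact ⟨h3, h4⟩
        · exact (hG.quad1 h1 h2 h4 h3).elim
    have big : ∀ x, c x = c m → t' ≤ (G x).card ∧ t' ≤ (Up G x).card := by
      intro x hx
      have hU := i2U x m hx hmU
      have hGx := i2G x m hx hmG
      obtain ⟨w, hw⟩ := Finset.card_pos.1 (lt_of_lt_of_le ht' hU)
      obtain ⟨a, ha⟩ := Finset.card_pos.1 (lt_of_lt_of_le ht' hGx)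
      rw [mem_inter, mem_Up] at hw
      rw [mem_inter] at ha
      constructor
      · refine hGx.trans (Finset.card_le_card ?_)
        intro z hz
        rw [mem_inter] at hz
        exact (rule z m w x hz.2 hw.2 hz.1 hw.1).1
      · refine hU.trans (Finset.card_le_card ?_)
        intro z hz
        rw [mem_inter, mem_Up] at hz
        exact mem_Up.2 (rule a m z x ha.2 hz.2 ha.1 hz.1).2
    rw [mem_X3]
    refine ⟨univ.filter (fun y => c y ≠ c m ∧ G y = ∅), univ.filter (fun y => c y = c m), ?_, ?_, ?_, ?_, ?_, ?_⟩
    · obtain ⟨a, ha⟩ := Finset.card_pos.1 (lt_of_lt_of_le (lt_of_lt_of_le ht' htt) hmG)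
      refine ⟨a, ?_⟩
      rw [mem_filter]
      exact ⟨mem_univ _, hcU ha, claim1 a m ha (big m rfl).2⟩
    · exact ⟨m, by simp⟩
    · rw [Finset.disjoint_left]
      intro y hy hy2
      rw [mem_filter] at hy hy2
      exact hy.2.1 hy2.2
    · intro y hy
      rw [mem_filter] at hy; exact hy.2.2
    · intro y hy
      rw [mem_filter] at hy
      have hb := big y hy.2
      refine ⟨Finset.card_pos.1 (lt_of_lt_of_le ht' hb.1), ?_⟩
      intro z hz
      rw [mem_filter]
      exact ⟨mem_univ _, by rw [← hy.2]; exact hcU hz, claim1 z y hz hb.2⟩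
    · intro y hyA hyB
      simp only [mem_filter, mem_univ, true_and] at hyA hyB
      push Not at hyA
      refine ⟨hyA hyB, ?_⟩
      intro z hz
      rw [mem_filter]
      exact ⟨mem_univ _, bool3 (hcU hz) hyB⟩
  · right
    push Not at hm
    have sU : ∀ v, decide ((G v).card < t) = true → t ≤ (Up G v).card := by
      intro v hv
      have := of_decide_eq_true hv
      have := hdeg v
      omega
    have sG : ∀ v, decide ((G v).card < t) = false → t ≤ (G v).card := by
      intro v hv
      have := of_decide_eq_false hv
      omega
    refine ⟨c, fun v => decide ((G v).card < t), ?_, ?_, ?_, ?_, ?_, ?_⟩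
    · intro x y h; exact hcU h
    · intro x y h hx
      by_contra hy
      have hy := sU y (by simpa using hy)
      have := claim1 x y h (by omega)
      have h2 := sG x hx
      rw [this] at h2; simp at h2; omega
    · intro x y h hx hy
      have hy := sU y hy
      exact claim1 x y h (by omega)
    · intro x y h hx hy
      have hx := sG x hx
      exact claim2 x y h (by omega)
    · intro v hv
      exact (of_decide_eq_true hv).le
    · intro v hv
      have := sG v hv
      by_contra h
      have := hm v (by omega)
      omega

/-- purity -/
def pur (s : V → Bool) (G : V → Finset V) (x : V) : Prop := if s x = true then G x = ∅ else Up G x = ∅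
noncomputable def EE (c : V → Bool) (G : V → Finset V) : Finset (V × V) :=
  univ.filter (fun p => c p.1 = true ∧ c p.2 = false ∧ p.2 ∈ Nb G p.1)
noncomputable def AB (c : V → Bool) : Finset (V × V) := univ.filter (fun p => c p.1 = true ∧ c p.2 = false)
noncomputable def ZZ (c s : V → Bool) : Finset (V × V) :=
  univ.filter (fun p => (c p.1 = true ∧ c p.2 = false) ∧ s p.1 = s p.2)

theorem WW.hc {t : ℕ} {c s : V → Bool} (h : WW t c s G) {x y : V} (hy : y ∈ Nb G x) : c x ≠ c y := by
  rw [mem_Nb] at hy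
  rcases hy with hy | hy
  · exact h.prop _ _ hy
  · exact (h.prop _ _ hy).symm

theorem WW.nb {t : ℕ} {c s : V → Bool} (h : WW t c s G) {x y : V} :
    y ∈ Nb G x ↔ (x, y) ∈ EE c G ∨ (y, x) ∈ EE c G := by
  simp only [EE, mem_filter, mem_univ, true_and]
  rw [Nb_symm (x := y) (y := x)]
  constructor
  · intro hy
    have := h.hc hy
    cases hx : c x <;> cases hy' : c y <;> simp_all
  · tauto

theorem WW.or1 {t : ℕ} {c s : V → Bool} (h : WW t c s G) {x y : V} (hy : y ∈ Nb G x) (hs : s x ≠ s y) :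
    x ∈ G y ↔ s x = true := by
  have a := h.w2 x y
  have b := h.w2 y x
  rw [mem_Nb] at hy
  cases hx : s x <;> cases hy' : s y <;> simp_all

theorem WW.or2 {t : ℕ} {c s : V → Bool} (h : WW t c s G) {x y : V} (hy : y ∈ Nb G x) (hs : s x = s y) :
    x ∈ G y ↔ (s x = true ↔ pur s G x) := by
  unfold pur
  cases hx : s x
  · have hb := h.w3b y x
    simp only [Bool.false_eq_true, if_false, false_iff]
    constructor
    · intro hxy h0
      have : y ∈ Up G x := mem_Up.2 hxy
      rw [h0] at this; simp at this
    · intro h0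
      rw [mem_Nb] at hy
      rcases hy with hy | hy
      · exact hy
      · exact (h0 (hb hy (hs ▸ hx) hx)).elim
  · have hb := h.w3a x y
    simp only [if_true, true_iff]
    constructor
    · intro hxy; exact hb hxy hx (hs ▸ hx)
    · intro h0
      rw [mem_Nb] at hy
      rcases hy with hy | hy
      · exact hy
      · rw [h0] at hy; simp at hy

theorem WW.or3 (hG : Hasse G) {t : ℕ} {c s : V → Bool} (h : WW t c s G) {x y : V} (hy : y ∈ Nb G x) (hs : s x = s y) :
    x ∈ G y ↔ ¬ (s y = true ↔ pur s G y) := by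
  rw [← h.or2 (Nb_symm.1 hy) hs.symm]
  constructor
  · exact fun h => hG.asymm h
  · intro h'
    rw [mem_Nb] at hy
    tauto

theorem cnt (t : ℕ) (c s : V → Bool) (X : Finset V) (hX : ∀ x y, c x ≠ c y → s x = s y → x ∈ X ∨ y ∈ X)
    (F : Finset (Finset (V × V))) (hF : ∀ G : V → Finset V, WW t c s G → EE c G ∈ F) :
    (univ.filter (fun G : V → Finset V => Hasse G ∧ WW t c s G)).card ≤ 2 ^ X.card * F.card := by
  rw [← Finset.card_powerset, ← Finset.card_product]
  refine Finset.card_le_card_of_injOn (fun G => (X.filter (pur s G), EE c G)) ?_ ?_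
  · intro G hG
    rw [mem_coe, mem_filter] at hG
    rw [mem_coe, mem_product, mem_powerset]
    exact ⟨Finset.filter_subset _ _, hF G hG.2.2⟩
  · intro G hG H hH h
    rw [mem_coe, mem_filter] at hG hH
    obtain ⟨_, hG, wG⟩ := hG
    obtain ⟨_, hH, wH⟩ := hH
    simp only [Prod.mk.injEq] at h
    obtain ⟨hp, hE⟩ := h
    have hp' : ∀ x ∈ X, (pur s G x ↔ pur s H x) := by
      intro x hx
      have := congrArg (fun T => x ∈ T) hp
      simpa [hx] using this
    have hN : ∀ x y, y ∈ Nb G x ↔ y ∈ Nb H x := by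
      intro x y; rw [wG.nb, wH.nb, hE]
    have key : ∀ x y, y ∈ Nb G x → (x ∈ G y ↔ x ∈ H y) := by
      intro x y hy
      have hy' := (hN x y).1 hy
      by_cases hs : s x = s y
      · rcases hX x y (wG.hc hy) hs with h | h
        · rw [wG.or2 hy hs, wH.or2 hy' hs, hp' x h]
        · rw [wG.or3 hG hy hs, wH.or3 hH hy' hs, hp' y h]
      · rw [wG.or1 hy hs, wH.or1 hy' hs]
    funext y; ext x
    constructor
    · intro hx; exact (key x y (mem_Nb.2 (Or.inl hx))).1 hx
    · intro hx; exact (key x y ((hN x y).2 (mem_Nb.2 (Or.inl hx)))).2 hx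

theorem EE_sub (c : V → Bool) (G : V → Finset V) : EE c G ⊆ AB c := by
  intro p hp
  simp only [EE, AB, mem_filter] at *
  tauto

theorem EZ_card {t : ℕ} {c s : V → Bool} (h : WW t c s G) : (EE c G ∩ ZZ c s).card ≤ 2 * t * Fintype.card V := by
  set D : V → Finset V := fun v => if s v = true then G v else Up G v with hD
  have hDc : ∀ v, (D v).card ≤ t := by
    intro v
    simp only [hD]
    split_ifs with hv
    · exact h.w4a v hv
    · exact h.w4b v (by simpa using hv)
  have hsub : EE c G ∩ ZZ c s ⊆ (univ.biUnion (fun v => (D v).image (fun x => (x, v)))) ∪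
      (univ.biUnion (fun v => (D v).image (fun x => (v, x)))) := by
    rintro ⟨x, y⟩ hp
    simp only [EE, ZZ, mem_inter, mem_filter, mem_univ, true_and, mem_Nb] at hp
    obtain ⟨⟨_, _, hxy⟩, _, hs⟩ := hp
    simp only [mem_union, mem_biUnion, mem_univ, true_and, mem_image, Prod.mk.injEq]
    have : x ∈ D y ∨ y ∈ D x := by
      simp only [hD]
      cases hx : s x
      · have hy : s y = false := hs ▸ hx
        simp only [hy, Bool.false_eq_true, if_false, mem_Up]; tauto
      · have hy : s y = true := hs ▸ hx
        simp only [hy, if_true]; tauto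
    rcases this with h | h
    · left; exact ⟨y, x, h, rfl, rfl⟩
    · right; exact ⟨x, y, h, rfl, rfl⟩
  have h1 : (univ.biUnion (fun v => (D v).image (fun x => (x, v)))).card ≤ Fintype.card V * t := by
    rw [← Finset.card_univ]
    exact Finset.card_biUnion_le_card_mul _ _ _ (fun v _ => Finset.card_image_le.trans (hDc v))
  have h2 : (univ.biUnion (fun v => (D v).image (fun x => (v, x)))).card ≤ Fintype.card V * t := by
    rw [← Finset.card_univ]
    exact Finset.card_biUnion_le_card_mul _ _ _ (fun v _ => Finset.card_image_le.trans (hDc v))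
  have h3 := (Finset.card_le_card hsub).trans (Finset.card_union_le _ _)
  nlinarith

theorem cnt1 (t : ℕ) (c s : V → Bool) :
    (univ.filter (fun G : V → Finset V => Hasse G ∧ WW t c s G)).card ≤ 2 ^ Fintype.card V *
      (2 ^ (AB c \ ZZ c s).card * ((univ : Finset (V × V)).powerset.filter
        (fun X => X.card ≤ 2 * t * Fintype.card V)).card) := by
  refine (cnt t c s univ (fun x _ _ _ => Or.inl (mem_univ x))
    (univ.filter (fun X : Finset (V × V) => (X \ (AB c \ ZZ c s)).card ≤ 2 * t * Fintype.card V)) ?_).trans ?_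
  · intro G hG
    rw [mem_filter]
    refine ⟨mem_univ _, (Finset.card_le_card ?_).trans (EZ_card hG)⟩
    intro p hp
    rw [Finset.mem_sdiff, Finset.mem_sdiff] at hp
    rw [mem_inter]
    have := EE_sub c G hp.1
    tauto
  · rw [Finset.card_univ]
    exact Nat.mul_le_mul_left _ (near_count _ _)

theorem cnt2 (t : ℕ) (c s : V → Bool) (X : Finset V) (hX : ∀ x y, c x ≠ c y → s x = s y → x ∈ X ∨ y ∈ X) :
    (univ.filter (fun G : V → Finset V => Hasse G ∧ WW t c s G)).card ≤ 2 ^ X.card * 2 ^ (AB c).card := by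
  rw [← Finset.card_powerset (AB c)]
  exact cnt t c s X hX _ (fun G _ => mem_powerset.2 (EE_sub c G))

theorem ZZ_sub (c s : V → Bool) : ZZ c s ⊆ AB c := by
  intro p hp
  simp only [ZZ, AB, mem_filter] at *
  tauto

theorem card_AB (c : V → Bool) : (AB c).card =
    (univ.filter (fun x => c x = true)).card * (univ.filter (fun x => c x = false)).card := by
  rw [← Finset.card_product]; congr 1; ext ⟨x, y⟩; simp [AB]

theorem card_AB_le (c : V → Bool) : 4 * (AB c).card ≤ (Fintype.card V) ^ 2 := by
  rw [card_AB]
  have h := Finset.card_filter_add_card_filter_not (s := (univ : Finset V)) (fun x => c x = true)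
  simp only [Bool.not_eq_true, Finset.card_univ] at h
  rw [← h]
  nlinarith [sq_nonneg (((univ.filter (fun x => c x = true)).card : ℤ) - (univ.filter (fun x => c x = false)).card),
    four_mul_le_sq_add (univ.filter (fun x => c x = true)).card (univ.filter (fun x => c x = false)).card]

theorem card_four (c s : V → Bool) (b : Bool) : (univ.filter (fun x => c x = b)).card =
    (univ.filter (fun x => c x = b ∧ s x = true)).card + (univ.filter (fun x => c x = b ∧ s x = false)).card := by
  rw [← Finset.card_filter_add_card_filter_not (s := univ.filter (fun x => c x = b)) (fun x => s x = true)]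
  simp only [Finset.filter_filter, Bool.not_eq_true]

theorem small_X (c s : V → Bool) (h1 : (Fintype.card V) ^ 2 < 5 * (AB c).card)
    (h2 : 2 ^ 20 * (ZZ c s).card < (Fintype.card V) ^ 2) :
    ∃ b : Bool, 2 ^ 9 * (univ.filter (fun x => (c x == s x) = b)).card ≤ Fintype.card V := by
  set n := Fintype.card V with hn
  set f : Bool → Bool → Finset V := fun a b => univ.filter (fun x => c x = a ∧ s x = b) with hf
  have e1 := card_four c s true
  have e2 := card_four c s false
  have e3 := Finset.card_filter_add_card_filter_not (s := (univ : Finset V)) (fun x => c x = true)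
  simp only [Bool.not_eq_true, Finset.card_univ] at e3
  rw [card_AB] at h1
  change _ = (f true true).card + (f true false).card at e1
  change _ = (f false true).card + (f false false).card at e2
  have z1 : (f true true).card * (f false true).card ≤ (ZZ c s).card := by
    rw [← Finset.card_product]
    apply Finset.card_le_card
    rintro ⟨x, y⟩ h
    simp only [hf, mem_product, mem_filter, ZZ] at *
    simp only [mem_univ, true_and] at *
    exact ⟨⟨h.1.1, h.2.1⟩, by rw [h.1.2, h.2.2]⟩
  have z2 : (f true false).card * (f false false).card ≤ (ZZ c s).card := by
    rw [← Finset.card_product]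
    apply Finset.card_le_card
    rintro ⟨x, y⟩ h
    simp only [hf, mem_product, mem_filter, ZZ] at *
    simp only [mem_univ, true_and] at *
    exact ⟨⟨h.1.1, h.2.1⟩, by rw [h.1.2, h.2.2]⟩
  have u1 : (univ.filter (fun x => (c x == s x) = true)).card ≤ (f true true).card + (f false false).card := by
    apply card_cov
    intro x hx
    simp only [hf, mem_filter, mem_univ, true_and] at *
    revert hx
    cases c x <;> cases s x <;> simp
  have u2 : (univ.filter (fun x => (c x == s x) = false)).card ≤ (f true false).card + (f false true).card := by
    apply card_cov
    intro x hx
    simp only [hf, mem_filter, mem_univ, true_and] at *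
    revert hx
    cases c x <;> cases s x <;> simp
  rw [e1, e2] at e3 h1
  generalize (f true true).card = a at *
  generalize (f true false).card = b at *
  generalize (f false true).card = p at *
  generalize (f false false).card = q at *
  have m1 : 2 ^ 10 * a < n ∨ 2 ^ 10 * p < n := by
    by_contra hh; push Not at hh
    have := Nat.mul_le_mul hh.1 hh.2
    nlinarith
  have m2 : 2 ^ 10 * b < n ∨ 2 ^ 10 * q < n := by
    by_contra hh; push Not at hh
    have := Nat.mul_le_mul hh.1 hh.2
    nlinarith
  have m3 : ¬ (2 ^ 10 * a < n ∧ 2 ^ 10 * b < n) := by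
    rintro ⟨x, y⟩
    have x1 : 2^9 * (a + b) ≤ n := by omega
    have x2 : p + q ≤ n := by omega
    have := Nat.mul_le_mul x1 x2
    nlinarith
  have m4 : ¬ (2 ^ 10 * p < n ∧ 2 ^ 10 * q < n) := by
    rintro ⟨x, y⟩
    have x1 : 2^9 * (p + q) ≤ n := by omega
    have x2 : a + b ≤ n := by omega
    have := Nat.mul_le_mul x1 x2
    nlinarith
  by_cases ha : 2 ^ 10 * a < n
  · have hb : ¬ 2 ^ 10 * b < n := fun h => m3 ⟨ha, h⟩
    have hq := m2.resolve_left hb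
    exact ⟨true, by omega⟩
  · have hp := m1.resolve_left ha
    have hq : ¬ 2 ^ 10 * q < n := fun h => m4 ⟨hp, h⟩
    have hb := m2.resolve_right hq
    exact ⟨false, by omega⟩
end F
end KR


set_option linter.all false
namespace KR
open Finset Relation
open scoped Classical

section F
variable {V : Type} [Fintype V] [DecidableEq V]

theorem rp_nat (m : ℕ) : (2:ℝ) ^ m = (2:ℝ) ^ (m:ℝ) := (Real.rpow_natCast _ _).symm

theorem rp_mono {a b : ℝ} (h : a ≤ b) : (2:ℝ) ^ a ≤ (2:ℝ) ^ b := Real.rpow_le_rpow_of_exponent_le (by norm_num) h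
theorem rp_add (a b : ℝ) : (2:ℝ) ^ a * (2:ℝ) ^ b = (2:ℝ) ^ (a + b) := (Real.rpow_add (by norm_num) _ _).symm

theorem cnt_class1 (t : ℕ) (ht : 2 ^ 27 * t ≤ Fintype.card V) (c s : V → Bool)
    (h : ¬ ((Fintype.card V) ^ 2 < 5 * (AB c).card ∧ 2 ^ 20 * (ZZ c s).card < (Fintype.card V) ^ 2)) :
    ((univ.filter (fun G : V → Finset V => Hasse G ∧ WW t c s G)).card : ℝ) ≤
      (2:ℝ) ^ ((Fintype.card V : ℝ) + (Fintype.card V : ℝ)^2 / 4 - (Fintype.card V : ℝ)^2 / 2^22) := by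
  set n := Fintype.card V with hn
  have hn2 : (0:ℝ) ≤ (n:ℝ)^2 := by positivity
  by_cases h1 : n ^ 2 < 5 * (AB c).card
  · have h2 : n ^ 2 ≤ 2 ^ 20 * (ZZ c s).card := by
      by_contra hh; exact h ⟨h1, by omega⟩
    have e := cnt1 t c s
    have hent := ent (univ : Finset (V × V)) (2 * t * n) 23
    rw [Finset.card_univ, Fintype.card_prod, ← hn] at hent
    have hsd := Finset.card_sdiff_of_subset (ZZ_sub c s)
    have hle := Finset.card_le_card (ZZ_sub c s)
    have hAB := card_AB_le c
    rw [← hn] at hAB e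
    have e' : ((univ.filter (fun G : V → Finset V => Hasse G ∧ WW t c s G)).card : ℝ) ≤
      2 ^ n * (2 ^ (AB c \ ZZ c s).card * (((univ : Finset (V × V)).powerset.filter
        (fun X => X.card ≤ 2 * t * n)).card : ℝ)) := by exact_mod_cast e
    refine e'.trans ?_
    have hsd' : ((AB c \ ZZ c s).card : ℝ) = (AB c).card - (ZZ c s).card := by
      rw [hsd, Nat.cast_sub hle]
    have hAB' : 4 * ((AB c).card : ℝ) ≤ (n:ℝ)^2 := by exact_mod_cast hAB
    have h2' : (n:ℝ)^2 ≤ 2 ^ 20 * ((ZZ c s).card : ℝ) := by exact_mod_cast h2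
    have ht' : (2:ℝ)^27 * t ≤ n := by exact_mod_cast ht
    have ht2 : (2:ℝ)^27 * t * n ≤ (n:ℝ)^2 := by
      rw [pow_two]; exact mul_le_mul_of_nonneg_right ht' (Nat.cast_nonneg _)
    calc _ ≤ (2:ℝ) ^ (n:ℝ) * ((2:ℝ) ^ ((AB c \ ZZ c s).card : ℝ) * (2:ℝ) ^ (((23:ℕ):ℝ) * ((2 * t * n : ℕ) : ℝ) + 2 * ((n * n : ℕ) : ℝ) / 2 ^ 23)) := by
          rw [Real.rpow_natCast, Real.rpow_natCast]
          gcongr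
      _ ≤ _ := by
          rw [rp_add, rp_add]
          apply rp_mono
          rw [hsd']
          push_cast
          nlinarith
  · have e := cnt2 t c s univ (fun x _ _ _ => Or.inl (mem_univ x))
    rw [Finset.card_univ, ← hn] at e
    have e' : ((univ.filter (fun G : V → Finset V => Hasse G ∧ WW t c s G)).card : ℝ) ≤
      2 ^ n * 2 ^ (AB c).card := by exact_mod_cast e
    refine e'.trans ?_
    rw [rp_nat, rp_nat, rp_add]
    apply rp_mono
    have : 5 * ((AB c).card : ℝ) ≤ (n:ℝ)^2 := by
      exact_mod_cast not_lt.1 h1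
    linarith

theorem cnt_class2 (t : ℕ) (c : V → Bool) (X : Finset V) (b : Bool) (hX : 2 ^ 9 * X.card ≤ Fintype.card V) :
    ((univ.filter (fun G : V → Finset V => Hasse G ∧
      WW t c (fun x => if x ∈ X then (c x == b) else (c x == !b)) G)).card : ℝ) ≤
      (2:ℝ) ^ ((Fintype.card V : ℝ) / 512 + (Fintype.card V : ℝ)^2 / 4) := by
  set n := Fintype.card V with hn
  have e := cnt2 t c (fun x => if x ∈ X then (c x == b) else (c x == !b)) X (by
    intro x y hxy hs
    by_contra hh
    push Not at hh
    simp only [hh.1, hh.2, if_false] at hs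
    revert hs hxy
    cases c x <;> cases c y <;> cases b <;> simp)
  have hAB := card_AB_le c
  rw [← hn] at hAB
  have hAB' : 4 * ((AB c).card : ℝ) ≤ (n:ℝ)^2 := by exact_mod_cast hAB
  have hX' : (2:ℝ) ^ 9 * (X.card:ℝ) ≤ n := by exact_mod_cast hX
  refine le_trans (b := (2:ℝ) ^ X.card * 2 ^ (AB c).card) (by exact_mod_cast e) ?_
  rw [rp_nat, rp_nat, rp_add]
  apply rp_mono
  linarith

theorem weird_count (t : ℕ) (ht : 2 ^ 27 * t ≤ Fintype.card V) :
    ((univ.filter (fun G : V → Finset V => Hasse G ∧ ∃ c s, WW t c s G)).card : ℝ) ≤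
      (2:ℝ) ^ (3 * (Fintype.card V : ℝ) + (Fintype.card V : ℝ)^2 / 4 - (Fintype.card V : ℝ)^2 / 2^22) +
      (2:ℝ) ^ ((Fintype.card V : ℝ)^2 / 4 + (Fintype.card V : ℝ) + (Fintype.card V : ℝ) / 8 + 1) := by
  set n := Fintype.card V with hn
  set P1 : Finset ((V → Bool) × (V → Bool)) := univ.filter (fun p =>
    ¬ (n ^ 2 < 5 * (AB p.1).card ∧ 2 ^ 20 * (ZZ p.1 p.2).card < n ^ 2)) with hP1
  set P2 : Finset ((V → Bool) × Finset V × Bool) :=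
    univ ×ˢ ((univ : Finset V).powerset.filter (fun X => X.card ≤ n / 512)) ×ˢ univ with hP2
  have hsub : (univ.filter (fun G : V → Finset V => Hasse G ∧ ∃ c s, WW t c s G)) ⊆
      P1.biUnion (fun p => univ.filter (fun G : V → Finset V => Hasse G ∧ WW t p.1 p.2 G)) ∪
      P2.biUnion (fun p => univ.filter (fun G : V → Finset V => Hasse G ∧
        WW t p.1 (fun x => if x ∈ p.2.1 then (p.1 x == p.2.2) else (p.1 x == !p.2.2)) G)) := by
    intro G hG
    rw [mem_filter] at hG
    obtain ⟨_, hG, c, s, hw⟩ := hG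
    rw [mem_union, mem_biUnion, mem_biUnion]
    by_cases h : (n ^ 2 < 5 * (AB c).card ∧ 2 ^ 20 * (ZZ c s).card < n ^ 2)
    · right
      obtain ⟨b, hb⟩ := small_X c s h.1 h.2
      refine ⟨(c, univ.filter (fun x => (c x == s x) = b), b), ?_, ?_⟩
      · rw [hP2, mem_product, mem_product, mem_filter, mem_powerset]
        refine ⟨mem_univ _, ⟨subset_univ _, ?_⟩, mem_univ _⟩
        simp only
        omega
      · rw [mem_filter]
        refine ⟨mem_univ _, hG, ?_⟩
        convert hw using 1
        funext x
        simp only [mem_filter, mem_univ, true_and]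
        cases c x <;> cases s x <;> cases b <;> simp
    · left
      refine ⟨(c, s), by rw [hP1, mem_filter]; exact ⟨mem_univ _, h⟩, ?_⟩
      rw [mem_filter]; exact ⟨mem_univ _, hG, hw⟩
  have h1 := (Finset.card_le_card hsub).trans (Finset.card_union_le _ _)
  have h2 : ((P1.biUnion (fun p => univ.filter (fun G : V → Finset V => Hasse G ∧ WW t p.1 p.2 G))).card : ℝ) ≤
      (2:ℝ) ^ (3 * (n : ℝ) + (n : ℝ)^2 / 4 - (n : ℝ)^2 / 2^22) := by
    refine le_trans (b := ∑ p ∈ P1, ((univ.filter (fun G : V → Finset V => Hasse G ∧ WW t p.1 p.2 G)).card : ℝ))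
      (by exact_mod_cast Finset.card_biUnion_le) ?_
    refine (Finset.sum_le_card_nsmul _ _ _ (fun p hp => cnt_class1 t ht p.1 p.2 (by
      rw [hP1, mem_filter] at hp; exact hp.2))).trans ?_
    have hc : (P1.card : ℝ) ≤ (2:ℝ) ^ (2 * (n:ℝ)) := by
      have : P1.card ≤ 2 ^ n * 2 ^ n := by
        refine (Finset.card_le_univ _).trans ?_
        simp [hn]
      have h' : (P1.card : ℝ) ≤ 2 ^ n * 2 ^ n := by exact_mod_cast this
      refine h'.trans ?_
      rw [rp_nat, rp_add]; apply rp_mono; linarith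
    rw [nsmul_eq_mul]
    refine (mul_le_mul_of_nonneg_right hc (by positivity)).trans ?_
    rw [rp_add]; apply rp_mono; rw [← hn]; linarith
  have h3 : ((P2.biUnion (fun p => univ.filter (fun G : V → Finset V => Hasse G ∧
        WW t p.1 (fun x => if x ∈ p.2.1 then (p.1 x == p.2.2) else (p.1 x == !p.2.2)) G))).card : ℝ) ≤
      (2:ℝ) ^ ((n : ℝ)^2 / 4 + (n : ℝ) + (n : ℝ) / 8 + 1) := by
    refine le_trans (b := ∑ p ∈ P2, ((univ.filter (fun G : V → Finset V => Hasse G ∧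
        WW t p.1 (fun x => if x ∈ p.2.1 then (p.1 x == p.2.2) else (p.1 x == !p.2.2)) G)).card : ℝ))
      (by exact_mod_cast Finset.card_biUnion_le) ?_
    refine (Finset.sum_le_card_nsmul _ _ _ (fun p hp => cnt_class2 t p.1 p.2.1 p.2.2 (by
      rw [hP2, mem_product, mem_product, mem_filter] at hp
      have := hp.2.1.2
      rw [← hn]; omega))).trans ?_
    have hent := ent (univ : Finset V) (n / 512) 5
    rw [Finset.card_univ, ← hn] at hent
    have hdiv : ((n / 512 : ℕ) : ℝ) ≤ (n:ℝ) / 512 := by exact_mod_cast Nat.cast_div_le (α := ℝ) (m := n) (n := 512)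
    have hc : (P2.card : ℝ) ≤ (2:ℝ) ^ ((n:ℝ) + (5 * ((n:ℝ)/512) + 2 * (n:ℝ) / 2^5) + 1) := by
      have : P2.card = 2 ^ n * (((univ : Finset V).powerset.filter (fun X => X.card ≤ n / 512)).card * 2) := by
        rw [hP2, Finset.card_product, Finset.card_product]
        simp [hn]
      rw [this]
      push_cast
      rw [Real.rpow_add (by norm_num), Real.rpow_add (by norm_num), Real.rpow_one, Real.rpow_natCast, mul_assoc]
      gcongr
      refine hent.trans (rp_mono ?_)
      push_cast
      linarith
    rw [nsmul_eq_mul]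
    refine (mul_le_mul_of_nonneg_right hc (by positivity)).trans ?_
    rw [rp_add]; apply rp_mono; rw [← hn]
    have : (0:ℝ) ≤ n := Nat.cast_nonneg _
    linarith
  have h1' : ((univ.filter (fun G : V → Finset V => Hasse G ∧ ∃ c s, WW t c s G)).card : ℝ) ≤
    ((P1.biUnion (fun p => univ.filter (fun G : V → Finset V => Hasse G ∧ WW t p.1 p.2 G))).card : ℝ) +
    ((P2.biUnion (fun p => univ.filter (fun G : V → Finset V => Hasse G ∧
        WW t p.1 (fun x => if x ∈ p.2.1 then (p.1 x == p.2.2) else (p.1 x == !p.2.2)) G))).card : ℝ) := by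
    exact_mod_cast h1
  linarith
end F
end KR


set_option linter.all false
namespace KR
open Finset Relation
open scoped Classical

theorem main_cover {V : Type} [Fintype V] [DecidableEq V] {G : V → Finset V} (hG : Hasse G) (u : ℕ)
    (hu : 2 ^ 70 ≤ u) (h1 : 2 ^ 66 * u ≤ Fintype.card V) (h2 : Fintype.card V < 2 ^ 66 * (u + 1))
    (g1 : Good G u (2^68) (2^10*u) (4*u)) (g2 : Good G u (2^68) (2^22*u) (2^13*u))
    (g3 : Good G u (2^68) (2^37*u) (2^28*u)) (g4 : Good G u (2^68) (2^63*u) (2^54*u)) :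
    G ∈ X3 V ∨ ∃ c s, WW (2^39*u) c s G := by
  have hosts : ∀ v w, ∃ Q, HP G u (2^68) (2^10*u) v Q ∧ w ∉ Q := fun v w =>
    host_exists hG (K0 := 2^67) (by norm_num) (by
      calc 2 * Fintype.card V < 2 * (2^66 * (u+1)) := by omega
        _ ≤ (2^67 + 1) * (u+1) := by ring_nf; omega) g1 (by omega) (by omega) (by omega) (by omega) v w
  obtain ⟨c, p1, p2, p3, p4, p5⟩ := coloring hG hosts g1 g2 g3 (by omega) (by omega) (by omega) (by omega) (by omega)
    (by omega) (by norm_num) (by omega)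
  have hne : Nonempty V := by rw [← Fintype.card_pos_iff]; omega
  refine structure_final hG (t := 2^39*u) (t' := 32 * (2^22*u)) hne p1 p2 p3 (fun x y h h' => p4 x y h (by omega))
    (fun x y h h' => p5 x y h (by omega)) (by omega) (by omega) ?_
  intro v
  have := good_deg hG g4 (by omega) v
  rw [card_sN hG] at this
  omega

theorem bad_bound (n u a b s : ℕ) (hu : 2 ^ 80 ≤ u) (h1 : 2 ^ 66 * u ≤ n + 1) (h2 : n + 1 < 2 ^ 66 * (u + 1))
    (ha : a ≤ 2 ^ 63) (hs : (b * s : ℝ) + 2 ^ 69 / 2 ^ s + 10 ≤ a) :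
    ((univ.filter (fun G : Fin (n+1) → Finset (Fin (n+1)) => Hasse G ∧ ¬ Good G u (2^68) (a*u) (b*u))).card : ℝ) ≤
      (2:ℝ) ^ ((n:ℝ) / 2 - 2 * u) * hc n := by
  have hb := bad_count n u (2^68) (a*u) (b*u)
  have hcod := card_codes (n+1) (2^68) 100
  have hent := ent (univ : Finset (Fin (n+1) × Bool)) (b*u) s
  have hcard : (univ : Finset (Fin (n+1) × Bool)).card = (n+1) * 2 := by simp
  rw [hcard] at hent
  have hb' : ((univ.filter (fun G : Fin (n+1) → Finset (Fin (n+1)) => Hasse G ∧ ¬ Good G u (2^68) (a*u) (b*u))).card : ℝ)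
    ≤ ((n:ℝ) + 1) * ((codes (Fin (n+1)) (2^68)).card : ℝ) * ((2 ^ ((n + 1 - 2 * (a*u)) / 2) *
      (((univ : Finset (Fin (n+1) × Bool)).powerset.filter (fun X => X.card ≤ b*u)).card : ℝ)) * hc n) := by
    exact_mod_cast hb
  refine hb'.trans ?_
  have hau : 2 * (a * u) ≤ n + 1 := by
    calc 2 * (a * u) ≤ 2 * (2^63 * u) := by gcongr
      _ ≤ n + 1 := by omega
  have huR : (2:ℝ)^80 ≤ u := by exact_mod_cast hu
  have h2R : (n:ℝ) + 1 ≤ 2^66 * (u+1) := by exact_mod_cast h2.le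
  have e1 : ((n:ℝ) + 1) ≤ (2:ℝ) ^ (u:ℝ) := by
    have : (n + 1) ≤ 2 ^ u := by
      have q1 : u + 1 ≤ 2 * 2 ^ (u/2) := by
        have := Nat.lt_two_pow_self (n := u/2)
        omega
      have q2 : 2 ^ 67 ≤ 2 ^ (u - u/2) := Nat.pow_le_pow_right (by norm_num) (by omega)
      calc n + 1 ≤ 2 ^ 66 * (2 * 2 ^ (u/2)) := h2.le.trans (Nat.mul_le_mul_left _ q1)
        _ = 2 ^ 67 * 2 ^ (u/2) := by ring
        _ ≤ 2 ^ (u - u/2) * 2 ^ (u/2) := Nat.mul_le_mul_right _ q2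
        _ = 2 ^ u := by rw [← pow_add]; congr 1; omega
    rw [Real.rpow_natCast]; exact_mod_cast this
  have e2 : (2:ℝ) ^ ((n + 1 - 2 * (a*u)) / 2) ≤ (2:ℝ) ^ (((n:ℝ)+1)/2 - a * u) := by
    rw [rp_nat]
    apply rp_mono
    have : (((n + 1 - 2 * (a*u)) / 2 : ℕ) : ℝ) ≤ ((n + 1 - 2 * (a*u) : ℕ) : ℝ) / 2 := by
      exact_mod_cast Nat.cast_div_le (α := ℝ) (m := n + 1 - 2 * (a*u)) (n := 2)
    rw [Nat.cast_sub hau] at this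
    push_cast at this
    linarith
  have e3 : (5:ℝ) ≤ (2:ℝ) ^ (3:ℝ) := by norm_num
  have step : ((n:ℝ) + 1) * ((codes (Fin (n+1)) (2^68)).card : ℝ) * ((2 ^ ((n + 1 - 2 * (a*u)) / 2) *
      (((univ : Finset (Fin (n+1) × Bool)).powerset.filter (fun X => X.card ≤ b*u)).card : ℝ)) * hc n) ≤
      (2:ℝ) ^ (u:ℝ) * ((2:ℝ) ^ (3:ℝ) * (2:ℝ) ^ (3 * (((100:ℕ):ℝ) * ((2^68 : ℕ):ℝ) + 2 * (((n+1 : ℕ)) : ℝ) / 2 ^ 100))) *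
      (((2:ℝ) ^ (((n:ℝ)+1)/2 - a * u) * (2:ℝ) ^ ((s:ℝ) * ((b*u:ℕ):ℝ) + 2 * (((n+1)*2 : ℕ) : ℝ) / 2 ^ s)) * hc n) := by
    gcongr
    refine hcod.trans ?_
    gcongr
  refine step.trans ?_
  rw [← mul_assoc]
  apply mul_le_mul_of_nonneg_right _ (Nat.cast_nonneg _)
  simp only [rp_add]
  apply rp_mono
  have hsp : (0:ℝ) < 2 ^ s := by positivity
  have d1 : 2 * (((n+1)*2 : ℕ) : ℝ) / 2 ^ s ≤ 2 ^ 69 / 2 ^ s * u := by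
    rw [div_mul_eq_mul_div]
    refine div_le_div_of_nonneg_right ?_ hsp.le
    push_cast
    linarith
  have d2 : (b * s : ℝ) * u + 2 ^ 69 / 2 ^ s * u + 10 * u ≤ a * u := by
    rw [← add_mul, ← add_mul]; gcongr
  push_cast at d1 ⊢
  have d3 : 2 * ((n:ℝ)+1) / 2 ^ 100 ≤ 1 * u := by
    rw [div_le_iff₀ (by positivity)]; linarith
  nlinarith
end KR


set_option linter.all false
namespace KR
open Finset Relation
open scoped Classical

theorem hc_upper (n : ℕ) (hu : 2 ^ 80 ≤ (n+1) / 2^66) :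
    (hc (n+1) : ℝ) ≤ kleitmanRothschildSum (n+1) + 4 * ((2:ℝ) ^ ((n:ℝ) / 2 - 2 * ((n+1) / 2^66 : ℕ)) * hc n) +
      ((2:ℝ) ^ (3 * ((n+1:ℕ) : ℝ) + ((n+1:ℕ) : ℝ)^2 / 4 - ((n+1:ℕ) : ℝ)^2 / 2^22) +
      (2:ℝ) ^ (((n+1:ℕ) : ℝ)^2 / 4 + ((n+1:ℕ) : ℝ) + ((n+1:ℕ) : ℝ) / 8 + 1)) := by
  obtain ⟨u, hudef⟩ : ∃ u, u = (n+1) / 2^66 := ⟨_, rfl⟩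
  rw [← hudef] at hu ⊢
  have h1 : 2 ^ 66 * u ≤ n + 1 := by omega
  have h2 : n + 1 < 2 ^ 66 * (u + 1) := by omega
  have b1 := bad_bound n u (2^10) 4 61 hu h1 h2 (by norm_num) (by norm_num)
  have b2 := bad_bound n u (2^22) (2^13) 49 hu h1 h2 (by norm_num) (by norm_num)
  have b3 := bad_bound n u (2^37) (2^28) 34 hu h1 h2 (by norm_num) (by norm_num)
  have b4 := bad_bound n u (2^63) (2^54) 10 hu h1 h2 (by norm_num) (by norm_num)
  have hw := weird_count (V := Fin (n+1)) (2^39*u) (by rw [Fintype.card_fin]; omega)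
  rw [Fintype.card_fin] at hw
  have hX := card_X3 (V := Fin (n+1))
  rw [Fintype.card_fin] at hX
  set B1 := univ.filter (fun G : Fin (n+1) → Finset (Fin (n+1)) => Hasse G ∧ ¬ Good G u (2^68) (2^10*u) (4*u))
  set B2 := univ.filter (fun G : Fin (n+1) → Finset (Fin (n+1)) => Hasse G ∧ ¬ Good G u (2^68) (2^22*u) (2^13*u))
  set B3 := univ.filter (fun G : Fin (n+1) → Finset (Fin (n+1)) => Hasse G ∧ ¬ Good G u (2^68) (2^37*u) (2^28*u))
  set B4 := univ.filter (fun G : Fin (n+1) → Finset (Fin (n+1)) => Hasse G ∧ ¬ Good G u (2^68) (2^63*u) (2^54*u))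
  set W := univ.filter (fun G : Fin (n+1) → Finset (Fin (n+1)) => Hasse G ∧ ∃ c s, WW (2^39*u) c s G)
  have hsub : univ.filter (fun G : Fin (n+1) → Finset (Fin (n+1)) => Hasse G) ⊆
      X3 (Fin (n+1)) ∪ (B1 ∪ (B2 ∪ (B3 ∪ (B4 ∪ W)))) := by
    intro G hG
    rw [mem_filter] at hG
    have hG := hG.2
    simp only [mem_union, B1, B2, B3, B4, W, mem_filter, mem_univ, true_and, hG]
    by_cases g1 : Good G u (2^68) (2^10*u) (4*u)
    swap
    · exact Or.inr (Or.inl g1)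
    by_cases g2 : Good G u (2^68) (2^22*u) (2^13*u)
    swap
    · exact Or.inr (Or.inr (Or.inl g2))
    by_cases g3 : Good G u (2^68) (2^37*u) (2^28*u)
    swap
    · exact Or.inr (Or.inr (Or.inr (Or.inl g3)))
    by_cases g4 : Good G u (2^68) (2^63*u) (2^54*u)
    swap
    · exact Or.inr (Or.inr (Or.inr (Or.inr (Or.inl g4))))
    rcases main_cover hG u (by omega) (by rw [Fintype.card_fin]; omega) (by rw [Fintype.card_fin]; omega) g1 g2 g3 g4 with h | h
    · exact Or.inl h
    · exact Or.inr (Or.inr (Or.inr (Or.inr (Or.inr h))))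
  have hle : hc (n+1) ≤ kleitmanRothschildSum (n+1) + (B1.card + (B2.card + (B3.card + (B4.card + W.card)))) := by
    refine (Finset.card_le_card hsub).trans ?_
    refine (Finset.card_union_le _ _).trans ?_
    rw [hX]
    refine Nat.add_le_add_left ((Finset.card_union_le _ _).trans (Nat.add_le_add_left ?_ _)) _
    refine (Finset.card_union_le _ _).trans (Nat.add_le_add_left ?_ _)
    refine (Finset.card_union_le _ _).trans (Nat.add_le_add_left ?_ _)
    exact Finset.card_union_le _ _
  have hle' : (hc (n+1) : ℝ) ≤ kleitmanRothschildSum (n+1) + (B1.card + (B2.card + (B3.card + (B4.card + W.card)))) := by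
    exact_mod_cast hle
  linarith

theorem S_le_hc (n : ℕ) : kleitmanRothschildSum n ≤ hc n := by
  have hX := card_X3 (V := Fin n)
  rw [Fintype.card_fin] at hX
  rw [← hX]
  apply Finset.card_le_card
  intro G hG
  rw [mem_filter]
  exact ⟨mem_univ _, X3_hasse hG⟩

theorem S_pos (n : ℕ) (hn : 100 ≤ n) : (0:ℝ) < kleitmanRothschildSum n := by
  have := S_lower n hn
  rcases Nat.eq_zero_or_pos (kleitmanRothschildSum n) with h | h
  · rw [h] at this
    have : 0 < 2 ^ (n + (n-n/2) + (n/2)*(n-n/2)) := by positivity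
    omega
  · exact_mod_cast h

theorem S_lowerR (n : ℕ) (hn : 100 ≤ n) :
    (2:ℝ) ^ (3 * (n:ℝ) / 2 + (n:ℝ)^2 / 4 - 1) ≤ 4 * ((n:ℝ)+1)^2 * kleitmanRothschildSum n := by
  have h : (2:ℝ) ^ (n + (n-n/2) + (n/2)*(n-n/2)) ≤ 4 * ((n:ℝ)+1)^2 * kleitmanRothschildSum n := by
    exact_mod_cast S_lower n hn
  refine le_trans ?_ h
  rw [rp_nat]
  apply rp_mono
  obtain ⟨m, hm⟩ : ∃ m, m = n / 2 := ⟨_, rfl⟩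
  rw [← hm]
  rcases Nat.even_or_odd' n with ⟨j, hj | hj⟩
  · have : m = j := by omega
    subst this
    have e : n - m = m := by omega
    rw [e, hj]; push_cast; nlinarith
  · have : m = j := by omega
    subst this
    have e : n - m = m + 1 := by omega
    rw [e, hj]; push_cast; nlinarith


theorem t1_aux (n u : ℕ) (H S S' : ℝ) (hH : 0 ≤ H) (hp : 0 < S) (hp' : 0 < S')
    (hgR : (2:ℝ) ^ (n/2) * S ≤ 4 * S') :
    4 * ((2:ℝ) ^ ((n:ℝ) / 2 - 2 * (u:ℝ)) * H) ≤ (64 * (1/4:ℝ) ^ u) * (H / S) * S' := by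
  have e1 : (2:ℝ) ^ ((n:ℝ) / 2 - 2 * (u:ℝ)) ≤ (2:ℝ)^(n/2) * (2 * (1/4:ℝ)^u) := by
    have h4 : (1/4:ℝ)^u = (2:ℝ) ^ (-2 * (u:ℝ)) := by
      rw [Real.rpow_mul (by norm_num), Real.rpow_natCast]; congr 1
      rw [Real.rpow_neg (by norm_num)]; norm_num
    have h5 : (2:ℝ)^(n/2) * (2 * (1/4:ℝ)^u) = (2:ℝ) ^ (((n/2:ℕ):ℝ) + (1 + -2 * (u:ℝ))) := by
      rw [h4, rp_nat, Real.rpow_add (by norm_num), Real.rpow_add (by norm_num), Real.rpow_one]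
    rw [h5]
    apply rp_mono
    have : (n:ℝ) ≤ 2 * ((n/2:ℕ):ℝ) + 1 := by
      have : n ≤ 2 * (n/2) + 1 := by omega
      exact_mod_cast this
    linarith
  have hS : H = H / S * S := by field_simp
  have hq : 0 ≤ H / S := by positivity
  calc 4 * ((2:ℝ) ^ ((n:ℝ) / 2 - 2 * (u:ℝ)) * H) ≤ 4 * (((2:ℝ)^(n/2) * (2 * (1/4:ℝ)^u)) * H) := by gcongr
    _ = 8 * (1/4:ℝ)^u * (H / S) * ((2:ℝ)^(n/2) * S) := by
        have : 8 * (1/4:ℝ)^u * (H / S) * ((2:ℝ)^(n/2) * S) = 8 * (1/4:ℝ)^u * (2:ℝ)^(n/2) * (H / S * S) := by ring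
        rw [this, ← hS]; ring
    _ ≤ 8 * (1/4:ℝ)^u * (H / S) * (4 * S') := by gcongr
    _ ≤ _ := by
        have : 0 ≤ (1/4:ℝ)^u * (H / S) * S' := by positivity
        linarith

theorem t2_aux (N S' : ℝ) (hp' : 0 < S') (hNR : 16777216 ≤ N)
    (hlow : (2:ℝ) ^ (3 * N / 2 + N^2 / 4 - 1) ≤ 4 * (N+1)^2 * S') :
    ((2:ℝ) ^ (3 * N + N^2 / 4 - N^2 / 2^22) + (2:ℝ) ^ (N^2 / 4 + N + N / 8 + 1)) ≤
      96 * (N + 1)^2 * (2:ℝ) ^ (-(3/8) * N) * S' := by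
  have hsq : 16777216 * N ≤ N^2 := by nlinarith
  have a1 : (2:ℝ) ^ (3 * N + N^2 / 4 - N^2 / 2^22) ≤ (2:ℝ) ^ (N^2 / 4 + N + N / 8 + 1) := by
    apply rp_mono; norm_num; linarith
  have a2 : (2:ℝ) ^ (N^2 / 4 + N + N / 8 + 1) = (2:ℝ) ^ (3 * N / 2 + N^2 / 4 - 1) * (2:ℝ) ^ (-(3/8) * N) * 4 := by
    have : (4:ℝ) = 2 ^ (2:ℝ) := by norm_num
    have h3 : (2:ℝ) ^ (3 * N / 2 + N^2 / 4 - 1) * (2:ℝ) ^ (-(3/8) * N) * 4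
      = (2:ℝ) ^ (3 * N / 2 + N^2 / 4 - 1) * (2:ℝ) ^ (-(3/8) * N) * 2 ^ (2:ℝ) := by rw [← this]
    rw [h3, ← Real.rpow_add (by norm_num), ← Real.rpow_add (by norm_num)]; congr 1; ring
  have hpos : (0:ℝ) ≤ (2:ℝ) ^ (-(3/8) * N) := by positivity
  have a3 := mul_le_mul_of_nonneg_right hlow hpos
  have a4 : 0 ≤ (N+1)^2 * (2:ℝ) ^ (-(3/8) * N) * S' := by positivity
  linarith

theorem rec_bound (n : ℕ) (hu : 2 ^ 80 ≤ (n+1) / 2^66) :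
    (hc (n+1) : ℝ) / kleitmanRothschildSum (n+1) ≤ 1 + (64 * (1/4:ℝ) ^ ((n+1) / 2^66)) * ((hc n : ℝ) / kleitmanRothschildSum n)
      + 96 * (((n+1:ℕ):ℝ) + 1)^2 * (2:ℝ) ^ (-(3/8) * ((n+1:ℕ):ℝ)) := by
  have hup := hc_upper n hu
  have hgrow := S_grow n
  have hp := S_pos n (by omega)
  have hp' := S_pos (n+1) (by omega)
  have hlow := S_lowerR (n+1) (by omega)
  have hgR : (2:ℝ) ^ (n/2) * kleitmanRothschildSum n ≤ 4 * kleitmanRothschildSum (n+1) := by exact_mod_cast hgrow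
  have hNbig : 16777216 ≤ n + 1 := by omega
  have hNR : (16777216:ℝ) ≤ ((n+1:ℕ):ℝ) := by exact_mod_cast hNbig
  have t1 := t1_aux n ((n+1)/2^66) (hc n) _ _ (Nat.cast_nonneg _) hp hp' hgR
  have t2 := t2_aux _ _ hp' hNR hlow
  clear hu hNbig hgrow hgR hlow hNR
  rw [div_le_iff₀ hp', add_mul, add_mul, one_mul]
  refine hup.trans ?_
  exact add_le_add (add_le_add le_rfl t1) t2


open Filter Topology in
theorem lim_lemma (r e d : ℕ → ℝ) (hr : ∀ n, 0 ≤ r n) (he0 : ∀ n, 0 ≤ e n) (he : Tendsto e atTop (𝓝 0))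
    (hd : Tendsto d atTop (𝓝 0)) (h : ∀ᶠ n in atTop, r (n+1) ≤ 1 + e n * r n + d n) (h1 : ∀ᶠ n in atTop, 1 ≤ r n) :
    Tendsto r atTop (𝓝 1) := by
  have he' : ∀ᶠ n in atTop, e n ≤ 1/2 := he.eventually_le_const (by norm_num)
  have hd' : ∀ᶠ n in atTop, d n ≤ 1 := hd.eventually_le_const (by norm_num)
  obtain ⟨n0, hn0⟩ := eventually_atTop.1 (h.and (he'.and hd'))
  have hb : ∀ m, r (n0 + m) ≤ max (r n0) 4 := by
    intro m
    induction m with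
    | zero => exact le_max_left _ _
    | succ m ih =>
      obtain ⟨a1, a2, a3⟩ := hn0 (n0 + m) (by omega)
      have a4 : e (n0+m) * r (n0+m) ≤ 1/2 * r (n0+m) := mul_le_mul_of_nonneg_right a2 (hr _)
      have : (4:ℝ) ≤ max (r n0) 4 := le_max_right _ _
      rw [← add_assoc]
      linarith
  set C := max (r n0) 4
  rw [← tendsto_add_atTop_iff_nat 1]
  have hlim : Tendsto (fun n => 1 + e n * C + d n) atTop (𝓝 1) := by
    have := (tendsto_const_nhds (x := (1:ℝ)) (f := atTop (α := ℕ))).add (he.mul_const C) |>.add hd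
    simpa using this
  refine tendsto_of_tendsto_of_tendsto_of_le_of_le' tendsto_const_nhds hlim ?_ ?_
  · exact (tendsto_add_atTop_nat 1).eventually h1
  · filter_upwards [h, eventually_ge_atTop n0] with n hn hge
    have := hb (n - n0)
    rw [Nat.add_sub_cancel' hge] at this
    have := mul_le_mul_of_nonneg_left this (he0 n)
    linarith

open Filter Topology in
theorem d_lim : Tendsto (fun n : ℕ => 96 * (((n+1:ℕ):ℝ) + 1)^2 * (2:ℝ) ^ (-(3/8) * ((n+1:ℕ):ℝ))) atTop (𝓝 0) := by
  have hb : (2:ℝ) ^ (-(3/8):ℝ) < 1 := Real.rpow_lt_one_of_one_lt_of_neg (by norm_num) (by norm_num)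
  have hb0 : (0:ℝ) < (2:ℝ) ^ (-(3/8):ℝ) := by positivity
  have h := tendsto_pow_const_mul_const_pow_of_abs_lt_one 2 (r := (2:ℝ) ^ (-(3/8):ℝ)) (by rw [abs_of_pos hb0]; exact hb)
  have h' := (h.const_mul 384).comp (tendsto_add_atTop_nat 1)
  rw [mul_zero] at h'
  refine squeeze_zero (fun n => by positivity) (fun n => ?_) h'
  simp only [Function.comp]
  rw [Real.rpow_mul (by norm_num), Real.rpow_natCast, ← mul_assoc]
  have : (1:ℝ) ≤ ((n+1:ℕ):ℝ) := by push_cast; linarith [Nat.cast_nonneg (α := ℝ) n]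
  refine mul_le_mul_of_nonneg_right ?_ (by positivity)
  nlinarith

open Filter Topology in
theorem u_lim : Tendsto (fun n : ℕ => (n+1) / 2^66) atTop atTop := by
  rw [tendsto_atTop]
  intro b
  filter_upwards [eventually_ge_atTop (2^66*b)] with n hn
  omega

open Filter Topology in
theorem ratio_lim : Tendsto (fun n => (hc n : ℝ) / kleitmanRothschildSum n) atTop (𝓝 1) := by
  refine lim_lemma _ (fun n => 64 * (1/4:ℝ) ^ ((n+1) / 2^66)) _ (fun n => by positivity) (fun n => by positivity) ?_ d_lim ?_ ?_
  · have h := (tendsto_pow_atTop_nhds_zero_of_lt_one (r := (1/4:ℝ)) (by norm_num) (by norm_num)).comp u_lim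
    simpa using h.const_mul 64
  · filter_upwards [u_lim.eventually_ge_atTop (2^80)] with n hn
    exact rec_bound n hn
  · filter_upwards [eventually_ge_atTop 100] with n hn
    rw [le_div_iff₀ (S_pos n hn), one_mul]
    exact_mod_cast S_le_hc n
end KR

/-- The number of distinct games on `n` time points is asymptotically
`Σ_{i=1}^{n} Σ_{j=1}^{n-i} C(n,i) C(n-i,j) (2^i-1)^j (2^j-1)^{n-i-j}`. -/
theorem numGames_isEquivalent :
    Asymptotics.IsEquivalent Filter.atTop
      (fun n => (numGames n : ℝ)) (fun n => (kleitmanRothschildSum n : ℝ)) := by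
  rw [Asymptotics.isEquivalent_iff_tendsto_one]
  · refine KR.ratio_lim.congr (fun n => ?_)
    rw [Pi.div_apply, KR.numGames_eq_hc]
  · filter_upwards [Filter.eventually_ge_atTop 100] with n hn
    exact (KR.S_pos n hn).ne'
end

section
/- (Scott–Lemmon correspondence) Let W be a type, R : W → W → Prop, and h, i, j, k : ℕ. Write Box P w := ∀ v, R w v → P v, Dia P w := ∃ v, R w v ∧ P v, and let Box^n, Dia^n denote n-fold iterates of these operators on predicates; write R^n for the n-fold relational composition of R (with R^0 equal to equality). If for every valuation P : W → Prop and every world w : W one has Dia^h (Box^i P) w → Box^j (Dia^k P) w, then for all worlds u, v, w : W, if R^h w v and R^j w u, then there exists x : W with R^i v x and R^k u x. -/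
/-- `boxN R n P`: the `n`-fold iterate of the box modality applied to `P`. -/
def boxN {W : Type*} (R : W → W → Prop) : ℕ → (W → Prop) → (W → Prop)
  | 0, P => P
  | n + 1, P => fun w => ∀ v, R w v → boxN R n P v

/-- `diaN R n P`: the `n`-fold iterate of the diamond modality applied to `P`. -/
def diaN {W : Type*} (R : W → W → Prop) : ℕ → (W → Prop) → (W → Prop)
  | 0, P => P
  | n + 1, P => fun w => ∃ v, R w v ∧ diaN R n P v

/-- `relPow R n`: the `n`-fold relational composition of `R`, with
`relPow R 0` being equality. -/
def relPow {W : Type*} (R : W → W → Prop) : ℕ → W → W → Prop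
  | 0 => fun a b => a = b
  | n + 1 => fun a b => ∃ c, relPow R n a c ∧ R c b

theorem sl_head {W : Type*} (R : W → W → Prop) (n : ℕ) :
    ∀ a b : W, relPow R (n + 1) a b ↔ ∃ c, R a c ∧ relPow R n c b := by
  induction n with
  | zero => intro a b; simp [relPow]
  | succ n ih =>
    intro a b
    constructor
    · rintro ⟨c, hc, hcb⟩
      obtain ⟨d, had, hdc⟩ := (ih a c).1 hc
      exact ⟨d, had, c, hdc, hcb⟩
    · rintro ⟨d, had, c, hdc, hcb⟩
      exact ⟨c, (ih a c).2 ⟨d, had, hdc⟩, hcb⟩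

theorem sl_box {W : Type*} (R : W → W → Prop) (P : W → Prop) (n : ℕ) :
    ∀ w : W, boxN R n P w ↔ ∀ v, relPow R n w v → P v := by
  induction n with
  | zero => intro w; simp [relPow, boxN]
  | succ n ih =>
    intro w
    simp only [boxN, ih, sl_head]
    exact ⟨fun H v ⟨c, h1, h2⟩ => H c h1 v h2, fun H c h1 v h2 => H v ⟨c, h1, h2⟩⟩

theorem sl_dia {W : Type*} (R : W → W → Prop) (P : W → Prop) (n : ℕ) :
    ∀ w : W, diaN R n P w ↔ ∃ v, relPow R n w v ∧ P v := by
  induction n with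
  | zero => intro w; simp [relPow, diaN]
  | succ n ih =>
    intro w
    simp only [diaN, ih, sl_head]
    exact ⟨fun ⟨c, h1, v, h2, h3⟩ => ⟨v, ⟨c, h1, h2⟩, h3⟩,
      fun ⟨v, ⟨c, h1, h2⟩, h3⟩ => ⟨c, h1, v, h2, h3⟩⟩

/-- **Scott–Lemmon frame correspondence.** If the frame `⟨W, R⟩` validates the
scheme `◇^h □^i φ → □^j ◇^k φ`, then for all worlds `u, v, w`, if `w R^h v`
and `w R^j u` then there is `x` with `v R^i x` and `u R^k x`. -/
theorem scott_lemmon {W : Type*} (R : W → W → Prop) (h i j k : ℕ)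
    (hval : ∀ (P : W → Prop) (w : W),
      diaN R h (boxN R i P) w → boxN R j (diaN R k P) w) :
    ∀ u v w : W, relPow R h w v → relPow R j w u →
      ∃ x : W, relPow R i v x ∧ relPow R k u x := by
  intro u v w hv hu
  have h1 : diaN R h (boxN R i (relPow R i v)) w :=
    (sl_dia R _ h w).2 ⟨v, hv, (sl_box R _ i v).2 fun _ hx => hx⟩
  have h2 := (sl_box R _ j w).1 (hval _ w h1) u hu
  obtain ⟨x, hx, hx'⟩ := (sl_dia R _ k u).1 h2
  exact ⟨x, hx', hx⟩
end

section
/- (Asymptotics of the number of S5 frames) The number of isomorphism classes of S5 modal frames with n worlds, which equals p(n) = Fintype.card (Nat.Partition n), is asymptotically the Hardy–Ramanujan number: (fun n => (Fintype.card (Nat.Partition n) : ℝ)) is asymptotically equivalent, as n → ∞, to (fun n => (1 / (4 * Real.sqrt 3 * n)) * Real.exp (Real.pi * Real.sqrt (2 * n / 3))), i.e., the ratio of the two tends to 1. -/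
open Filter Asymptotics Real
namespace HR
open scoped Topology

noncomputable def P (q : ℂ) : ℂ := ∏' n : ℕ, (1 - q ^ (n + 1))

lemma P_ne_zero {q : ℂ} (hq : ‖q‖ < 1) : P q ≠ 0 := by
  unfold P
  simp only [sub_eq_add_neg]
  refine tprod_one_add_ne_zero_of_summable (f := fun n => -q ^ (n+1)) ?_ ?_
  · intro i h
    have : q ^ (i+1) = 1 := by linear_combination -h
    have h2 := congrArg norm this
    rw [norm_pow, norm_one] at h2
    have := pow_lt_one₀ (norm_nonneg q) hq (Nat.succ_ne_zero i)
    simp only [Nat.succ_eq_add_one] at this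
    linarith
  · simpa using (summable_nat_add_iff 1).mpr (summable_geometric_of_lt_one (norm_nonneg _) hq)

lemma tendsto_P {q : ℂ} (hq : ‖q‖ < 1) :
    Tendsto (fun K => ∏ i ∈ Finset.range K, (1 - q ^ (i+1))) atTop (𝓝 (P q)) :=
  (ModularForm.multipliable_one_sub_pow hq).hasProd.tendsto_prod_nat

open PowerSeries in
lemma factor_hasSum {q : ℂ} (hq : ‖q‖ < 1) (i : ℕ) :
    Summable (fun n => ‖coeff n (PowerSeries.mk fun n => if (i+1) ∣ n then (1:ℂ) else 0) * q ^ n‖) ∧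
    HasSum (fun n => coeff n (PowerSeries.mk fun n => if (i+1) ∣ n then (1:ℂ) else 0) * q ^ n)
      (1 - q ^ (i+1))⁻¹ := by
  have hs : Summable (fun n => ‖coeff n (PowerSeries.mk fun n => if (i+1) ∣ n then (1:ℂ) else 0) * q ^ n‖) := by
    refine Summable.of_nonneg_of_le (fun _ => norm_nonneg _) (fun n => ?_) (summable_geometric_of_lt_one (norm_nonneg q) hq)
    simp only [coeff_mk, norm_mul, norm_pow]
    split_ifs <;> simp
  refine ⟨hs, ?_⟩
  have h1 : HasSum (fun j : ℕ => (q ^ (i+1)) ^ j) (1 - q ^ (i+1))⁻¹ := by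
    apply hasSum_geometric_of_norm_lt_one
    rw [norm_pow]
    exact pow_lt_one₀ (norm_nonneg q) hq (Nat.succ_ne_zero i)
  have hinj : Function.Injective (fun j : ℕ => (i+1) * j) := fun a b h => by simpa using h
  rw [← hinj.hasSum_iff]
  · convert h1 using 2 with j
    simp [pow_mul]
  · intro x hx
    simp only [coeff_mk]
    rw [if_neg, zero_mul]
    rintro ⟨c, rfl⟩
    exact hx ⟨c, rfl⟩

open PowerSeries in
noncomputable def A (K : ℕ) : ℂ⟦X⟧ :=
  ∏ i ∈ Finset.range K, (PowerSeries.mk fun n => if (i+1) ∣ n then (1:ℂ) else 0)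

open PowerSeries in
lemma A_hasSum {q : ℂ} (hq : ‖q‖ < 1) (K : ℕ) :
    Summable (fun n => ‖coeff n (A K) * q ^ n‖) ∧
    HasSum (fun n => coeff n (A K) * q ^ n) (∏ i ∈ Finset.range K, (1 - q ^ (i+1)))⁻¹ := by
  induction K with
  | zero =>
    have h0 : ∀ n, n ≠ 0 → coeff n (A 0) * q ^ n = 0 := by
      intro n hn; simp [A, coeff_one, hn]
    constructor
    · apply summable_of_ne_finset_zero (s := {0})
      intro n hn
      rw [h0 n (by simpa using hn), norm_zero]
    · convert hasSum_single 0 h0 using 1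
      simp [A]
  | succ K ih =>
    obtain ⟨f1, f2⟩ := factor_hasSum hq K
    have key : ∀ n, coeff n (A (K+1)) * q ^ n = ∑ kl ∈ Finset.HasAntidiagonal.antidiagonal n,
        (coeff kl.1 (A K) * q ^ kl.1) * (coeff kl.2 (PowerSeries.mk fun n => if (K+1) ∣ n then (1:ℂ) else 0) * q ^ kl.2) := by
      intro n
      rw [A, Finset.prod_range_succ, coeff_mul, Finset.sum_mul, ← A]
      refine Finset.sum_congr rfl fun kl hkl => ?_
      rw [← Finset.HasAntidiagonal.mem_antidiagonal.1 hkl, pow_add]; ring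
    have hs := summable_norm_sum_mul_antidiagonal_of_summable_norm ih.1 f1
    have ht := tsum_mul_tsum_eq_tsum_sum_antidiagonal_of_summable_norm ih.1 f1
    simp only [← key] at hs ht
    refine ⟨hs, ?_⟩
    rw [Finset.prod_range_succ, mul_inv, ← ih.2.tsum_eq, ← f2.tsum_eq, ht]
    exact hs.of_norm.hasSum

open PowerSeries PowerSeries.WithPiTopology in
lemma coeff_A (K n : ℕ) : coeff n (A K) = ((Nat.Partition.restricted n (· ≤ K)).card : ℂ) := by
  have h := Nat.Partition.powerSeriesMk_card_restricted_eq_tprod ℂ (· ≤ K)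
  have : A K = PowerSeries.mk fun n => ((Nat.Partition.restricted n (· ≤ K)).card : ℂ) := by
    rw [h, tprod_eq_prod (s := Finset.range K)]
    · unfold A
      refine Finset.prod_congr rfl fun i hi => ?_
      rw [if_pos (by simpa [Nat.succ_le_iff] using hi)]
      symm
      refine HasSum.tsum_eq ?_
      rw [HasSum, PowerSeries.WithPiTopology.tendsto_iff_coeff_tendsto]
      intro d
      refine tendsto_atTop_of_eventually_const (i₀ := Finset.range (d+1)) (fun s hs => ?_)
      simp only [map_sum, coeff_X_pow, coeff_mk]
      split_ifs with hd
      · obtain ⟨c, rfl⟩ := hd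
        rw [Finset.sum_eq_single c]
        · simp
        · intro b _ hb; rw [if_neg]; simpa using fun h => hb h.symm
        · intro hc; exfalso; apply hc; apply hs; simp; nlinarith
      · apply Finset.sum_eq_zero
        intro b _; rw [if_neg]; rintro rfl; exact hd ⟨b, rfl⟩
    · intro b hb
      rw [if_neg (by simpa [Nat.succ_le_iff] using hb)]
  rw [this, coeff_mk]

lemma restricted_le (K n : ℕ) : (Nat.Partition.restricted n (· ≤ K)).card ≤ Fintype.card (Nat.Partition n) :=
  Finset.card_le_univ _

lemma restricted_eq (K n : ℕ) (h : n ≤ K) : (Nat.Partition.restricted n (· ≤ K)).card = Fintype.card (Nat.Partition n) := by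
  rw [← Finset.card_univ]
  congr 1
  ext p
  simp only [Nat.Partition.restricted, Finset.mem_filter, Finset.mem_univ, true_and, iff_true]
  intro i hi
  exact (p.le_of_mem_parts hi).trans h

lemma summable_p {q : ℂ} (hq : ‖q‖ < 1) :
    Summable (fun n => ‖(Fintype.card (Nat.Partition n) : ℂ) * q ^ n‖) := by
  have hr : ‖(‖q‖ : ℂ)‖ < 1 := by simpa using hq
  have ht : Tendsto (fun K => ‖(∏ i ∈ Finset.range K, (1 - (‖q‖ : ℂ) ^ (i+1)))⁻¹‖) atTop (𝓝 ‖(P ‖q‖)⁻¹‖) :=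
    ((tendsto_P hr).inv₀ (P_ne_zero hr)).norm
  obtain ⟨C, hC⟩ := ht.bddAbove_range
  refine summable_of_sum_range_le (c := C) (fun _ => norm_nonneg _) (fun M => ?_)
  refine le_trans ?_ (hC ⟨M, rfl⟩)
  obtain ⟨a1, a2⟩ := A_hasSum hr M
  simp only [coeff_A] at a1 a2
  have a3 : HasSum (fun n => ((Nat.Partition.restricted n (· ≤ M)).card : ℝ) * ‖q‖ ^ n)
     (∏ i ∈ Finset.range M, (1 - ‖q‖ ^ (i+1)))⁻¹ := by exact_mod_cast a2
  have : ∑ i ∈ Finset.range M, ‖(Fintype.card (Nat.Partition i) : ℂ) * q ^ i‖ =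
    ∑ i ∈ Finset.range M, ((Nat.Partition.restricted i (· ≤ M)).card : ℝ) * ‖q‖ ^ i := by
    refine Finset.sum_congr rfl fun i hi => ?_
    rw [restricted_eq M i (Finset.mem_range.1 hi).le]; simp
  rw [this]
  refine (sum_le_hasSum _ (fun i _ => by positivity) a3).trans ?_
  refine (le_abs_self _).trans (le_of_eq ?_)
  simp only [← Real.norm_eq_abs]; rw [← Complex.norm_real]; push_cast; rfl

lemma hasSum_p {q : ℂ} (hq : ‖q‖ < 1) :
    HasSum (fun n => (Fintype.card (Nat.Partition n) : ℂ) * q ^ n) (P q)⁻¹ := by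
  have hs := summable_p hq
  have h1 : Tendsto (fun K => ∑' n, ((Nat.Partition.restricted n (· ≤ K)).card : ℂ) * q ^ n) atTop
      (𝓝 (∑' n, (Fintype.card (Nat.Partition n) : ℂ) * q ^ n)) := by
    refine tendsto_tsum_of_dominated_convergence hs ?_ ?_
    · intro n
      refine tendsto_atTop_of_eventually_const (i₀ := n) fun K hK => ?_
      rw [restricted_eq K n hK]
    · refine Eventually.of_forall fun K n => ?_
      simp only [norm_mul, Complex.norm_natCast]
      gcongr
      exact restricted_le K n
  have h2 := (tendsto_P hq).inv₀ (P_ne_zero hq)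
  have h3 : ∀ K, ∑' n, ((Nat.Partition.restricted n (· ≤ K)).card : ℂ) * q ^ n = (∏ i ∈ Finset.range K, (1 - q ^ (i+1)))⁻¹ := by
    intro K
    have := (A_hasSum hq K).2
    simp only [coeff_A] at this
    exact this.tsum_eq
  simp only [h3] at h1
  rw [tendsto_nhds_unique h2 h1]
  exact hs.of_norm.hasSum

lemma norm_exp_neg {w : ℂ} (hw : 0 < w.re) : ‖Complex.exp (-w)‖ < 1 := by
  rw [Complex.norm_exp]; simpa using hw

lemma integral_char (k : ℤ) :
    ∫ θ in (-π)..π, Complex.exp (k * θ * Complex.I) = if k = 0 then 2 * (π : ℂ) else 0 := by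
  split_ifs with h
  · simp [h]; ring
  · have hk : (k : ℂ) * Complex.I ≠ 0 := by simp [h, Complex.I_ne_zero]
    have : ∀ θ : ℝ, Complex.exp (k * θ * Complex.I) = Complex.exp (k * Complex.I * θ) := by
      intro θ; ring_nf
    simp only [this]
    rw [integral_exp_mul_complex hk]
    have : Complex.exp (k * Complex.I * (π : ℝ)) = Complex.exp (k * Complex.I * ((-π : ℝ) : ℂ)) := by
      rw [Complex.exp_eq_exp_iff_exists_int]
      exact ⟨k, by push_cast; ring⟩
    rw [this]; simp

lemma coeff_formula (n : ℕ) {t : ℝ} (ht : 0 < t) :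
    ∫ θ in (-π)..π, (P (Complex.exp (-(t - θ * Complex.I))))⁻¹ * Complex.exp (n * (t - θ * Complex.I))
      = 2 * π * (Fintype.card (Nat.Partition n) : ℂ) := by
  have hre : ∀ θ : ℝ, 0 < ((t : ℂ) - θ * Complex.I).re := by intro θ; simpa using ht
  let f : ℕ → ℝ → ℂ := fun m θ => (Fintype.card (Nat.Partition m) : ℂ) *
      (Complex.exp (-(t - θ * Complex.I)))^m * Complex.exp (n * (t - θ * Complex.I))
  have hf : ∀ m θ, f m θ = (Fintype.card (Nat.Partition m) : ℂ) * Complex.exp ((n - m) * t) *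
      Complex.exp (((m : ℤ) - (n : ℤ) : ℤ) * θ * Complex.I) := by
    intro m θ
    simp only [f]
    rw [← Complex.exp_nat_mul, mul_assoc, mul_assoc, ← Complex.exp_add, ← Complex.exp_add]
    congr 2
    push_cast; ring
  have hsum : HasSum (fun m => ∫ θ in (-π)..π, f m θ) (∫ θ in (-π)..π, (P (Complex.exp (-(t - θ * Complex.I))))⁻¹ * Complex.exp (n * (t - θ * Complex.I))) := by
    have hr : ‖Complex.exp (-(t:ℂ))‖ < 1 := norm_exp_neg (by simpa using ht)
    have hb := (summable_p hr).mul_right ‖Complex.exp (n * (t:ℂ))‖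
    refine intervalIntegral.hasSum_integral_of_dominated_convergence (fun m θ => ‖(Fintype.card (Nat.Partition m) : ℂ) * Complex.exp (-(t:ℂ)) ^ m‖ * ‖Complex.exp (n * (t:ℂ))‖) ?_ ?_ ?_ ?_ ?_
    · intro m
      apply Continuous.aestronglyMeasurable
      simp only [f]; fun_prop
    · intro m
      refine Eventually.of_forall fun θ _ => le_of_eq ?_
      simp only [f]
      simp [Complex.norm_exp]
    · exact Eventually.of_forall fun θ _ => hb
    · exact intervalIntegrable_const
    · refine Eventually.of_forall fun θ _ => ?_
      exact (hasSum_p (norm_exp_neg (hre θ))).mul_right _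
  have hval : ∀ m, ∫ θ in (-π)..π, f m θ = if m = n then 2 * π * (Fintype.card (Nat.Partition n) : ℂ) else 0 := by
    intro m
    simp only [hf]
    rw [intervalIntegral.integral_const_mul, integral_char]
    by_cases h : m = n
    · subst h; simp; ring
    · rw [if_neg (by omega), if_neg h, mul_zero]
  simp only [hval] at hsum
  exact hsum.unique (hasSum_ite_eq n _)

lemma transform {w : ℂ} (hw : 0 < w.re) :
    (P (Complex.exp (-w)))⁻¹ = (P (Complex.exp (-(4 * π ^ 2 / w))))⁻¹ *
      Complex.exp (π ^ 2 / (6 * w) - w / 24) * (Complex.sqrt (w / (2 * π) * Complex.I) / Complex.sqrt Complex.I) := by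
  have hw0 : w ≠ 0 := by rintro rfl; simp at hw
  have hpi : (π : ℂ) ≠ 0 := by exact_mod_cast Real.pi_ne_zero
  set τ : ℂ := w / (2 * π) * Complex.I with hτ
  have hτ0 : τ ≠ 0 := by simp [hτ, hw0, hpi]
  have him : 0 < τ.im := by
    have : τ = ((1 / (2 * π) : ℝ) : ℂ) * w * Complex.I := by rw [hτ]; push_cast; ring
    rw [this, Complex.mul_I_im, Complex.re_ofReal_mul]
    positivity
  have hinv : -1 / τ = 2 * π / w * Complex.I := by
    rw [hτ]; field_simp; simp
  have h := ModularForm.eta_comp_eq_csqrt_I_inv (x := τ) him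
  have hq : ∀ z : ℂ, ModularForm.eta z = Complex.exp (2 * π * Complex.I * z / 24) * P (Complex.exp (2 * π * Complex.I * z)) := by
    intro z
    simp [ModularForm.eta, P, ModularForm.eta_q, Function.Periodic.qParam]
  simp only [Function.comp, Pi.smul_apply, Pi.mul_apply, smul_eq_mul, hq, hinv] at h
  have e1 : 2 * π * Complex.I * (2 * π / w * Complex.I) = -(4 * π ^ 2 / w) := by
    linear_combination (4 * π ^ 2 / w) * Complex.I_sq
  have e2 : 2 * π * Complex.I * τ = -w := by
    rw [hτ]; field_simp; simp
  rw [e1, e2] at h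
  have hsI : Complex.sqrt Complex.I ≠ 0 := by simp [Complex.sqrt]
  have hsτ : Complex.sqrt τ ≠ 0 := by simp [Complex.sqrt, hτ0]
  have hP1 : P (Complex.exp (-w)) ≠ 0 := P_ne_zero (norm_exp_neg hw)
  have hw2 : 0 < (4 * π ^ 2 / w).re := by
    have : 4 * π ^ 2 / w = ((4 * π ^ 2 : ℝ) : ℂ) * w⁻¹ := by push_cast; ring
    rw [this, Complex.re_ofReal_mul, Complex.inv_re]
    have : 0 < Complex.normSq w := Complex.normSq_pos.2 hw0
    positivity
  have hP2 : P (Complex.exp (-(4 * π ^ 2 / w))) ≠ 0 := P_ne_zero (norm_exp_neg hw2)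
  have e3 : Complex.exp (π ^ 2 / (6 * w) - w / 24) = Complex.exp (-w / 24) / Complex.exp (-(4 * π ^ 2 / w) / 24) := by
    rw [← Complex.exp_sub]; congr 1; field_simp; ring
  rw [e3]
  have hE := Complex.exp_ne_zero (-(4 * π ^ 2 / w) / 24)
  field_simp
  field_simp at h
  linear_combination h

lemma factor_bound {z : ℂ} (hz : ‖z‖ < 1) :
    ‖(1 - z)⁻¹‖ ≤ (1 - ‖z‖)⁻¹ * Real.exp (z.re - ‖z‖) := by
  have h1 := (Complex.hasSum_taylorSeries_neg_log hz)
  have h2 := (Complex.hasSum_taylorSeries_neg_log (z := (‖z‖ : ℂ)) (by simpa using hz))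
  have h3 := Complex.hasSum_re (h1.sub h2)
  have hz1 : (1 : ℂ) - z ≠ 0 := by
    intro h; have : z = 1 := by linear_combination -h
    rw [this] at hz; simp at hz
  have hterm : ∀ n : ℕ, (z ^ n / n - (‖z‖ : ℂ) ^ n / n).re ≤ 0 := by
    intro n
    rcases Nat.eq_zero_or_pos n with rfl | hn
    · simp
    have : z ^ n / n - (‖z‖ : ℂ) ^ n / n = ((1 / n : ℝ) : ℂ) * (z ^ n - ((‖z‖ ^ n : ℝ) : ℂ)) := by
      push_cast; ring
    rw [this, Complex.re_ofReal_mul, Complex.sub_re, Complex.ofReal_re]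
    have h := Complex.re_le_norm (z ^ n)
    rw [norm_pow] at h
    apply mul_nonpos_of_nonneg_of_nonpos
    · positivity
    · linarith
  have h4 := sum_le_hasSum {1} (fun n _ => neg_nonneg.2 (hterm n)) h3.neg
  simp only [Finset.sum_singleton, Complex.sub_re, Complex.neg_re, Complex.log_re, pow_one, Nat.cast_one, div_one, Complex.ofReal_re] at h4
  have e : ‖(1 : ℂ) - ‖z‖‖ = 1 - ‖z‖ := by
    have : (1 : ℂ) - ‖z‖ = ((1 - ‖z‖ : ℝ) : ℂ) := by push_cast; ring
    rw [this, Complex.norm_real, Real.norm_of_nonneg (by linarith)]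
  rw [e] at h4
  have hp : 0 < ‖1 - z‖ := norm_pos_iff.2 hz1
  have hp2 : 0 < 1 - ‖z‖ := by linarith
  rw [norm_inv, ← Real.exp_log hp, ← Real.exp_log hp2, ← Real.exp_neg, ← Real.exp_neg, ← Real.exp_add]
  apply Real.exp_le_exp.2
  linarith

lemma P_bound {q : ℂ} (hq : ‖q‖ < 1) :
    ‖(P q)⁻¹‖ ≤ ‖(P (‖q‖:ℂ))⁻¹‖ * Real.exp ((1 - q)⁻¹.re - (1 - ‖q‖)⁻¹) := by
  have hr : ‖(‖q‖ : ℂ)‖ < 1 := by simpa using hq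
  have t1 := ((tendsto_P hq).inv₀ (P_ne_zero hq)).norm
  have t2 := ((tendsto_P hr).inv₀ (P_ne_zero hr)).norm
  have s1 := (Complex.hasSum_re (hasSum_geometric_of_norm_lt_one hq)).sub (hasSum_geometric_of_norm_lt_one (by simpa using hq : ‖‖q‖‖ < 1))
  have t3 : Tendsto (fun K => Real.exp (∑ i ∈ Finset.range (K+1), ((q^i).re - ‖q‖^i))) atTop (𝓝 (Real.exp ((1 - q)⁻¹.re - (1 - ‖q‖)⁻¹))) :=
    (Real.continuous_exp.tendsto _).comp ((tendsto_add_atTop_iff_nat 1).2 s1.tendsto_sum_nat)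
  refine le_of_tendsto_of_tendsto' t1 (t2.mul t3) fun K => ?_
  rw [Finset.sum_range_succ']
  simp only [pow_zero, Complex.one_re, sub_self, add_zero, Real.exp_sum, norm_inv, norm_prod, ← Finset.prod_inv_distrib]
  rw [← Finset.prod_mul_distrib]
  refine Finset.prod_le_prod (fun _ _ => by positivity) fun i _ => ?_
  have hz : ‖q ^ (i+1)‖ < 1 := by
    rw [norm_pow]; exact pow_lt_one₀ (norm_nonneg q) hq (Nat.succ_ne_zero i)
  have h := factor_bound hz
  have e : ‖(1 : ℂ) - (‖q‖:ℂ)^(i+1)‖ = 1 - ‖q ^ (i+1)‖ := by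
    have : (1 : ℂ) - (‖q‖:ℂ)^(i+1) = ((1 - ‖q ^ (i+1)‖ : ℝ) : ℂ) := by push_cast; rw [norm_pow]; push_cast; ring
    rw [this, Complex.norm_real, Real.norm_of_nonneg (by linarith)]
  rw [e]
  rw [norm_inv] at h
  simpa [norm_pow] using h

noncomputable def T (x : ℝ) : ℝ := π ^ 2 / (6 * x ^ 2)

noncomputable def W (x s : ℝ) : ℂ := T x * (1 - (s / x : ℝ) * Complex.I)

noncomputable def G (x s : ℝ) : ℂ :=
  (P (Complex.exp (-W x s)))⁻¹ * Complex.exp (x ^ 2 * (1 - (s / x : ℝ) * Complex.I)) /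
    ((√(T x / (2 * π)) * Real.exp (2 * x ^ 2) : ℝ) : ℂ)

lemma T_pos {x : ℝ} (hx : 0 < x) : 0 < T x := by unfold T; positivity

lemma W_re (x s : ℝ) : (W x s).re = T x := by simp [W]

lemma G_eq {x : ℝ} (hx : 0 < x) (s : ℝ) : G x s =
    (P (Complex.exp (-(24 * x ^ 2 / (1 - (s / x : ℝ) * Complex.I)))))⁻¹ *
    Complex.exp (- s ^ 2 / (1 - (s / x : ℝ) * Complex.I)) * Complex.exp (-W x s / 24) *
    (Complex.sqrt ((1 - (s / x : ℝ) * Complex.I) * Complex.I) / Complex.sqrt Complex.I) := by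
  have hT := T_pos hx
  have hpi : (π : ℂ) ≠ 0 := by exact_mod_cast Real.pi_ne_zero
  have hx0 : (x : ℂ) ≠ 0 := by exact_mod_cast hx.ne'
  have hu0 : (1 - (s / x : ℝ) * Complex.I : ℂ) ≠ 0 := by
    intro h; have := congrArg Complex.re h; simp at this
  unfold G
  rw [transform (by rw [W_re]; exact hT)]
  have e1 : (4 * π ^ 2 / W x s : ℂ) = 24 * x ^ 2 / (1 - (s / x : ℝ) * Complex.I) := by
    simp only [W, T]; push_cast at hu0 ⊢; field_simp; ring
  have e2 : Complex.sqrt (W x s / (2 * π) * Complex.I) = (√(T x / (2 * π)) : ℝ) * Complex.sqrt ((1 - (s / x : ℝ) * Complex.I) * Complex.I) := by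
    have h : W x s / (2 * π) * Complex.I = ((T x / (2 * π) : ℝ) : ℂ) * ((1 - (s / x : ℝ) * Complex.I) * Complex.I) := by
      simp only [W]; push_cast; ring
    rw [h]
    have hp : 0 < T x / (2 * π) := by positivity
    have hz : (1 - (s / x : ℝ) * Complex.I) * Complex.I ≠ 0 := mul_ne_zero hu0 Complex.I_ne_zero
    have hpc : ((T x / (2 * π) : ℝ) : ℂ) ≠ 0 := by exact_mod_cast hp.ne'
    unfold Complex.sqrt
    rw [Complex.cpow_def_of_ne_zero (mul_ne_zero hpc hz), Complex.cpow_def_of_ne_zero hz,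
      Complex.log_ofReal_mul hp hz, add_mul, Complex.exp_add, Real.sqrt_eq_rpow,
      Real.rpow_def_of_pos hp]
    push_cast
    norm_num
  have e3 : Complex.exp (π ^ 2 / (6 * W x s) - W x s / 24) * Complex.exp (x ^ 2 * (1 - (s / x : ℝ) * Complex.I)) =
      Complex.exp (- s ^ 2 / (1 - (s / x : ℝ) * Complex.I)) * Complex.exp (-W x s / 24) * ((Real.exp (2 * x ^ 2) : ℝ) : ℂ) := by
    rw [Complex.ofReal_exp, ← Complex.exp_add, ← Complex.exp_add, ← Complex.exp_add]
    congr 1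
    have : (π ^ 2 / (6 * W x s) : ℂ) = x ^ 2 / (1 - (s / x : ℝ) * Complex.I) := by
      simp only [W, T]; push_cast at hu0 ⊢; field_simp
    rw [this]
    have hv : (s : ℂ) = x * ((s / x : ℝ) : ℂ) := by push_cast; field_simp
    generalize ((s / x : ℝ) : ℂ) = v at hv hu0 ⊢
    rw [hv]; push_cast; field_simp
    linear_combination (x^2 * v^2 *24: ℂ) * Complex.I_sq
  rw [e1, e2]
  have hs0 : ((√(T x / (2 * π)) : ℝ) : ℂ) ≠ 0 := by
    have : 0 < √(T x / (2 * π)) := by positivity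
    exact_mod_cast this.ne'
  have hE0 : ((Real.exp (2 * x ^ 2) : ℝ) : ℂ) ≠ 0 := by exact_mod_cast (Real.exp_pos _).ne'
  push_cast at *
  rw [div_eq_iff (mul_ne_zero hs0 hE0)]
  linear_combination (P (Complex.exp (-(24 * x ^ 2 / (1 - (s / x) * Complex.I)))))⁻¹ * (√(T x / (2 * π)) : ℂ) *
    (Complex.sqrt ((1 - (s / x) * Complex.I) * Complex.I) / Complex.sqrt Complex.I) * e3

lemma G_tendsto (s : ℝ) : Tendsto (fun x => G x s) atTop (𝓝 (Complex.exp (-s ^ 2))) := by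
  have hu : Tendsto (fun x : ℝ => (1 - (s / x : ℝ) * Complex.I : ℂ)) atTop (𝓝 1) := by
    have h1 : Tendsto (fun x : ℝ => s / x) atTop (𝓝 0) := tendsto_const_nhds.div_atTop tendsto_id
    have h2 := (Complex.continuous_ofReal.tendsto 0).comp h1
    have h3 := (h2.mul_const Complex.I).const_sub (1:ℂ)
    simpa using h3
  have hT : Tendsto T atTop (𝓝 0) := by
    unfold T
    exact tendsto_const_nhds.div_atTop (((tendsto_pow_atTop (by norm_num))).const_mul_atTop (by norm_num))
  have hW : Tendsto (fun x => W x s) atTop (𝓝 0) := by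
    have h2 := (Complex.continuous_ofReal.tendsto 0).comp hT
    have h3 := h2.mul hu
    rw [Complex.ofReal_zero, zero_mul] at h3
    exact h3
  have hq : Tendsto (fun x : ℝ => Complex.exp (-(24 * x ^ 2 / (1 - (s / x : ℝ) * Complex.I)))) atTop (𝓝 0) := by
    rw [tendsto_zero_iff_norm_tendsto_zero]
    simp only [Complex.norm_exp]
    refine Real.tendsto_exp_atBot.comp ?_
    have hinv : Tendsto (fun x : ℝ => ((1 - (s / x : ℝ) * Complex.I : ℂ)⁻¹).re) atTop (𝓝 1) := by
      have := (Complex.continuous_re.tendsto _).comp (hu.inv₀ one_ne_zero)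
      rw [inv_one, Complex.one_re] at this
      exact this
    have h3 : Tendsto (fun x : ℝ => 24 * x ^ 2) atTop atTop := ((tendsto_pow_atTop (by norm_num))).const_mul_atTop (by norm_num)
    have h4 := tendsto_neg_atTop_atBot.comp (h3.atTop_mul_pos one_pos hinv)
    refine h4.congr fun x => ?_
    simp only [Function.comp, Complex.neg_re, neg_inj]
    rw [div_eq_mul_inv (24 * (x:ℂ) ^ 2), show (24 * (x:ℂ) ^ 2) = ((24 * x ^ 2 : ℝ) : ℂ) by push_cast; ring, Complex.re_ofReal_mul]
  have hP : Tendsto (fun x : ℝ => P (Complex.exp (-(24 * x ^ 2 / (1 - (s / x : ℝ) * Complex.I))))) atTop (𝓝 1) := by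
    have hc : ContinuousAt P 0 := ModularForm.differentiableOn_tprod_one_sub_pow.continuousOn.continuousAt (Metric.ball_mem_nhds _ one_pos)
    have := hc.tendsto.comp hq
    have h0 : P 0 = 1 := by simp [P]
    rwa [h0] at this
  have hE : Tendsto (fun x : ℝ => Complex.exp (- s ^ 2 / (1 - (s / x : ℝ) * Complex.I))) atTop (𝓝 (Complex.exp (-s ^ 2))) := by
    refine (Complex.continuous_exp.tendsto _).comp ?_
    have := (tendsto_const_nhds (x := (-s ^ 2 : ℂ))).div hu one_ne_zero
    rw [div_one] at this
    exact this
  have hE2 : Tendsto (fun x : ℝ => Complex.exp (-W x s / 24)) atTop (𝓝 1) := by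
    have := (Complex.continuous_exp.tendsto _).comp (hW.neg.div_const 24)
    rw [neg_zero, zero_div, Complex.exp_zero] at this
    exact this
  have hS : Tendsto (fun x : ℝ => Complex.sqrt ((1 - (s / x : ℝ) * Complex.I) * Complex.I) / Complex.sqrt Complex.I) atTop (𝓝 1) := by
    have hsI : Complex.sqrt Complex.I ≠ 0 := by simp [Complex.sqrt]
    have hc : ContinuousAt Complex.sqrt (1 * Complex.I) := Complex.continuousAt_sqrt (by simp)
    have := (hc.tendsto.comp (hu.mul_const Complex.I)).div_const (Complex.sqrt Complex.I)
    rwa [one_mul, div_self hsI] at this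
  have := ((hP.inv₀ one_ne_zero).mul hE).mul hE2 |>.mul hS
  simp only [inv_one, one_mul, mul_one] at this
  refine this.congr' ?_
  filter_upwards [eventually_gt_atTop 0] with x hx
  exact (G_eq hx s).symm

lemma G_continuous {x : ℝ} (hx : 0 < x) : Continuous (G x) := by
  have hc : ContinuousOn P (Metric.ball 0 1) := ModularForm.differentiableOn_tprod_one_sub_pow.continuousOn
  have hW : Continuous (W x) := by unfold W; fun_prop
  have h1 : Continuous (fun s => P (Complex.exp (-W x s))) :=
    hc.comp_continuous (by fun_prop) (fun s => by
      simpa using norm_exp_neg (by rw [W_re]; exact T_pos hx : 0 < (W x s).re))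
  have h2 := h1.inv₀ (fun s => P_ne_zero (norm_exp_neg (by rw [W_re]; exact T_pos hx)))
  unfold G
  exact (h2.mul (by fun_prop)).div_const _

lemma gain_bound {t θ : ℝ} (ht : 0 < t) (ht1 : t ≤ 1 / 2) (hθ : |θ| ≤ π) :
    (1 - Complex.exp (-(t - θ * Complex.I)))⁻¹.re - (1 - Real.exp (-t))⁻¹ ≤
      - (θ ^ 2 / (t * (10 * t ^ 2 + 2 * θ ^ 2))) := by
  set r := Real.exp (-t) with hr
  have hr1 : r < 1 := by rw [hr]; simpa using ht
  have hr2 : 1 - t ≤ r := by have := Real.add_one_le_exp (-t); linarith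
  have hq : Complex.exp (-(t - θ * Complex.I)) = r * (Real.cos θ + Real.sin θ * Complex.I) := by
    rw [show -((t:ℂ) - θ * Complex.I) = ((-t : ℝ) : ℂ) + θ * Complex.I by push_cast; ring, Complex.exp_add, Complex.exp_mul_I, hr]
    push_cast; ring
  have hcos := Real.cos_le_one_sub_mul_cos_sq hθ
  have hpi : π ^ 2 ≤ 10 := by nlinarith [Real.pi_lt_d2, Real.pi_pos]
  set y := r * (1 - Real.cos θ) with hy
  have hx : θ ^ 2 / 10 ≤ y := by
    have h1 : θ ^ 2 / 5 ≤ 1 - Real.cos θ := by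
      have : θ ^ 2 / 5 ≤ 2 / π ^ 2 * θ ^ 2 := by
        have : (1:ℝ) / 5 ≤ 2 / π ^ 2 := by
          rw [div_le_div_iff₀ (by norm_num) (by positivity)]; linarith
        nlinarith [sq_nonneg θ]
      linarith
    have h2 : 0 ≤ θ ^ 2 / 5 := by positivity
    rw [hy]
    nlinarith
  have hb : 0 < 1 - r := by linarith
  have hy0 : 0 ≤ y := le_trans (by positivity) hx
  have hre : (1 - Complex.exp (-(t - θ * Complex.I)))⁻¹.re = ((1 - r) + y) / ((1-r)^2 + 2 * y) := by
    rw [hq, Complex.inv_re]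
    congr 1
    · simp [Complex.cos_ofReal_re, hy]; ring
    · rw [Complex.normSq_apply]
      simp [Complex.cos_ofReal_re, Complex.sin_ofReal_re, hy]
      nlinarith [Real.sin_sq_add_cos_sq θ]
  rw [hre]
  have hd : 0 < (1-r)^2 + 2 * y := by positivity
  have e : ((1 - r) + y) / ((1-r)^2 + 2 * y) - (1 - r)⁻¹ = - (y * (1 + r) / ((1 - r) * ((1-r)^2 + 2 * y))) := by
    field_simp; ring
  rw [e]
  apply neg_le_neg
  have hd2 : 0 < 10 * t ^ 2 + 2 * θ ^ 2 := by positivity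
  calc θ ^ 2 / (t * (10 * t ^ 2 + 2 * θ ^ 2)) ≤ y / (t * (t ^ 2 + 2 * y)) := by
        rw [div_le_div_iff₀ (by positivity) (by positivity)]
        have : 0 ≤ t ^ 3 * (10 * y - θ ^ 2) := mul_nonneg (by positivity) (by linarith)
        nlinarith
    _ ≤ y / ((1 - r) * ((1-r)^2 + 2 * y)) := by
        have : 1 - r ≤ t := by linarith
        gcongr
    _ ≤ _ := by
        have : 0 < r := Real.exp_pos _
        gcongr
        nlinarith

lemma G_norm {x s : ℝ} (hx : 0 < x) (ht : T x ≤ 1 / 2) (hs : |s| ≤ π * x / T x) :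
    ‖G x s‖ ≤ ‖G x 0‖ * Real.exp (-(s ^ 2 / (T x * (10 * x ^ 2 + 2 * s ^ 2)))) := by
  have hT := T_pos hx
  have hq : ‖Complex.exp (-W x s)‖ < 1 := norm_exp_neg (by rw [W_re]; exact hT)
  have hn : ‖Complex.exp (-W x s)‖ = Real.exp (-T x) := by
    rw [Complex.norm_exp, Complex.neg_re, W_re]
  have hb := P_bound hq
  rw [hn] at hb
  have hW : W x s = T x - (T x * s / x : ℝ) * Complex.I := by
    simp only [W]; push_cast; ring
  have hθ : |T x * s / x| ≤ π := by
    rw [abs_div, abs_mul, abs_of_pos hT, abs_of_pos hx, div_le_iff₀ hx]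
    rwa [le_div_iff₀ hT, mul_comm] at hs
  have hg := gain_bound hT ht hθ
  rw [← hW] at hg
  have e1 : (T x * s / x) ^ 2 / (T x * (10 * T x ^ 2 + 2 * (T x * s / x) ^ 2)) =
      s ^ 2 / (T x * (10 * x ^ 2 + 2 * s ^ 2)) := by
    have : 0 < 10 * x ^ 2 + 2 * s ^ 2 := by positivity
    field_simp
  rw [e1] at hg
  have e2 : (P (Complex.exp (-W x 0))) = P (Real.exp (-T x) : ℝ) := by
    simp [W]
  have e3 : ∀ s : ℝ, ‖Complex.exp (x ^ 2 * (1 - (s / x : ℝ) * Complex.I))‖ = Real.exp (x ^ 2) := by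
    intro s
    rw [Complex.norm_exp, show (x:ℂ)^2 = ((x ^ 2 : ℝ) : ℂ) by push_cast; ring, Complex.re_ofReal_mul]
    simp
  unfold G
  rw [norm_div, norm_div, norm_mul, norm_mul, e3, e3, e2, div_mul_eq_mul_div]
  gcongr ?_ / _
  calc _ ≤ (‖(P (Real.exp (-T x) : ℝ))⁻¹‖ * Real.exp (-(s ^ 2 / (T x * (10 * x ^ 2 + 2 * s ^ 2))))) * Real.exp (x ^ 2) := by
        gcongr
        refine hb.trans ?_
        gcongr
    _ = _ := by ring

lemma dom_bound {x s : ℝ} (hx : 1 ≤ x) (hs : |s| ≤ π * x / T x) :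
    Real.exp (-(s ^ 2 / (T x * (10 * x ^ 2 + 2 * s ^ 2)))) ≤ 500000 * (1 + s ^ 2)⁻¹ := by
  have hx0 : 0 < x := by linarith
  have hT := T_pos hx0
  have hD : 0 < 10 * x ^ 2 + 2 * s ^ 2 := by positivity
  have hpi : π ^ 2 ≤ 12 := by nlinarith [Real.pi_lt_d2, Real.pi_pos]
  have hTx : T x * x ^ 2 = π ^ 2 / 6 := by unfold T; field_simp
  have hT2 : T x * x ^ 2 ≤ 2 := by rw [hTx]; linarith
  set g := s ^ 2 / (T x * (10 * x ^ 2 + 2 * s ^ 2)) with hg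
  rw [Real.exp_neg, ← one_div, ← div_eq_mul_inv, div_le_div_iff₀ (Real.exp_pos _) (by positivity), one_mul]
  rcases le_total (s ^ 2) (x ^ 2) with h | h
  · have h1 : s ^ 2 / 24 ≤ g := by
      rw [hg, div_le_div_iff₀ (by norm_num) (by positivity)]
      have : T x * (10 * x ^ 2 + 2 * s ^ 2) ≤ 24 := by nlinarith
      exact mul_le_mul_of_nonneg_left this (by positivity)
    have := Real.add_one_le_exp g
    nlinarith [sq_nonneg s]
  · have h1 : x ^ 2 / 24 ≤ g := by
      rw [hg, div_le_div_iff₀ (by norm_num) (by positivity)]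
      have : T x * (10 * x ^ 2 + 2 * s ^ 2) ≤ T x * (12 * s ^ 2) := by
        apply mul_le_mul_of_nonneg_left _ hT.le; linarith
      have h3 : x ^ 2 * (T x * (12 * s ^ 2)) = (T x * x ^ 2) * (12 * s ^ 2) := by ring
      have h4 : (T x * x ^ 2) * (12 * s ^ 2) ≤ 2 * (12 * s ^ 2) := mul_le_mul_of_nonneg_right hT2 (by positivity)
      have h5 := mul_le_mul_of_nonneg_left this (sq_nonneg x)
      linarith
    have h2 := Real.pow_div_factorial_le_exp (x := x^2/24) (by positivity) 3
    have h3 : Real.exp (x^2/24) ≤ Real.exp g := Real.exp_le_exp.2 h1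
    have h4 : |s| ≤ 2 * x ^ 3 := by
      refine hs.trans ?_
      have : π * x / T x = 6 / π * x ^ 3 := by unfold T; field_simp
      rw [this]
      gcongr
      rw [div_le_iff₀ Real.pi_pos]; linarith [Real.pi_gt_three]
    have h5 : s ^ 2 ≤ 4 * x ^ 6 := by
      rw [← sq_abs]
      calc |s| ^ 2 ≤ (2 * x ^ 3) ^ 2 := by gcongr
        _ = _ := by ring
    have h6 : 1 ≤ x ^ 6 := one_le_pow₀ hx
    have h7 : (x^2/24)^3 / (Nat.factorial 3 : ℝ) = x ^ 6 / 82944 := by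
      norm_num [Nat.factorial]; ring
    rw [h7] at h2
    linarith

lemma integral_tendsto : Tendsto (fun x : ℝ => ∫ s in (-(π * x / T x))..(π * x / T x), G x s) atTop (𝓝 (√π : ℝ)) := by
  have hlim : ∫ s : ℝ, Complex.exp (-(s:ℂ) ^ 2) = (√π : ℝ) := by
    have := integral_gaussian 1
    rw [div_one] at this
    rw [← this, ← integral_complex_ofReal]
    congr 1
    ext s
    push_cast; simp
  have hTt : Tendsto T atTop (𝓝 0) := by
    unfold T
    exact tendsto_const_nhds.div_atTop (((tendsto_pow_atTop (by norm_num))).const_mul_atTop (by norm_num))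
  have hT2 : ∀ᶠ x in atTop, T x ≤ 1 / 2 := hTt.eventually (ge_mem_nhds (by norm_num))
  have hG0 : ∀ᶠ x in atTop, ‖G x 0‖ ≤ 2 := by
    have := (G_tendsto 0).norm
    refine this.eventually (ge_mem_nhds ?_)
    simp
  have key : Tendsto (fun x : ℝ => ∫ s, (Set.Ioc (-(π * x / T x)) (π * x / T x)).indicator (G x) s) atTop
      (𝓝 (∫ s : ℝ, Complex.exp (-(s:ℂ) ^ 2))) := by
    refine MeasureTheory.tendsto_integral_filter_of_dominated_convergence (fun s => 2 * (500000 * (1 + s ^ 2)⁻¹)) ?_ ?_ ?_ ?_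
    · filter_upwards [eventually_gt_atTop 0] with x hx
      exact (G_continuous hx).aestronglyMeasurable.indicator measurableSet_Ioc
    · filter_upwards [eventually_ge_atTop 1, hT2, hG0] with x hx ht h0
      refine Eventually.of_forall fun s => ?_
      by_cases hs : s ∈ Set.Ioc (-(π * x / T x)) (π * x / T x)
      · rw [Set.indicator_of_mem hs]
        have hs' : |s| ≤ π * x / T x := abs_le.2 ⟨hs.1.le, hs.2⟩
        refine (G_norm (by linarith) ht hs').trans ?_
        gcongr
        exact dom_bound hx hs'
      · rw [Set.indicator_of_notMem hs, norm_zero]; positivity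
    · exact (integrable_inv_one_add_sq.const_mul _).const_mul _
    · refine Eventually.of_forall fun s => ?_
      refine (G_tendsto s).congr' ?_
      have : Tendsto (fun x => π * x / T x) atTop atTop := by
        have h : Tendsto (fun x : ℝ => 6 / π * x ^ 3) atTop atTop :=
          (tendsto_pow_atTop (by norm_num)).const_mul_atTop (by positivity)
        refine h.congr' ?_
        filter_upwards [eventually_gt_atTop 0] with x hx
        unfold T; field_simp
      filter_upwards [this.eventually (eventually_gt_atTop |s|)] with x hx
      rw [Set.indicator_of_mem]
      exact ⟨(abs_lt.1 hx).1, (abs_lt.1 hx).2.le⟩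
  rw [hlim] at key
  refine key.congr' ?_
  filter_upwards [eventually_gt_atTop 0] with x hx
  have hT := T_pos hx
  have : 0 < π * x / T x := by positivity
  rw [intervalIntegral.integral_of_le (by linarith), MeasureTheory.integral_indicator measurableSet_Ioc]

lemma card_eq (n : ℕ) {x : ℝ} (hx : 0 < x) (hn : (n : ℝ) * T x = x ^ 2) :
    2 * π * (Fintype.card (Nat.Partition n) : ℂ) =
      ((T x / x * (√(T x / (2 * π)) * Real.exp (2 * x ^ 2)) : ℝ) : ℂ) *
        ∫ s in (-(π * x / T x))..(π * x / T x), G x s := by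
  have hT := T_pos hx
  rw [← coeff_formula n hT]
  have h := intervalIntegral.smul_integral_comp_mul_left (a := -(π * x / T x)) (b := π * x / T x)
    (f := fun θ : ℝ => (P (Complex.exp (-(T x - θ * Complex.I))))⁻¹ * Complex.exp (n * (T x - θ * Complex.I))) (T x / x)
  have e1 : T x / x * -(π * x / T x) = -π := by field_simp
  have e2 : T x / x * (π * x / T x) = π := by field_simp
  rw [e1, e2] at h
  rw [← h]
  have hpos : 0 < √(T x / (2 * π)) * Real.exp (2 * x ^ 2) := by positivity
  have hc : ((√(T x / (2 * π)) * Real.exp (2 * x ^ 2) : ℝ) : ℂ) ≠ 0 := by exact_mod_cast hpos.ne'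
  have hG : ∀ s : ℝ, (P (Complex.exp (-(T x - (T x / x * s : ℝ) * Complex.I))))⁻¹ * Complex.exp (n * (T x - (T x / x * s : ℝ) * Complex.I))
      = ((√(T x / (2 * π)) * Real.exp (2 * x ^ 2) : ℝ) : ℂ) * G x s := by
    intro s
    unfold G
    rw [mul_div_cancel₀ _ hc]
    have e3 : (T x - (T x / x * s : ℝ) * Complex.I : ℂ) = W x s := by
      simp only [W]; push_cast; ring
    have e4 : (n * W x s : ℂ) = x ^ 2 * (1 - (s / x : ℝ) * Complex.I) := by
      have : (n * T x : ℂ) = x ^ 2 := by exact_mod_cast hn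
      simp only [W]; rw [← mul_assoc, this]
    rw [e3, e4]
  simp only [hG]
  rw [intervalIntegral.integral_const_mul, Complex.real_smul]
  push_cast; ring

end HR

/-- **Asymptotics of the number of S5 frames.** The number of isomorphism
classes of S5 modal frames with `n` worlds, which equals the partition number
`p(n) = Fintype.card (Nat.Partition n)`, is asymptotically the Hardy–Ramanujan
number `(1 / (4 √3 n)) · exp (π √(2n/3))`. -/
theorem partition_isEquivalent_hardyRamanujan :
    Asymptotics.IsEquivalent Filter.atTop
      (fun n : ℕ => (Fintype.card (Nat.Partition n) : ℝ))
      (fun n : ℕ =>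
        (1 / (4 * Real.sqrt 3 * n)) * Real.exp (Real.pi * Real.sqrt (2 * n / 3))) := by
  let X : ℕ → ℝ := fun n => √(π * √(n / 6))
  have hX : Tendsto X atTop atTop := by
    have h1 : Tendsto (fun n : ℕ => (n : ℝ) / 6) atTop atTop :=
      tendsto_natCast_atTop_atTop.atTop_div_const (by norm_num)
    exact Real.tendsto_sqrt_atTop.comp ((Real.tendsto_sqrt_atTop.comp h1).const_mul_atTop Real.pi_pos)
  have hlim := ((Complex.continuous_re.tendsto _).comp (HR.integral_tendsto.comp hX)).div_const (√π)
  rw [Complex.ofReal_re, div_self (by positivity)] at hlim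
  refine (isEquivalent_iff_tendsto_one ?_).2 ?_
  · filter_upwards [eventually_gt_atTop 0] with n hn
    have : (0:ℝ) < n := by exact_mod_cast hn
    positivity
  refine hlim.congr' ?_
  filter_upwards [eventually_gt_atTop 0] with n hn
  have hn0 : (0:ℝ) < n := by exact_mod_cast hn
  have hX0 : 0 < X n := by simp only [X]; positivity
  have hX2 : X n ^ 2 = π * √(n / 6) := Real.sq_sqrt (by positivity)
  have hX4 : X n ^ 4 = π ^ 2 * (n / 6) := by
    rw [show X n ^ 4 = (X n ^ 2) ^ 2 by ring, hX2, mul_pow, Real.sq_sqrt (by positivity)]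
  have hnT : (n : ℝ) * HR.T (X n) = X n ^ 2 := by
    unfold HR.T; field_simp; linarith
  have hc := HR.card_eq n hX0 hnT
  have hc' := congrArg Complex.re hc
  rw [Complex.re_ofReal_mul] at hc'
  have e0 : (2 * (π : ℂ) * (Fintype.card (Nat.Partition n) : ℂ)).re = 2 * π * (Fintype.card (Nat.Partition n) : ℝ) := by
    rw [show (2 * (π : ℂ) * (Fintype.card (Nat.Partition n) : ℂ)) = ((2 * π * (Fintype.card (Nat.Partition n) : ℝ) : ℝ) : ℂ) by push_cast; ring, Complex.ofReal_re]
  rw [e0] at hc'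
  have hE : 2 * X n ^ 2 = π * √(2 * n / 3) := by
    rw [hX2, show (2 * n / 3 : ℝ) = 2 ^ 2 * (n / 6) by ring, Real.sqrt_mul (by positivity), Real.sqrt_sq (by norm_num)]
    ring
  rw [hE] at hc'
  simp only [Function.comp, Pi.div_apply]
  set J := (∫ s in (-(π * X n / HR.T (X n)))..(π * X n / HR.T (X n)), HR.G (X n) s).re with hJ
  have hp : (Fintype.card (Nat.Partition n) : ℝ) = HR.T (X n) / X n * √(HR.T (X n) / (2 * π)) / (2 * π) * J * Real.exp (π * √(2 * n / 3)) := by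
    field_simp
    field_simp at hc'
    linarith
  rw [hp]
  have hT := HR.T_pos hX0
  have hconst : HR.T (X n) / X n * √(HR.T (X n) / (2 * π)) / (2 * π) * (4 * √3 * n) = 1 / √π := by
    have hs : √(HR.T (X n) / (2 * π)) = √π / (√3 * 2 * X n) := by
      rw [Real.sqrt_eq_iff_mul_self_eq (by positivity) (by positivity)]
      have h3 : √3 * √3 = 3 := Real.mul_self_sqrt (by norm_num)
      have hpi : √π * √π = π := Real.mul_self_sqrt Real.pi_pos.le
      rw [div_mul_div_comm, hpi, show √3 * 2 * X n * (√3 * 2 * X n) = (√3 * √3) * 4 * X n ^ 2 by ring, h3]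
      unfold HR.T; field_simp; norm_num
    rw [hs]
    have hpi : √π ^ 2 = π := Real.sq_sqrt Real.pi_pos.le
    have : HR.T (X n) * n = X n ^ 2 := by linarith
    field_simp
    rw [hpi]
    linear_combination (4 * π) * this
  have hexp := Real.exp_pos (π * √(2 * n / 3))
  have h3 : 0 < √3 := by positivity
  have e5 : J / √π = J * (1 / √π) := by ring
  rw [e5, ← hconst]
  field_simp
end

section
/- (An arbitrary modal frame is almost surely not S5) Let a(n) denote the number of isomorphism classes of binary relations on Fin n (relations up to conjugation by a permutation of Fin n), and let p(n) = Fintype.card (Nat.Partition n) denote the number of isomorphism classes of S5 modal frames on n worlds. Then the ratio p(n) / a(n) tends to 0 as n → ∞; that is, the probability that an arbitrary modal frame on n worlds is an S5 modal frame tends to zero. -/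
open Filter

/-- Two binary relations on `Fin n` are isomorphic iff some permutation of
`Fin n` transports one to the other. -/
def relIso (n : ℕ) (r r' : Fin n → Fin n → Prop) : Prop :=
  ∃ σ : Equiv.Perm (Fin n), ∀ i j : Fin n, r i j ↔ r' (σ i) (σ j)

/-- `a n`: the number of isomorphism classes of binary relations on `Fin n`,
i.e. the number of modal frames on `n` worlds up to isomorphism. -/
noncomputable def numRelClasses (n : ℕ) : ℕ :=
  Nat.card (Quot (relIso n))

theorem relIso_equiv (n : ℕ) : Equivalence (relIso n) := by
  refine ⟨fun r => ⟨1, fun i j => Iff.rfl⟩, ?_, ?_⟩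
  · rintro r s ⟨σ, h⟩
    refine ⟨σ⁻¹, fun i j => ?_⟩
    rw [h]; simp
  · rintro r s t ⟨σ, h⟩ ⟨τ, h'⟩
    refine ⟨τ * σ, fun i j => ?_⟩
    rw [h, h']; rfl

theorem numRel_lower (n : ℕ) : 2 ^ (n ^ 2) ≤ numRelClasses n * n.factorial := by
  classical
  have hs : Function.Surjective
      (fun p : Quot (relIso n) × Equiv.Perm (Fin n) =>
        (fun i j => Quot.out p.1 (p.2 i) (p.2 j) : Fin n → Fin n → Prop)) := by
    intro r
    have h : Quot.mk (relIso n) (Quot.out (Quot.mk (relIso n) r)) = Quot.mk (relIso n) r :=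
      Quot.out_eq _
    have h2 : relIso n (Quot.out (Quot.mk (relIso n) r)) r :=
      (relIso_equiv n).eqvGen_iff.1 (Quot.eqvGen_exact h)
    obtain ⟨σ, hσ⟩ := h2
    refine ⟨(Quot.mk _ r, σ⁻¹), ?_⟩
    funext i j
    apply propext
    have := hσ (σ⁻¹ i) (σ⁻¹ j)
    simpa using this
  have := Nat.card_le_card_of_surjective _ hs
  rw [Nat.card_prod] at this
  simpa [numRelClasses, Nat.card_eq_fintype_card, Fintype.card_perm, ← pow_mul, sq] using this

theorem part_upper (n : ℕ) : Fintype.card (Nat.Partition n) ≤ 2 ^ n := by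
  have h := Fintype.card_le_of_surjective _ (Nat.Partition.ofComposition_surj (n := n))
  rw [composition_card] at h
  exact h.trans (Nat.pow_le_pow_right (by norm_num) (Nat.sub_le _ _))

theorem arith_bound (n : ℕ) : 2 ^ n * n.factorial * (n + 1) ≤ 2 * 2 ^ (n ^ 2) := by
  rcases Nat.eq_zero_or_pos n with rfl | hn
  · simp
  induction n, hn using Nat.le_induction with
  | base => simp [Nat.factorial]
  | succ n hn ih =>
    have h1 : n + 2 ≤ 2 ^ (2 * n) := by
      have := Nat.lt_two_pow_self (n := 2 * n)
      omega
    calc 2 ^ (n + 1) * (n + 1).factorial * (n + 1 + 1)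
        = (2 ^ n * n.factorial * (n + 1)) * (2 * (n + 2)) := by
          rw [Nat.factorial_succ]; ring
      _ ≤ (2 * 2 ^ (n ^ 2)) * (2 * 2 ^ (2 * n)) := by gcongr
      _ = 2 * 2 ^ ((n + 1) ^ 2) := by ring

/-- **An arbitrary modal frame is almost surely not S5.** The ratio of the
number `p(n)` of isomorphism classes of S5 modal frames on `n` worlds to the
number `a(n)` of isomorphism classes of all modal frames on `n` worlds tends
to `0` as `n → ∞`. -/
theorem s5_frames_probability_zero :
    Filter.Tendsto
      (fun n : ℕ => (Fintype.card (Nat.Partition n) : ℝ) / (numRelClasses n : ℝ))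
      Filter.atTop (nhds 0) := by
  have hlim : Tendsto (fun n : ℕ => 2 * (1 / ((n : ℝ) + 1))) atTop (nhds 0) := by
    simpa using (tendsto_one_div_add_atTop_nhds_zero_nat (𝕜 := ℝ)).const_mul 2
  refine squeeze_zero (fun n => by positivity) (fun n => ?_) hlim
  have hl := numRel_lower n
  have hpos : 0 < numRelClasses n := by
    rcases Nat.eq_zero_or_pos (numRelClasses n) with h | h
    · rw [h, zero_mul] at hl
      have : 0 < 2 ^ (n ^ 2) := by positivity
      omega
    · exact h
  have key : Fintype.card (Nat.Partition n) * (n + 1) ≤ 2 * numRelClasses n := by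
    refine Nat.le_of_mul_le_mul_right ?_ n.factorial_pos
    calc Fintype.card (Nat.Partition n) * (n + 1) * n.factorial
        ≤ 2 ^ n * (n + 1) * n.factorial := by gcongr; exact part_upper n
      _ = 2 ^ n * n.factorial * (n + 1) := by ring
      _ ≤ 2 * 2 ^ (n ^ 2) := arith_bound n
      _ ≤ 2 * (numRelClasses n * n.factorial) := by gcongr
      _ = _ := by ring
  have hposR : (0 : ℝ) < numRelClasses n := by exact_mod_cast hpos
  have hn : (0 : ℝ) < (n : ℝ) + 1 := by positivity
  rw [mul_one_div, div_le_div_iff₀ hposR hn]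
  exact_mod_cast key
end
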